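/- Fix d = 2. For every resistivity η > 0 and constants T > 0, M > 0, R > 0, there exist a viscosity ν = ν(M, R, η, T) ≥ 1 and a smooth divergence-free zero-average field b₀ : 𝕋² → ℝ² with ‖b₀‖_{L²} = M such that the following holds: for any smooth divergence-free zero-average u₀ : 𝕋² → ℝ² with ‖u₀‖_{H⁴} = R, there is a global smooth solution (u, b, P) of the MHD system on 𝕋² with viscosity ν, resistivity η and initial datum (u₀, b₀), such that u(t,·) and b(t,·) have zero average for all t ≥ 0 and there is no homeomorphism of 𝕋² onto itself mapping the family of magnetic lines of b(0,·) onto the family of magnetic lines of b(T,·). -/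

import Mathlib

open MeasureTheory Real Set

noncomputable section

/-- Partial derivative of a scalar function on `ℝ^d` in the `i`-th coordinate direction. -/
def pd {d : ℕ} (i : Fin d) (f : (Fin d → ℝ) → ℝ) : (Fin d → ℝ) → ℝ :=
  fun x => fderiv ℝ f x (Pi.single i 1)

/-- Iterated partial derivative along a list of directions. -/
def pdList {d : ℕ} : List (Fin d) → ((Fin d → ℝ) → ℝ) → ((Fin d → ℝ) → ℝ)
  | [], f => f
  | i :: l, f => pd i (pdList l f)

/-- The list of directions associated to a multi-index `α`
(the direction `i` repeated `α i` times). -/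
def mIdxList {d : ℕ} (α : Fin d → ℕ) : List (Fin d) :=
  ((List.finRange d).map fun i => List.replicate (α i) i).flatten

/-- The partial derivative `∂^α f` for a multi-index `α`. -/
def pdM {d : ℕ} (α : Fin d → ℕ) (f : (Fin d → ℝ) → ℝ) : (Fin d → ℝ) → ℝ :=
  pdList (mIdxList α) f

/-- `|∇^m w|²(x) = ∑_{|α| = m} |∂^α w(x)|²` for a vector field `w : ℝ^d → ℝ^k`. -/
def gradSq {d k : ℕ} (m : ℕ) (w : (Fin d → ℝ) → Fin k → ℝ) (x : Fin d → ℝ) : ℝ :=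
  ∑ α ∈ Finset.Nat.antidiagonalTuple d m, ∑ i, pdM α (fun y => w y i) x ^ 2

/-- The fundamental domain `[0,L]^d` of the torus `ℝ^d/(Lℤ)^d`. -/
def box (d : ℕ) (L : ℝ) : Set (Fin d → ℝ) := Set.Icc 0 fun _ => L

/-- Square of the Sobolev `H^r` norm on the torus of period `L`. -/
def HnormSq {d k : ℕ} (L : ℝ) (r : ℕ) (w : (Fin d → ℝ) → Fin k → ℝ) : ℝ :=
  ∑ m ∈ Finset.range (r + 1), ∫ x in box d L, gradSq m w x

/-- The Sobolev `H^r` norm on the torus of period `L`. -/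
def Hnorm {d k : ℕ} (L : ℝ) (r : ℕ) (w : (Fin d → ℝ) → Fin k → ℝ) : ℝ :=
  Real.sqrt (HnormSq L r w)

/-- The `L²` norm on the torus of period `L`. -/
def L2norm {d k : ℕ} (L : ℝ) (w : (Fin d → ℝ) → Fin k → ℝ) : ℝ :=
  Real.sqrt (∫ x in box d L, ∑ i, w x i ^ 2)

/-- The `L^∞` norm of `∇^m w`. -/
def LinfGrad {d k : ℕ} (m : ℕ) (w : (Fin d → ℝ) → Fin k → ℝ) : ℝ :=
  ⨆ x : Fin d → ℝ, Real.sqrt (gradSq m w x)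

/-- The `L^∞` norm of `w`. -/
def Linf {d k : ℕ} (w : (Fin d → ℝ) → Fin k → ℝ) : ℝ := LinfGrad 0 w

/-- `L`-periodicity in each coordinate direction. -/
def Prdc {d : ℕ} {E : Type*} (L : ℝ) (w : (Fin d → ℝ) → E) : Prop :=
  ∀ (x : Fin d → ℝ) (i : Fin d), w (x + Pi.single i L) = w x

/-- Zero average on the torus. -/
def ZeroAvg {d k : ℕ} (L : ℝ) (w : (Fin d → ℝ) → Fin k → ℝ) : Prop :=
  ∀ i, (∫ x in box d L, w x i) = 0

/-- Divergence of a vector field on `ℝ^d`. -/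
def divg {d : ℕ} (w : (Fin d → ℝ) → Fin d → ℝ) (x : Fin d → ℝ) : ℝ :=
  ∑ i, pd i (fun y => w y i) x

/-- A smooth solution of the MHD system with viscosity `ν` and resistivity `η` on the torus
`ℝ^d/(Lℤ)^d`, on the time interval `J` (the equations are imposed at positive times of `J`). -/
structure IsMHD (d : ℕ) (L ν η : ℝ) (J : Set ℝ)
    (u b : ℝ → (Fin d → ℝ) → Fin d → ℝ) (P : ℝ → (Fin d → ℝ) → ℝ) : Prop where
  smooth_u : ContDiffOn ℝ (⊤ : ℕ∞) (fun p : ℝ × (Fin d → ℝ) => u p.1 p.2) (J ×ˢ Set.univ)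
  smooth_b : ContDiffOn ℝ (⊤ : ℕ∞) (fun p : ℝ × (Fin d → ℝ) => b p.1 p.2) (J ×ˢ Set.univ)
  smooth_P : ContDiffOn ℝ (⊤ : ℕ∞) (fun p : ℝ × (Fin d → ℝ) => P p.1 p.2) (J ×ˢ Set.univ)
  periodic_u : ∀ t ∈ J, Prdc L (u t)
  periodic_b : ∀ t ∈ J, Prdc L (b t)
  periodic_P : ∀ t ∈ J, Prdc L (P t)
  div_u : ∀ t ∈ J, ∀ x, divg (u t) x = 0
  div_b : ∀ t ∈ J, ∀ x, divg (b t) x = 0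
  momentum : ∀ t ∈ J, 0 < t → ∀ x i,
    deriv (fun s => u s x i) t + (∑ j, u t x j * pd j (fun y => u t y i) x) + pd i (P t) x
      = ν * (∑ j, pd j (pd j fun y => u t y i) x) + ∑ j, b t x j * pd j (fun y => b t y i) x
  induction_eq : ∀ t ∈ J, 0 < t → ∀ x i,
    deriv (fun s => b s x i) t + (∑ j, u t x j * pd j (fun y => b t y i) x)
      = (∑ j, b t x j * pd j (fun y => u t y i) x)
        + η * (∑ j, pd j (pd j fun y => b t y i) x)

/-- Projection from `ℝ^d` onto the torus `ℝ^d/(Lℤ)^d`. -/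
def torusProj (d : ℕ) (L : ℝ) (x : Fin d → ℝ) : Fin d → AddCircle L :=
  fun i => (x i : AddCircle L)

/-- A magnetic line of the field `b`: the image on the torus of a maximal (hence, since the
relevant fields are smooth and periodic, globally defined) integral curve of `b`. -/
def IsMagLine (d : ℕ) (L : ℝ) (b : (Fin d → ℝ) → Fin d → ℝ)
    (s : Set (Fin d → AddCircle L)) : Prop :=
  ∃ γ : ℝ → Fin d → ℝ, (∀ τ : ℝ, HasDerivAt γ (b (γ τ)) τ) ∧
    s = torusProj d L '' Set.range γ

/-- The families of magnetic lines of `b₁` and `b₂` are topologically equivalent: some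
self-homeomorphism of the torus maps the family of magnetic lines of `b₁` bijectively onto the
family of magnetic lines of `b₂`. -/
def MagLinesEquiv (d : ℕ) (L : ℝ) (b₁ b₂ : (Fin d → ℝ) → Fin d → ℝ) : Prop :=
  ∃ φ : (Fin d → AddCircle L) ≃ₜ (Fin d → AddCircle L),
    ∀ s : Set (Fin d → AddCircle L), IsMagLine d L b₁ s ↔ IsMagLine d L b₂ (φ '' s)

namespace MHD

open scoped BoundedContinuousFunction

/-- Frequencies on the two-dimensional torus. -/
abbrev Freq := Fin 2 → ℤ

/-- Bounded continuous complex-valued functions of time. -/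
abbrev TF := ℝ →ᵇ ℂ

/-- The submultiplicative weight `1 + |k₀| + |k₁|`. -/
def wt (k : Freq) : ℝ := 1 + |(k 0 : ℝ)| + |(k 1 : ℝ)|

lemma one_le_wt (k : Freq) : 1 ≤ wt k := by
  unfold wt; linarith [abs_nonneg (k 0 : ℝ), abs_nonneg (k 1 : ℝ)]

lemma wt_pos (k : Freq) : 0 < wt k := lt_of_lt_of_le one_pos (one_le_wt k)

lemma wt_neg (k : Freq) : wt (-k) = wt k := by
  simp [wt]

lemma wt_add_le (j k : Freq) : wt (j + k) ≤ wt j * wt k := by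
  unfold wt
  have h0 := abs_add_le (j 0 : ℝ) (k 0 : ℝ)
  have h1 := abs_add_le (j 1 : ℝ) (k 1 : ℝ)
  simp only [Pi.add_apply, Int.cast_add]
  have a := abs_nonneg (j 0 : ℝ)
  have b := abs_nonneg (j 1 : ℝ)
  have c := abs_nonneg (k 0 : ℝ)
  have d := abs_nonneg (k 1 : ℝ)
  nlinarith [mul_nonneg a c, mul_nonneg a d, mul_nonneg b c, mul_nonneg b d]

lemma wt_le_mul_sub (j k : Freq) : wt k ≤ wt j * wt (k - j) := by
  simpa using wt_add_le j (k - j)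

lemma abs_le_wt (k : Freq) (i : Fin 2) : |(k i : ℝ)| ≤ wt k := by
  unfold wt
  fin_cases i <;> simp <;> linarith [abs_nonneg (k 0 : ℝ), abs_nonneg (k 1 : ℝ)]

/-- Reindexing of pairs of frequencies used for convolutions. -/
def shear : Freq × Freq ≃ Freq × Freq where
  toFun p := (p.2, p.1 - p.2)
  invFun p := (p.1 + p.2, p.1)
  left_inv p := by simp
  right_inv p := by simp

section RealConv

variable {F G : Freq → ℝ}

lemma summable_shear (hF : Summable F) (hG : Summable G) (hF0 : ∀ k, 0 ≤ F k)
    (hG0 : ∀ k, 0 ≤ G k) :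
    Summable fun p : Freq × Freq => F p.2 * G (p.1 - p.2) := by
  have h : Summable fun p : Freq × Freq => F p.1 * G p.2 :=
    hF.mul_of_nonneg hG hF0 hG0
  exact (shear.summable_iff (f := fun p : Freq × Freq => F p.1 * G p.2)).2 h

lemma tsum_shear (hF : Summable F) (hG : Summable G) (hF0 : ∀ k, 0 ≤ F k)
    (hG0 : ∀ k, 0 ≤ G k) :
    ∑' k, ∑' j, F j * G (k - j) = (∑' k, F k) * ∑' k, G k := by
  have h : Summable fun p : Freq × Freq => F p.1 * G p.2 :=
    hF.mul_of_nonneg hG hF0 hG0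
  rw [hF.tsum_mul_tsum hG h, ← shear.tsum_eq (fun p : Freq × Freq => F p.1 * G p.2)]
  exact ((summable_shear hF hG hF0 hG0).tsum_prod).symm

end RealConv

/-- Weighted absolute summability of a family of time-dependent coefficients. -/
def WSum (s : ℕ) (f : Freq → TF) : Prop := Summable fun k => wt k ^ s * ‖f k‖

/-- Rapid decay of a family of time-dependent coefficients. -/
def Rapid (f : Freq → TF) : Prop := ∀ s, WSum s f

lemma WSum.zero {s : ℕ} {f : Freq → TF} (h : WSum s f) : WSum 0 f := by
  refine Summable.of_nonneg_of_le (fun k => by positivity) (fun k => ?_) h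
  have := one_le_pow₀ (one_le_wt k) (n := s)
  simpa using le_mul_of_one_le_left (norm_nonneg (f k)) this

lemma WSum.norm {f : Freq → TF} (h : WSum 0 f) : Summable fun k => ‖f k‖ := by
  simpa [WSum] using h

lemma WSum.of_le {s r : ℕ} {f g : Freq → TF} (C : ℝ) (h : WSum r f)
    (hle : ∀ k, wt k ^ s * ‖g k‖ ≤ C * (wt k ^ r * ‖f k‖)) : WSum s g := by
  refine Summable.of_nonneg_of_le (fun k => ?_) hle (h.mul_left C)
  have := wt_pos k
  positivity

lemma WSum.add {s : ℕ} {f g : Freq → TF} (hf : WSum s f) (hg : WSum s g) : WSum s (f + g) := by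
  refine Summable.of_nonneg_of_le (fun k => ?_) (fun k => ?_) (Summable.add hf hg)
  · have := wt_pos k
    positivity
  · have := wt_pos k
    rw [← mul_add]
    gcongr
    exact norm_add_le _ _

/-- Convolution of families of coefficients. -/
def conv (f g : Freq → TF) : Freq → TF := fun k => ∑' j, f j * g (k - j)

section Conv

variable {f g h : Freq → TF}

lemma summable_conv_norm (hf : WSum 0 f) (hg : WSum 0 g) (k : Freq) :
    Summable fun j => ‖f j‖ * ‖g (k - j)‖ :=
  (summable_shear hf.norm hg.norm (fun _ => norm_nonneg _) (fun _ => norm_nonneg _)).prod_factor k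

lemma summable_conv (hf : WSum 0 f) (hg : WSum 0 g) (k : Freq) :
    Summable fun j => f j * g (k - j) :=
  Summable.of_norm_bounded (summable_conv_norm hf hg k) fun _ => norm_mul_le _ _

lemma norm_conv_le (hf : WSum 0 f) (hg : WSum 0 g) (k : Freq) :
    ‖conv f g k‖ ≤ ∑' j, ‖f j‖ * ‖g (k - j)‖ :=
  tsum_of_norm_bounded (summable_conv_norm hf hg k).hasSum fun _ => norm_mul_le _ _

lemma conv_comm (f g : Freq → TF) : conv f g = conv g f := by
  funext k
  unfold conv
  rw [← (Equiv.subLeft k).tsum_eq]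
  simp [mul_comm]

lemma conv_add (hf : WSum 0 f) (hg : WSum 0 g) (hh : WSum 0 h) :
    conv f (g + h) = conv f g + conv f h := by
  funext k
  simp only [conv, Pi.add_apply, mul_add]
  exact (summable_conv hf hg k).tsum_add (summable_conv hf hh k)

lemma conv_zero (f : Freq → TF) : conv f 0 = 0 := by
  funext k
  simp [conv]

lemma wt_pow_mul_norm_conv_le {s : ℕ} (hf : WSum s f) (hg : WSum s g) (k : Freq) :
    wt k ^ s * ‖conv f g k‖ ≤
      ∑' j, (wt j ^ s * ‖f j‖) * (wt (k - j) ^ s * ‖g (k - j)‖) := by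
  have hs : Summable fun j => (wt j ^ s * ‖f j‖) * (wt (k - j) ^ s * ‖g (k - j)‖) :=
    (summable_shear hf hg (fun k => by have := wt_pos k; positivity)
      (fun k => by have := wt_pos k; positivity)).prod_factor k
  refine (mul_le_mul_of_nonneg_left (norm_conv_le hf.zero hg.zero k)
    (pow_nonneg (wt_pos k).le s)).trans ?_
  rw [← tsum_mul_left]
  refine ((summable_conv_norm hf.zero hg.zero k).mul_left _).tsum_le_tsum (fun j => ?_) hs
  have h1 : wt k ^ s ≤ wt j ^ s * wt (k - j) ^ s := by
    rw [← mul_pow]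
    exact pow_le_pow_left₀ (wt_pos k).le (wt_le_mul_sub j k) s
  calc wt k ^ s * (‖f j‖ * ‖g (k - j)‖)
      ≤ (wt j ^ s * wt (k - j) ^ s) * (‖f j‖ * ‖g (k - j)‖) := by gcongr
    _ = _ := by ring

lemma WSum.conv {s : ℕ} (hf : WSum s f) (hg : WSum s g) : WSum s (conv f g) := by
  refine Summable.of_nonneg_of_le (fun k => ?_) (wt_pow_mul_norm_conv_le hf hg)
    (summable_shear hf hg (fun k => by have := wt_pos k; positivity)
      (fun k => by have := wt_pos k; positivity)).prod
  have := wt_pos k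
  positivity

lemma Rapid.conv (hf : Rapid f) (hg : Rapid g) : Rapid (conv f g) := fun s => (hf s).conv (hg s)

lemma Rapid.add (hf : Rapid f) (hg : Rapid g) : Rapid (f + g) := fun s => (hf s).add (hg s)

/-- Multiplication of a family of coefficients by a symbol. -/
def sym (c : Freq → ℂ) (f : Freq → TF) : Freq → TF := fun k => c k • f k

/-- Symbols of polynomial growth. -/
def PolyBdd (c : Freq → ℂ) : Prop := ∃ C : ℝ, ∃ r : ℕ, 0 ≤ C ∧ ∀ k, ‖c k‖ ≤ C * wt k ^ r

lemma Rapid.sym {c : Freq → ℂ} (hc : PolyBdd c) (hf : Rapid f) : Rapid (sym c f) := by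
  obtain ⟨C, r, -, hC⟩ := hc
  intro s
  refine (hf (s + r)).of_le C fun k => ?_
  have := wt_pos k
  calc wt k ^ s * ‖c k • f k‖ ≤ wt k ^ s * ((C * wt k ^ r) * ‖f k‖) := by
        rw [norm_smul]
        gcongr
        exact hC k
    _ = _ := by ring

/-- The symbol of the `i`-th partial derivative. -/
def dsym (i : Fin 2) : Freq → ℂ := fun k => 2 * π * Complex.I * k i

lemma norm_dsym (i : Fin 2) (k : Freq) : ‖dsym i k‖ = 2 * π * |(k i : ℝ)| := by
  simp [dsym, abs_of_pos Real.pi_pos]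

lemma polyBdd_dsym (i : Fin 2) : PolyBdd (dsym i) := by
  refine ⟨2 * π, 1, by positivity, fun k => ?_⟩
  rw [norm_dsym, pow_one]
  gcongr
  exact abs_le_wt k i

lemma sym_dsym_conv (i : Fin 2) (hf : Rapid f) (hg : Rapid g) :
    sym (dsym i) (conv f g) = conv (sym (dsym i) f) g + conv f (sym (dsym i) g) := by
  funext k
  have h1 := summable_conv ((hf.sym (polyBdd_dsym i)) 0) (hg 0) k
  have h2 := summable_conv (hf 0) ((hg.sym (polyBdd_dsym i)) 0) k
  simp only [Pi.add_apply, conv]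
  rw [← h1.tsum_add h2]
  simp only [sym, conv]
  rw [← (summable_conv (hf 0) (hg 0) k).tsum_const_smul]
  refine tsum_congr fun j => ?_
  ext t
  simp [dsym]
  ring

end Conv

/-- The conjugation symmetry of coefficients of real-valued functions. -/
def Herm (f : Freq → TF) : Prop := ∀ k, f (-k) = star (f k)

lemma Herm.conv {f g : Freq → TF} (hf : Herm f) (hg : Herm g) : Herm (conv f g) := fun k => by
  unfold MHD.conv
  rw [tsum_star, ← (Equiv.neg Freq).tsum_eq]
  refine tsum_congr fun j => ?_
  have : -k - -j = -(k - j) := by abel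
  rw [Equiv.neg_apply, this, hf j, hg (k - j), star_mul']

lemma Herm.sym {f : Freq → TF} {c : Freq → ℂ} (hc : ∀ k, c (-k) = star (c k)) (hf : Herm f) :
    Herm (sym c f) := fun k => by
  ext t
  simp [MHD.sym, hc k, hf k]

lemma dsym_neg (i : Fin 2) (k : Freq) : dsym i (-k) = star (dsym i k) := by
  simp [dsym]

/-- The character `exp(2 * π * i * (k · x))`. -/
def chr (k : Freq) (x : Fin 2 → ℝ) : ℂ :=
  Complex.exp (2 * π * Complex.I * (k 0 * x 0 + k 1 * x 1))

lemma norm_chr (k : Freq) (x : Fin 2 → ℝ) : ‖chr k x‖ = 1 := by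
  rw [chr, show (2 * π * Complex.I * (k 0 * x 0 + k 1 * x 1) : ℂ)
    = ((2 * π * (k 0 * x 0 + k 1 * x 1) : ℝ) : ℂ) * Complex.I by push_cast; ring]
  exact Complex.norm_exp_ofReal_mul_I _

lemma chr_add (j k : Freq) (x : Fin 2 → ℝ) : chr (j + k) x = chr j x * chr k x := by
  rw [chr, chr, chr, ← Complex.exp_add]
  congr 1
  simp
  ring

lemma chr_neg (k : Freq) (x : Fin 2 → ℝ) : chr (-k) x = star (chr k x) := by
  simp only [chr, Complex.star_def, ← Complex.exp_conj]
  congr 1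
  simp [Complex.conj_ofNat]
  ring

lemma prdc_chr (k : Freq) : Prdc 1 (chr k) := by
  intro x i
  rw [chr, chr, Complex.exp_eq_exp_iff_exists_int]
  refine ⟨k i, ?_⟩
  fin_cases i <;> simp <;> ring

/-- The function on space-time with the given time-dependent Fourier coefficients. -/
def Ser (f : Freq → TF) (t : ℝ) (x : Fin 2 → ℝ) : ℂ := ∑' k, f k t * chr k x

section Ser

variable {f g : Freq → TF}

lemma summable_ser (hf : WSum 0 f) (t : ℝ) (x : Fin 2 → ℝ) :
    Summable fun k => f k t * chr k x := by
  refine Summable.of_norm_bounded hf.norm fun k => ?_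
  rw [norm_mul, norm_chr, mul_one]
  exact (f k).norm_coe_le_norm t

lemma norm_ser_le (hf : WSum 0 f) (t : ℝ) (x : Fin 2 → ℝ) : ‖Ser f t x‖ ≤ ∑' k, ‖f k‖ := by
  refine tsum_of_norm_bounded hf.norm.hasSum fun k => ?_
  rw [norm_mul, norm_chr, mul_one]
  exact (f k).norm_coe_le_norm t

lemma ser_add (hf : WSum 0 f) (hg : WSum 0 g) (t : ℝ) (x : Fin 2 → ℝ) :
    Ser (f + g) t x = Ser f t x + Ser g t x := by
  unfold Ser
  rw [← (summable_ser hf t x).tsum_add (summable_ser hg t x)]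
  simp [add_mul]

lemma ser_smul (c : ℂ) (t : ℝ) (x : Fin 2 → ℝ) :
    Ser (c • f) t x = c * Ser f t x := by
  unfold Ser
  rw [← tsum_mul_left]
  simp [mul_assoc]

lemma prdc_ser (f : Freq → TF) (t : ℝ) : Prdc 1 (Ser f t) := by
  intro x i
  unfold Ser
  exact tsum_congr fun k => by rw [prdc_chr k x i]

lemma conv_apply (hf : WSum 0 f) (hg : WSum 0 g) (k : Freq) (t : ℝ) :
    conv f g k t = ∑' j, f j t * g (k - j) t := by
  have := (BoundedContinuousFunction.evalCLM ℂ t).map_tsum (summable_conv hf hg k)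
  simpa [conv] using this

lemma ser_conv (hf : WSum 0 f) (hg : WSum 0 g) (t : ℝ) (x : Fin 2 → ℝ) :
    Ser (conv f g) t x = Ser f t x * Ser g t x := by
  have hn : ∀ f : Freq → TF, WSum 0 f → Summable fun k => ‖f k t * chr k x‖ := fun f hf => by
    refine Summable.of_nonneg_of_le (fun k => norm_nonneg _) (fun k => ?_) hf.norm
    rw [norm_mul, norm_chr, mul_one]
    exact (f k).norm_coe_le_norm t
  unfold Ser
  rw [tsum_mul_tsum_of_summable_norm (hn f hf) (hn g hg)]
  have hs := summable_mul_of_summable_norm (hn f hf) (hn g hg)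
  have hs' := (shear.summable_iff (f := fun p : Freq × Freq =>
    (f p.1 t * chr p.1 x) * (g p.2 t * chr p.2 x))).2 hs
  rw [← shear.tsum_eq]
  refine Eq.trans ?_ hs'.tsum_prod.symm
  refine tsum_congr fun k => ?_
  rw [conv_apply hf hg, ← tsum_mul_right]
  refine tsum_congr fun j => ?_
  have : chr k x = chr j x * chr (k - j) x := by rw [← chr_add]; simp
  simp only [shear, Function.comp, Equiv.coe_fn_mk]
  rw [this]
  ring

lemma ser_im (hf : Herm f) (t : ℝ) (x : Fin 2 → ℝ) : (Ser f t x).im = 0 := by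
  rw [← Complex.conj_eq_iff_im, ← Complex.star_def]
  unfold Ser
  rw [tsum_star, ← (Equiv.neg Freq).tsum_eq]
  refine tsum_congr fun k => ?_
  have := hf k
  simp only [Equiv.neg_apply, this, chr_neg]
  simp

end Ser

/-- `g` is the time derivative of `f` on `[0, ∞)`, in integrated form. -/
def TD (f g : TF) : Prop := ∀ t : ℝ, 0 ≤ t → f t = f 0 + ∫ s in (0 : ℝ)..t, g s

/-- The `C¹` function on the whole line with initial value `f 0` and derivative `g`. -/
def prim (f g : TF) (t : ℝ) : ℂ := f 0 + ∫ s in (0 : ℝ)..t, g s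

lemma hasDerivAt_prim (f g : TF) (t : ℝ) : HasDerivAt (prim f g) (g t) t :=
  (g.continuous.integral_hasStrictDerivAt 0 t).hasDerivAt.const_add (f 0)

lemma TD.hasDerivWithinAt {f g : TF} (h : TD f g) {t : ℝ} (ht : 0 ≤ t) :
    HasDerivWithinAt f (g t) (Ici 0) t :=
  (hasDerivAt_prim f g t).hasDerivWithinAt.congr (fun s hs => h s hs) (h t ht)

lemma TD.of_hasDerivWithinAt {f g : TF}
    (h : ∀ t : ℝ, 0 ≤ t → HasDerivWithinAt f (g t) (Ici 0) t) : TD f g := by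
  intro t ht
  have := intervalIntegral.integral_eq_sub_of_hasDeriv_right_of_le ht
    (f := f) (f' := g) f.continuous.continuousOn
    (fun x hx => (h x hx.1.le).mono (fun y hy => hx.1.le.trans (le_of_lt hy)))
    (g.continuous.intervalIntegrable _ _)
  rw [this]
  ring

lemma TD.add {f g f' g' : TF} (hf : TD f f') (hg : TD g g') : TD (f + g) (f' + g') :=
  TD.of_hasDerivWithinAt fun _ ht => (hf.hasDerivWithinAt ht).add (hg.hasDerivWithinAt ht)

lemma TD.smul {f f' : TF} (c : ℂ) (hf : TD f f') : TD (c • f) (c • f') :=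
  TD.of_hasDerivWithinAt fun _ ht => (hf.hasDerivWithinAt ht).const_smul c

lemma TD.mul {f g f' g' : TF} (hf : TD f f') (hg : TD g g') :
    TD (f * g) (f' * g + f * g') :=
  TD.of_hasDerivWithinAt fun _ ht => (hf.hasDerivWithinAt ht).mul (hg.hasDerivWithinAt ht)

/-- Integration over `[0, t]` as a continuous linear functional. -/
def intCLM (t : ℝ) : TF →L[ℂ] ℂ :=
  LinearMap.mkContinuous
    { toFun := fun g => ∫ s in (0 : ℝ)..t, g s
      map_add' := fun f g => intervalIntegral.integral_add
        (f.continuous.intervalIntegrable _ _) (g.continuous.intervalIntegrable _ _)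
      map_smul' := fun c f => intervalIntegral.integral_smul c _ } |t| (fun f => by
        have := intervalIntegral.norm_integral_le_of_norm_le_const
          (a := 0) (b := t) (f := f) (C := ‖f‖) (fun s _ => f.norm_coe_le_norm s)
        simpa [mul_comm] using this)

lemma TD.tsum {ι : Type*} {f g : ι → TF} (hf : Summable f) (hg : Summable g)
    (h : ∀ i, TD (f i) (g i)) : TD (∑' i, f i) (∑' i, g i) := by
  intro t ht
  have e1 := (BoundedContinuousFunction.evalCLM ℂ t).map_tsum hf
  have e0 := (BoundedContinuousFunction.evalCLM ℂ (0 : ℝ)).map_tsum hf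
  have e2 := (intCLM t).map_tsum hg
  have s0 := (BoundedContinuousFunction.evalCLM ℂ (0 : ℝ)).summable hf
  have s2 := (intCLM t).summable hg
  change (∑' i, f i) t = ∑' i, f i t at e1
  change (∑' i, f i) 0 = ∑' i, f i 0 at e0
  change (∫ s in (0 : ℝ)..t, (∑' i, g i) s) = ∑' i, ∫ s in (0 : ℝ)..t, g i s at e2
  rw [e1, e0, e2]
  refine Eq.trans ?_ (s0.tsum_add s2)
  exact tsum_congr fun i => h i t ht

/-- Families of coefficients with `n` time derivatives, all rapidly decaying. -/
def Sm : ℕ → (Freq → TF) → Prop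
  | 0, f => Rapid f
  | n + 1, f => Rapid f ∧ ∃ g, Sm n g ∧ ∀ k, TD (f k) (g k)

lemma Sm.rapid {n : ℕ} {f : Freq → TF} (h : Sm n f) : Rapid f := by
  cases n with
  | zero => exact h
  | succ n => exact h.1

lemma Sm.of_succ {n : ℕ} {f : Freq → TF} (h : Sm (n + 1) f) : Sm n f := by
  induction n generalizing f with
  | zero => exact h.1
  | succ n ih =>
    obtain ⟨hf, g, hg, hfg⟩ := h
    exact ⟨hf, g, ih hg, hfg⟩

lemma Sm.add {n : ℕ} {f g : Freq → TF} (hf : Sm n f) (hg : Sm n g) : Sm n (f + g) := by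
  induction n generalizing f g with
  | zero => exact Rapid.add hf hg
  | succ n ih =>
    obtain ⟨hf, f', hf', hff⟩ := hf
    obtain ⟨hg, g', hg', hgg⟩ := hg
    exact ⟨hf.add hg, f' + g', ih hf' hg', fun k => (hff k).add (hgg k)⟩

lemma Sm.sym {n : ℕ} {f : Freq → TF} {c : Freq → ℂ} (hc : PolyBdd c) (hf : Sm n f) :
    Sm n (sym c f) := by
  induction n generalizing f with
  | zero => exact Rapid.sym hc hf
  | succ n ih =>
    obtain ⟨hf, f', hf', hff⟩ := hf
    exact ⟨hf.sym hc, MHD.sym c f', ih hf', fun k => (hff k).smul (c k)⟩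

lemma Sm.conv {n : ℕ} {f g : Freq → TF} (hf : Sm n f) (hg : Sm n g) : Sm n (conv f g) := by
  induction n generalizing f g with
  | zero => exact Rapid.conv hf hg
  | succ n ih =>
    have hfn := hf.of_succ
    have hgn := hg.of_succ
    obtain ⟨hf, f', hf', hff⟩ := hf
    obtain ⟨hg, g', hg', hgg⟩ := hg
    refine ⟨hf.conv hg, MHD.conv f' g + MHD.conv f g', (ih hf' hgn).add (ih hfn hg'), fun k => ?_⟩
    have h1 := summable_conv (hf'.rapid 0) (hg 0) k
    have h2 := summable_conv (hf 0) (hg'.rapid 0) k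
    simp only [Pi.add_apply, MHD.conv]
    rw [← h1.tsum_add h2]
    exact TD.tsum (summable_conv (hf 0) (hg 0) k) (h1.add h2)
      fun j => (hff j).mul (hgg (k - j))

section Smooth

/-- The real-linear map `(t, x) ↦ t A + ∑ xᵢ Bᵢ`. -/
def lin (A : ℂ) (B : Fin 2 → ℂ) : (ℝ × (Fin 2 → ℝ)) →L[ℝ] ℂ :=
  (ContinuousLinearMap.fst ℝ ℝ (Fin 2 → ℝ)).smulRight A +
    ∑ i, ((ContinuousLinearMap.proj i : (Fin 2 → ℝ) →L[ℝ] ℝ).comp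
      (ContinuousLinearMap.snd ℝ ℝ (Fin 2 → ℝ))).smulRight (B i)

lemma lin_apply (A : ℂ) (B : Fin 2 → ℂ) (p : ℝ × (Fin 2 → ℝ)) :
    lin A B p = p.1 * A + ∑ i, p.2 i * B i := by
  simp [lin]

lemma norm_lin_le (A : ℂ) (B : Fin 2 → ℂ) : ‖lin A B‖ ≤ ‖A‖ + ∑ i, ‖B i‖ := by
  refine ContinuousLinearMap.opNorm_le_bound _ (by positivity) fun p => ?_
  rw [lin_apply, add_mul, Finset.sum_mul]
  refine (norm_add_le _ _).trans (add_le_add ?_ ((norm_sum_le _ _).trans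
    (Finset.sum_le_sum fun i _ => ?_)))
  · rw [norm_mul, mul_comm, Complex.norm_real]
    gcongr
    exact norm_fst_le p
  · rw [norm_mul, mul_comm, Complex.norm_real]
    gcongr
    exact (norm_le_pi_norm p.2 i).trans (norm_snd_le p)

lemma contDiffOn_lin {n : ℕ} {s : Set (ℝ × (Fin 2 → ℝ))} {A : ℝ × (Fin 2 → ℝ) → ℂ}
    {B : Fin 2 → ℝ × (Fin 2 → ℝ) → ℂ} (hA : ContDiffOn ℝ n A s)
    (hB : ∀ i, ContDiffOn ℝ n (B i) s) :
    ContDiffOn ℝ n (fun p => lin (A p) (fun i => B i p)) s := by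
  unfold lin
  refine ContDiffOn.add ?_ (ContDiffOn.sum fun i _ => ?_)
  · exact contDiffOn_const.smulRight hA
  · exact contDiffOn_const.smulRight (hB i)

lemma hasFDerivAt_chr (k : Freq) (x : Fin 2 → ℝ) :
    HasFDerivAt (chr k) (∑ i, (ContinuousLinearMap.proj i : (Fin 2 → ℝ) →L[ℝ] ℝ).smulRight
      (dsym i k * chr k x)) x := by
  have h : ∀ i : Fin 2, HasFDerivAt (fun y : Fin 2 → ℝ => ((y i : ℝ) : ℂ))
      (Complex.ofRealCLM.comp (ContinuousLinearMap.proj i : (Fin 2 → ℝ) →L[ℝ] ℝ)) x := fun i =>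
    (Complex.ofRealCLM.comp (ContinuousLinearMap.proj i : (Fin 2 → ℝ) →L[ℝ] ℝ)).hasFDerivAt
  have := ((((h 0).const_mul (k 0 : ℂ)).add ((h 1).const_mul (k 1 : ℂ))).const_mul
    (2 * π * Complex.I)).cexp
  refine this.congr_fderiv ?_
  ext v
  simp [Fin.sum_univ_two, chr, dsym]
  ring

lemma hasFDerivAt_term (f g : TF) (k : Freq) (p : ℝ × (Fin 2 → ℝ)) :
    HasFDerivAt (fun p : ℝ × (Fin 2 → ℝ) => prim f g p.1 * chr k p.2)
      (lin (g p.1 * chr k p.2) fun i => (dsym i k * prim f g p.1) * chr k p.2) p := by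
  have h1 : HasFDerivAt (fun p : ℝ × (Fin 2 → ℝ) => prim f g p.1) _ p :=
    (hasDerivAt_prim f g p.1).hasFDerivAt.comp p hasFDerivAt_fst
  have h2 : HasFDerivAt (fun p : ℝ × (Fin 2 → ℝ) => chr k p.2) _ p :=
    (hasFDerivAt_chr k p.2).comp p hasFDerivAt_snd
  refine (h1.mul h2).congr_fderiv ?_
  ext v
  · simp [lin_apply]
    ring
  · simp [lin_apply, Fin.sum_univ_two]
    ring

lemma norm_prim_le (f g : TF) {t : ℝ} (ht : -1 < t) (h : TD f g) :
    ‖prim f g t‖ ≤ ‖f‖ + ‖g‖ := by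
  rcases le_or_gt 0 t with h0 | h0
  · rw [prim, ← h t h0]
    exact (f.norm_coe_le_norm t).trans (by linarith [norm_nonneg g])
  · refine (norm_add_le _ _).trans (add_le_add (f.norm_coe_le_norm 0) ?_)
    refine (intervalIntegral.norm_integral_le_of_norm_le_const
      (fun s _ => g.norm_coe_le_norm s)).trans ?_
    have : |t - 0| ≤ 1 := by rw [abs_le]; constructor <;> linarith
    exact mul_le_of_le_one_right (norm_nonneg g) this

/-- The space-time domain `[0, ∞) × ℝ²`. -/
abbrev dom : Set (ℝ × (Fin 2 → ℝ)) := Ici 0 ×ˢ univ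

lemma hasFDerivWithinAt_ser {f g : Freq → TF} (hf : Rapid f) (hg : Rapid g)
    (h : ∀ k, TD (f k) (g k)) {p : ℝ × (Fin 2 → ℝ)} (hp : p ∈ dom) :
    HasFDerivWithinAt (fun p : ℝ × (Fin 2 → ℝ) => Ser f p.1 p.2)
      (lin (Ser g p.1 p.2) fun i => Ser (sym (dsym i) f) p.1 p.2) dom p := by
  have hp0 : (0 : ℝ) ≤ p.1 := hp.1
  set u : Freq → ℝ := fun k => ‖g k‖ + ∑ i, ‖dsym i k‖ * (‖f k‖ + ‖g k‖) with hu
  have hsum : Summable u := by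
    refine (hg 0).norm.add (summable_sum fun i _ => ?_)
    have h1 := ((hf.sym (polyBdd_dsym i)) 0).norm
    have h2 := ((hg.sym (polyBdd_dsym i)) 0).norm
    refine (h1.add h2).congr fun k => ?_
    simp [sym, norm_smul, mul_add]
  have hO : IsOpen (Ioi (-1 : ℝ) ×ˢ (univ : Set (Fin 2 → ℝ))) := isOpen_Ioi.prod isOpen_univ
  have hC : IsPreconnected (Ioi (-1 : ℝ) ×ˢ (univ : Set (Fin 2 → ℝ))) :=
    isPreconnected_Ioi.prod isPreconnected_univ
  have hsub : ∀ q : ℝ × (Fin 2 → ℝ), q ∈ dom → q ∈ Ioi (-1 : ℝ) ×ˢ (univ : Set (Fin 2 → ℝ)) :=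
    fun q hq => ⟨lt_of_lt_of_le (show (-1 : ℝ) < 0 by norm_num) hq.1, trivial⟩
  have heq : ∀ q ∈ dom, ∀ k, prim (f k) (g k) q.1 * chr k q.2 = f k q.1 * chr k q.2 :=
    fun q hq k => by rw [prim, ← h k q.1 hq.1]
  have key := hasFDerivAt_tsum_of_isPreconnected (𝕜 := ℝ) (u := u) hsum hO hC
    (f := fun k (q : ℝ × (Fin 2 → ℝ)) => prim (f k) (g k) q.1 * chr k q.2)
    (f' := fun k q => lin (g k q.1 * chr k q.2)
      fun i => (dsym i k * prim (f k) (g k) q.1) * chr k q.2)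
    (fun k q _ => hasFDerivAt_term (f k) (g k) k q)
    (fun k q hq => by
      refine (norm_lin_le _ _).trans ?_
      refine add_le_add ?_ (Finset.sum_le_sum fun i _ => ?_)
      · rw [norm_mul, norm_chr, mul_one]
        exact (g k).norm_coe_le_norm _
      · rw [norm_mul, norm_chr, mul_one, norm_mul]
        gcongr
        exact norm_prim_le _ _ hq.1 (h k))
    (hsub p hp)
    (by
      refine (summable_ser (hf 0) p.1 p.2).congr fun k => ?_
      rw [heq p hp k])
    (hsub p hp)
  have hS : Summable fun k => lin (g k p.1 * chr k p.2)
      fun i => (dsym i k * prim (f k) (g k) p.1) * chr k p.2 := by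
    refine Summable.of_norm_bounded hsum fun k => ?_
    refine (norm_lin_le _ _).trans ?_
    refine add_le_add ?_ (Finset.sum_le_sum fun i _ => ?_)
    · rw [norm_mul, norm_chr, mul_one]
      exact (g k).norm_coe_le_norm _
    · rw [norm_mul, norm_chr, mul_one, norm_mul]
      gcongr
      exact norm_prim_le _ _ (hsub p hp).1 (h k)
  refine (key.congr_fderiv ?_).hasFDerivWithinAt.congr (fun q hq => ?_) ?_
  · refine ContinuousLinearMap.ext fun v => ?_
    have e := (ContinuousLinearMap.apply ℝ ℂ v).map_tsum hS
    simp only [ContinuousLinearMap.apply_apply] at e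
    rw [e, lin_apply]
    simp only [lin_apply, Ser, Fin.sum_univ_two]
    have s1 := (summable_ser (hg 0) p.1 p.2).mul_left (v.1 : ℂ)
    have s2 : ∀ i, Summable fun k => (v.2 i : ℂ) * (sym (dsym i) f k p.1 * chr k p.2) := fun i =>
      (summable_ser (hf.sym (polyBdd_dsym i) 0) p.1 p.2).mul_left (v.2 i : ℂ)
    rw [← tsum_mul_left, ← tsum_mul_left, ← tsum_mul_left, ← (s2 0).tsum_add (s2 1),
      ← s1.tsum_add ((s2 0).add (s2 1))]
    refine tsum_congr fun k => ?_
    rw [prim, ← h k p.1 hp0]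
    simp [sym]
  · exact tsum_congr fun k => (heq q hq k).symm
  · exact tsum_congr fun k => (heq p hp k).symm

lemma uniqueDiffOn_dom : UniqueDiffOn ℝ dom := (uniqueDiffOn_Ici 0).prod uniqueDiffOn_univ

lemma contDiffOn_ser {n : ℕ} {f : Freq → TF} (hf : Sm n f) :
    ContDiffOn ℝ n (fun p : ℝ × (Fin 2 → ℝ) => Ser f p.1 p.2) dom := by
  induction n generalizing f with
  | zero =>
    rw [Nat.cast_zero, contDiffOn_zero]
    refine Continuous.continuousOn ?_
    refine continuous_tsum (u := fun k => ‖f k‖) (fun k => ?_) ((hf 0).norm) fun k p => ?_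
    · have := (f k).continuous
      unfold chr
      fun_prop
    · rw [norm_mul, norm_chr, mul_one]
      exact (f k).norm_coe_le_norm _
  | succ n ih =>
    have hfn := hf.of_succ
    obtain ⟨hf, g, hg, hfg⟩ := hf
    rw [Nat.cast_succ, contDiffOn_succ_iff_hasFDerivWithinAt_of_uniqueDiffOn uniqueDiffOn_dom]
    refine ⟨fun h => by simp at h, _, contDiffOn_lin (ih hg)
      (fun i => ih (hfn.sym (polyBdd_dsym i))), fun p hp => ?_⟩
    exact hasFDerivWithinAt_ser hf hg.rapid hfg hp

lemma contDiffOn_ser_infty {f : Freq → TF} (hf : ∀ n, Sm n f) :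
    ContDiffOn ℝ (⊤ : ℕ∞) (fun p : ℝ × (Fin 2 → ℝ) => Ser f p.1 p.2) dom :=
  contDiffOn_infty.2 fun n => contDiffOn_ser (hf n)

/-- Spatial derivative of a series with rapidly decaying coefficients. -/
lemma hasFDerivAt_ser_space {f : Freq → TF} (hf : Rapid f) (t : ℝ) (x : Fin 2 → ℝ) :
    HasFDerivAt (Ser f t) (∑ i, (ContinuousLinearMap.proj i : (Fin 2 → ℝ) →L[ℝ] ℝ).smulRight
      (Ser (sym (dsym i) f) t x)) x := by
  set c : Freq → TF := fun k => BoundedContinuousFunction.const ℝ (f k t) with hc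
  have hcr : Rapid c := fun s => (hf s).of_le 1 fun k => by
    have := wt_pos k
    rw [one_mul]
    gcongr
    refine (BoundedContinuousFunction.norm_const_le _).trans ((f k).norm_coe_le_norm t)
  have h0 : Rapid (0 : Freq → TF) := fun s => by
    simp [WSum]
  have key := hasFDerivWithinAt_ser hcr h0 (fun k t _ => by simp [hc]) (p := ((0 : ℝ), x))
    ⟨mem_Ici.2 le_rfl, trivial⟩
  have hi : HasFDerivWithinAt (fun y : Fin 2 → ℝ => ((0 : ℝ), y))
      (ContinuousLinearMap.inr ℝ ℝ (Fin 2 → ℝ)) univ x :=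
    (ContinuousLinearMap.inr ℝ ℝ (Fin 2 → ℝ)).hasFDerivAt.hasFDerivWithinAt
  have := HasFDerivWithinAt.comp x (t := dom) key hi (fun y _ => ⟨mem_Ici.2 le_rfl, trivial⟩)
  rw [hasFDerivWithinAt_univ] at this
  refine (this.congr_fderiv ?_)
  ext v
  simp [lin_apply, hc, Ser, sym]

lemma pd_re_ser {f : Freq → TF} (hf : Rapid f) (i : Fin 2) (t : ℝ) (x : Fin 2 → ℝ) :
    pd i (fun y => (Ser f t y).re) x = (Ser (sym (dsym i) f) t x).re := by
  have h : HasFDerivAt (fun y => (Ser f t y).re) _ x :=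
    Complex.reCLM.hasFDerivAt.comp x (hasFDerivAt_ser_space hf t x)
  rw [pd, h.fderiv]
  fin_cases i <;> simp

lemma deriv_re_ser {f g : Freq → TF} (hf : Rapid f) (hg : Rapid g) (h : ∀ k, TD (f k) (g k))
    {t : ℝ} (ht : 0 < t) (x : Fin 2 → ℝ) :
    deriv (fun s => (Ser f s x).re) t = (Ser g t x).re := by
  have h1 := hasFDerivWithinAt_ser hf hg h (p := (t, x)) ⟨ht.le, trivial⟩
  have hi : HasFDerivWithinAt (fun s : ℝ => (s, x)) (ContinuousLinearMap.inl ℝ ℝ (Fin 2 → ℝ))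
      (Ici 0) t :=
    ((hasFDerivAt_id t).prodMk (hasFDerivAt_const x t)).hasFDerivWithinAt
  have h2 := (HasFDerivWithinAt.comp t (t := dom) h1 hi
    (fun s hs => ⟨hs, trivial⟩)).hasFDerivAt (Ici_mem_nhds ht)
  have h3 : HasFDerivAt (fun s => (Ser f s x).re) _ t := Complex.reCLM.hasFDerivAt.comp t h2
  rw [h3.hasDerivAt.deriv]
  simp [lin_apply]

end Smooth

section Banach

/-- Solvability of `x = x₀ + B(x, x)` in a closed set for a bounded biadditive `B` with small
data. -/
lemma exists_quadratic_fixedPoint {E : Type*} [NormedAddCommGroup E] [CompleteSpace E]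
    (B : E → E → E) (hl : ∀ x y z, B (x - y) z = B x z - B y z)
    (hr : ∀ x y z, B x (y - z) = B x y - B x z) {κ ρ : ℝ} (hκ : 0 ≤ κ)
    (hB : ∀ x y, ‖B x y‖ ≤ κ * ‖x‖ * ‖y‖) (S : Set E) (hS : IsClosed S) (x₀ : E) (hx₀S : x₀ ∈ S)
    (hBS : ∀ x ∈ S, x₀ + B x x ∈ S) (hx₀ : ‖x₀‖ ≤ ρ) (hsmall : 8 * κ * ρ ≤ 1) :
    ∃ x ∈ S, x = x₀ + B x x ∧ ‖x - x₀‖ ≤ 4 * κ * ρ ^ 2 := by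
  have hρ : 0 ≤ ρ := (norm_nonneg _).trans hx₀
  set s : Set E := Metric.closedBall 0 (2 * ρ) ∩ S with hs
  have hsc : IsComplete s := (Metric.isClosed_closedBall.inter hS).isComplete
  have hquad : ∀ x ∈ s, ‖B x x‖ ≤ 4 * κ * ρ ^ 2 := fun x hx => by
    have hx1 : ‖x‖ ≤ 2 * ρ := by simpa using hx.1
    calc ‖B x x‖ ≤ κ * ‖x‖ * ‖x‖ := hB x x
      _ ≤ κ * (2 * ρ) * (2 * ρ) := by gcongr
      _ = _ := by ring
  have hmaps : MapsTo (fun x => x₀ + B x x) s s := fun x hx => by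
    refine ⟨?_, hBS x hx.2⟩
    rw [mem_closedBall_zero_iff]
    refine (norm_add_le _ _).trans ?_
    have := hquad x hx
    nlinarith
  have hcontr : ContractingWith (1 / 2) (hmaps.restrict (fun x => x₀ + B x x) s s) := by
    refine ⟨by rw [← NNReal.coe_lt_coe]; norm_num, LipschitzWith.of_dist_le_mul ?_⟩
    rintro ⟨x, hx⟩ ⟨y, hy⟩
    have hx1 : ‖x‖ ≤ 2 * ρ := by simpa using hx.1
    have hy1 : ‖y‖ ≤ 2 * ρ := by simpa using hy.1
    simp only [Subtype.dist_eq, MapsTo.val_restrict_apply, dist_eq_norm]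
    have e : x₀ + B x x - (x₀ + B y y) = B (x - y) x + B y (x - y) := by
      rw [hl, hr]; abel
    rw [e]
    calc ‖B (x - y) x + B y (x - y)‖ ≤ κ * ‖x - y‖ * ‖x‖ + κ * ‖y‖ * ‖x - y‖ :=
          (norm_add_le _ _).trans (add_le_add (hB _ _) (hB _ _))
      _ ≤ κ * ‖x - y‖ * (2 * ρ) + κ * (2 * ρ) * ‖x - y‖ := by gcongr
      _ = (8 * κ * ρ) / 2 * ‖x - y‖ := by ring
      _ ≤ 1 / 2 * ‖x - y‖ := by gcongr
      _ = _ := by simp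
  have hmem : x₀ ∈ s := ⟨by rw [mem_closedBall_zero_iff]; linarith, hx₀S⟩
  obtain ⟨x, hxs, hfix, -⟩ := hcontr.exists_fixedPoint' hsc hmaps hmem (edist_ne_top _ _)
  have hfix' : x = x₀ + B x x := hfix.symm
  refine ⟨x, hxs.2, hfix', ?_⟩
  have : x - x₀ = B x x := by rw [sub_eq_iff_eq_add']; exact hfix'
  rw [this]
  exact hquad x hxs

end Banach

section FixedPoint

variable {ι : Type*}

/-- Absolutely summable families indexed by components and frequencies. -/
abbrev Coef (ι : Type*) := lp (fun _ : ι × Freq => TF) 1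

lemma Coef.summable (f : Coef ι) : Summable fun p => ‖f p‖ := by
  simpa using (lp.memℓp f).summable (by simp)

lemma Coef.norm_eq (f : Coef ι) : ‖f‖ = ∑' p, ‖f p‖ := by
  simpa using lp.norm_eq_tsum_rpow (p := 1) (by simp) f

/-- An absolutely summable family as an element of `Coef`. -/
def Coef.mk (f : ι × Freq → TF) (h : Summable fun p => ‖f p‖) : Coef ι :=
  ⟨f, memℓp_gen (by simpa using h)⟩

lemma Coef.mk_apply (f : ι × Freq → TF) (h : Summable fun p => ‖f p‖) (p : ι × Freq) :
    Coef.mk f h p = f p := rfl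

/-- The family with weights removed. -/
def Coef.un (f : Coef ι) (a : ι) : Freq → TF := fun k => ((wt k)⁻¹ : ℂ) • f (a, k)

lemma Coef.wt_mul_norm_un (f : Coef ι) (a : ι) (k : Freq) :
    wt k ^ 1 * ‖Coef.un f a k‖ = ‖f (a, k)‖ := by
  have := wt_pos k
  rw [Coef.un, norm_smul, norm_inv, Complex.norm_real, Real.norm_of_nonneg this.le, pow_one,
    mul_inv_cancel_left₀ this.ne']

lemma Coef.summable_fst (f : Coef ι) (a : ι) : Summable fun k => ‖f (a, k)‖ :=
  (Coef.summable f).prod_factor a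

lemma Coef.wsum_un (f : Coef ι) (a : ι) : WSum 1 (Coef.un f a) :=
  (Coef.summable_fst f a).congr fun k => (Coef.wt_mul_norm_un f a k).symm

lemma Coef.un_sub (f g : Coef ι) (a : ι) : Coef.un (f - g) a = Coef.un f a - Coef.un g a := by
  funext k
  simp [Coef.un, smul_sub]

variable [Fintype ι]

lemma Coef.norm_eq_sum (f : Coef ι) : ‖f‖ = ∑ a, ∑' k, ‖f (a, k)‖ := by
  rw [Coef.norm_eq f, (Coef.summable f).tsum_prod, tsum_fintype]

/-- The bilinear expression governing the mild formulation, coefficient by coefficient. -/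
def bil (T : ι → ι → ι → Freq → TF →L[ℂ] TF) (f g : Coef ι) (p : ι × Freq) : TF :=
  (wt p.2 : ℂ) • ∑ a, ∑ a', T p.1 a a' p.2 (conv (Coef.un f a) (Coef.un g a') p.2)

variable {T : ι → ι → ι → Freq → TF →L[ℂ] TF} {ε : ℝ}

lemma norm_bil_le (hε : 0 ≤ ε) (hT : ∀ c a a' k F, ‖T c a a' k F‖ ≤ ε * ‖F‖) (f g : Coef ι)
    (p : ι × Freq) :
    ‖bil T f g p‖ ≤ ε * ∑ a, ∑ a', ∑' j, ‖f (a, j)‖ * ‖g (a', p.2 - j)‖ := by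
  rw [bil, norm_smul, Complex.norm_real, Real.norm_of_nonneg (wt_pos _).le]
  have h1 : ‖∑ a, ∑ a', T p.1 a a' p.2 (conv (Coef.un f a) (Coef.un g a') p.2)‖ ≤
      ∑ a, ∑ a', ε * ‖conv (Coef.un f a) (Coef.un g a') p.2‖ :=
    (norm_sum_le _ _).trans (Finset.sum_le_sum fun a _ => (norm_sum_le _ _).trans
      (Finset.sum_le_sum fun a' _ => hT _ _ _ _ _))
  refine (mul_le_mul_of_nonneg_left h1 (wt_pos _).le).trans ?_
  simp only [Finset.mul_sum]
  refine Finset.sum_le_sum fun a _ => Finset.sum_le_sum fun a' _ => ?_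
  have h2 := wt_pow_mul_norm_conv_le (Coef.wsum_un f a) (Coef.wsum_un g a') p.2
  simp only [Coef.wt_mul_norm_un] at h2
  calc wt p.2 * (ε * ‖conv (Coef.un f a) (Coef.un g a') p.2‖)
      = ε * (wt p.2 ^ 1 * ‖conv (Coef.un f a) (Coef.un g a') p.2‖) := by ring
    _ ≤ _ := by gcongr

lemma hasSum_bil_bound (f g : Coef ι) :
    HasSum (fun k => ∑ a, ∑ a', ∑' j, ‖f (a, j)‖ * ‖g (a', k - j)‖) (‖f‖ * ‖g‖) := by
  have : ‖f‖ * ‖g‖ = ∑ a, ∑ a', (∑' k, ‖f (a, k)‖) * ∑' k, ‖g (a', k)‖ := by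
    rw [Coef.norm_eq_sum, Coef.norm_eq_sum g, Finset.sum_mul_sum]
  rw [this]
  refine hasSum_sum fun a _ => hasSum_sum fun a' _ => ?_
  have hs := summable_shear (Coef.summable_fst f a) (Coef.summable_fst g a') (fun _ => norm_nonneg _)
    (fun _ => norm_nonneg _)
  rw [← tsum_shear (Coef.summable_fst f a) (Coef.summable_fst g a') (fun _ => norm_nonneg _)
    (fun _ => norm_nonneg _)]
  exact hs.prod.hasSum

lemma summable_bil (hε : 0 ≤ ε) (hT : ∀ c a a' k F, ‖T c a a' k F‖ ≤ ε * ‖F‖) (f g : Coef ι) :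
    Summable fun p => ‖bil T f g p‖ := by
  refine Summable.of_nonneg_of_le (fun _ => norm_nonneg _) (norm_bil_le hε hT f g) ?_
  refine Summable.mul_left ε ?_
  rw [summable_prod_of_nonneg fun p => by positivity]
  refine ⟨fun c => (hasSum_bil_bound f g).summable, Summable.of_finite⟩

lemma tsum_bil_le (hε : 0 ≤ ε) (hT : ∀ c a a' k F, ‖T c a a' k F‖ ≤ ε * ‖F‖) (f g : Coef ι) :
    ∑' p, ‖bil T f g p‖ ≤ (Fintype.card ι * ε) * ‖f‖ * ‖g‖ := by
  rw [(summable_bil hε hT f g).tsum_prod, tsum_fintype]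
  have : ∀ c : ι, ∑' k, ‖bil T f g (c, k)‖ ≤ ε * (‖f‖ * ‖g‖) := fun c => by
    have hb := (hasSum_bil_bound f g).mul_left ε
    rw [← hb.tsum_eq]
    exact ((summable_bil hε hT f g).prod_factor c).tsum_le_tsum
      (fun k => norm_bil_le hε hT f g (c, k)) hb.summable
  refine (Finset.sum_le_sum fun c _ => this c).trans ?_
  simp [mul_assoc]

lemma conv_sub_right {f g h : Freq → TF} (hf : WSum 0 f) (hg : WSum 0 g) (hh : WSum 0 h) :
    conv f (g - h) = conv f g - conv f h := by
  funext k
  simp only [conv, Pi.sub_apply, mul_sub]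
  exact (summable_conv hf hg k).tsum_sub (summable_conv hf hh k)

lemma conv_sub_left {f g h : Freq → TF} (hf : WSum 0 f) (hg : WSum 0 g) (hh : WSum 0 h) :
    conv (f - g) h = conv f h - conv g h := by
  rw [conv_comm, conv_sub_right hh hf hg, conv_comm h f, conv_comm h g]

theorem exists_mild (hε : 0 ≤ ε) (hT : ∀ c a a' k F, ‖T c a a' k F‖ ≤ ε * ‖F‖)
    (hTstar : ∀ c a a' k F, T c a a' (-k) (star F) = star (T c a a' k F))
    (x : ι → Freq → TF) (hx : ∀ c, WSum 1 (x c)) (hxh : ∀ c, Herm (x c)) {ρ : ℝ}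
    (hρ : ∑ c, ∑' k, wt k * ‖x c k‖ ≤ ρ) (hsmall : 8 * (Fintype.card ι * ε) * ρ ≤ 1) :
    ∃ f : ι → Freq → TF, (∀ c, WSum 1 (f c)) ∧ (∀ c, Herm (f c)) ∧
      (∀ c k, f c k = x c k + ∑ a, ∑ a', T c a a' k (conv (f a) (f a') k)) ∧
      (∀ c, ∑' k, wt k * ‖f c k - x c k‖ ≤ 4 * (Fintype.card ι * ε) * ρ ^ 2) := by
  have hsx : Summable fun p : ι × Freq => ‖(wt p.2 : ℂ) • x p.1 p.2‖ := by
    rw [summable_prod_of_nonneg fun p => norm_nonneg _]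
    refine ⟨fun c => ?_, Summable.of_finite⟩
    refine (hx c).congr fun k => ?_
    simp [norm_smul, abs_of_pos (wt_pos k)]
  set x₀ : Coef ι := Coef.mk _ hsx with hx₀
  have hx₀n : ‖x₀‖ ≤ ρ := by
    rw [Coef.norm_eq_sum]
    refine le_trans (le_of_eq ?_) hρ
    refine Finset.sum_congr rfl fun c _ => tsum_congr fun k => ?_
    rw [hx₀, Coef.mk_apply, norm_smul, Complex.norm_real, Real.norm_of_nonneg (wt_pos k).le]
  set B : Coef ι → Coef ι → Coef ι := fun f g => Coef.mk _ (summable_bil hε hT f g) with hB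
  set S : Set (Coef ι) := {f | ∀ c k, f (c, -k) = star (f (c, k))} with hS
  have hev : ∀ p : ι × Freq, Continuous fun f : Coef ι => f p := fun p => by
    have := (lp.evalCLM ℂ (fun _ : ι × Freq => TF) (p := 1) p).continuous
    exact this
  have hScl : IsClosed S := by
    simp only [hS, Set.ofPred_forall]
    exact isClosed_iInter fun c => isClosed_iInter fun k =>
      isClosed_eq (hev _) (continuous_star.comp (hev _))
  have hun : ∀ f ∈ S, ∀ a, Herm (Coef.un f a) := fun f hf a k => by
    simp only [Coef.un, wt_neg, hf a k]
    ext t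
    simp
  obtain ⟨y, hyS, hy, hyn⟩ := exists_quadratic_fixedPoint B
    (fun f g h => by
      ext1; funext p
      simp only [hB, lp.coeFn_sub, Pi.sub_apply, Coef.mk_apply, bil, Coef.un_sub]
      simp only [conv_sub_left (Coef.wsum_un f _).zero (Coef.wsum_un g _).zero (Coef.wsum_un h _).zero,
        Pi.sub_apply, map_sub, Finset.sum_sub_distrib, smul_sub])
    (fun f g h => by
      ext1; funext p
      simp only [hB, lp.coeFn_sub, Pi.sub_apply, Coef.mk_apply, bil, Coef.un_sub]
      simp only [conv_sub_right (Coef.wsum_un f _).zero (Coef.wsum_un g _).zero (Coef.wsum_un h _).zero,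
        Pi.sub_apply, map_sub, Finset.sum_sub_distrib, smul_sub])
    (κ := Fintype.card ι * ε) (by positivity)
    (fun f g => by
      rw [Coef.norm_eq (B f g)]
      exact tsum_bil_le hε hT f g)
    S hScl x₀
    (fun c k => by
      simp only [hx₀, Coef.mk_apply, wt_neg, hxh c k]
      ext t
      simp)
    (fun f hf c k => by
      simp only [lp.coeFn_add, Pi.add_apply, hx₀, hB, Coef.mk_apply, bil, wt_neg, hxh c k]
      have : ∀ a a', conv (Coef.un f a) (Coef.un f a') (-k) = star (conv (Coef.un f a) (Coef.un f a') k) :=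
        fun a a' => (hun f hf a).conv (hun f hf a') k
      simp only [this, hTstar, star_add, star_smul, star_sum]
      simp)
    hx₀n hsmall
  have hwt : ∀ k, (wt k : ℂ) ≠ 0 := fun k => by exact_mod_cast (wt_pos k).ne'
  have hyk : ∀ c k, Coef.un y c k = x c k + ∑ a, ∑ a', T c a a' k (conv (Coef.un y a) (Coef.un y a') k) := by
    intro c k
    have h1 : y (c, k) = x₀ (c, k) + B y y (c, k) := by
      conv_lhs => rw [hy]
      simp
    simp only [hx₀, hB, Coef.mk_apply, bil, ← smul_add] at h1
    rw [Coef.un, h1, ← smul_assoc]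
    simp [hwt k]
  refine ⟨Coef.un y, Coef.wsum_un y, hun y hyS, hyk, fun c => ?_⟩
  refine le_trans ?_ hyn
  have hnn : ∀ k, wt k * ‖Coef.un y c k - x c k‖ = ‖(y - x₀) (c, k)‖ := fun k => by
    have h1 : y (c, k) = (wt k : ℂ) • Coef.un y c k := by simp [Coef.un, hwt k]
    rw [lp.coeFn_sub, Pi.sub_apply, h1, hx₀, Coef.mk_apply, ← smul_sub, norm_smul,
      Complex.norm_real, Real.norm_of_nonneg (wt_pos k).le]
  rw [tsum_congr hnn, Coef.norm_eq_sum]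
  exact Finset.single_le_sum (f := fun c => ∑' k, ‖(y - x₀) (c, k)‖)
    (fun c _ => tsum_nonneg fun k => norm_nonneg _) (Finset.mem_univ c)

end FixedPoint

section Duhamel

/-- The decaying exponential `exp(-l t)` for `t ≥ 0`, extended by a constant. -/
def heat (l : ℝ) : TF :=
  BoundedContinuousFunction.ofNormedAddCommGroup
    (fun t : ℝ => ((Real.exp (-(|l| * max t 0)) : ℝ) : ℂ)) (by fun_prop) 1 (fun t => by
      rw [Complex.norm_real, Real.norm_of_nonneg (exp_pos _).le, exp_le_one_iff]
      have := abs_nonneg l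
      have := le_max_right t 0
      nlinarith)

lemma heat_apply {l : ℝ} (hl : 0 ≤ l) (t : ℝ) :
    heat l t = ((Real.exp (-(l * max t 0)) : ℝ) : ℂ) := by
  simp [heat, abs_of_nonneg hl]

lemma norm_heat_apply {l : ℝ} (hl : 0 ≤ l) (t : ℝ) :
    ‖heat l t‖ = Real.exp (-(l * max t 0)) := by
  rw [heat_apply hl, Complex.norm_real, Real.norm_of_nonneg (exp_pos _).le]

lemma norm_heat_le (l : ℝ) : ‖heat l‖ ≤ 1 :=
  BoundedContinuousFunction.norm_ofNormedAddCommGroup_le _ zero_le_one _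

lemma star_heat (l : ℝ) : star (heat l) = heat l := by
  ext t
  rw [BoundedContinuousFunction.star_apply]
  exact Complex.conj_ofReal _

lemma heat_zero_apply (l : ℝ) : heat l 0 = 1 := by
  simp [heat]

lemma td_heat {l : ℝ} (hl : 0 ≤ l) : TD (heat l) ((-l : ℂ) • heat l) := by
  refine TD.of_hasDerivWithinAt fun t ht => ?_
  have h : HasDerivAt (fun t : ℝ => ((Real.exp (-(l * t)) : ℝ) : ℂ))
      ((Real.exp (-(l * t)) * (-l) : ℝ) : ℂ) t := by
    have := ((hasDerivAt_id t).const_mul l).neg.exp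
    simpa using this.ofReal_comp
  refine (h.hasDerivWithinAt (s := Ici 0)).congr_deriv ?_ |>.congr (fun s hs => ?_) ?_
  · simp [heat_apply hl, max_eq_left ht]
    ring
  · rw [heat_apply hl, max_eq_left hs]
  · rw [heat_apply hl, max_eq_left ht]

/-- The solution of `f' = -l f + F`, `f 0 = 0`. -/
def duhFun (l : ℝ) (F : TF) (t : ℝ) : ℂ :=
  ((Real.exp (-(l * max t 0)) : ℝ) : ℂ) *
    ∫ s in (0 : ℝ)..(max t 0), ((Real.exp (l * s) : ℝ) : ℂ) * F s

lemma continuous_duhFun (l : ℝ) (F : TF) : Continuous (duhFun l F) := by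
  have h : Continuous fun s : ℝ => ((Real.exp (l * s) : ℝ) : ℂ) * F s := by
    have := F.continuous
    fun_prop
  have h2 : Continuous fun m : ℝ => ∫ s in (0 : ℝ)..m, ((Real.exp (l * s) : ℝ) : ℂ) * F s :=
    continuous_iff_continuousAt.2 fun t =>
      (h.integral_hasStrictDerivAt 0 t).hasDerivAt.continuousAt
  unfold duhFun
  have h3 : Continuous fun t : ℝ => max t 0 := by fun_prop
  exact (by fun_prop : Continuous fun t : ℝ =>
    ((Real.exp (-(l * max t 0)) : ℝ) : ℂ)).mul (h2.comp h3)

lemma norm_duhFun_le {l m C : ℝ} (F : TF)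
    (hF : ∀ s, 0 ≤ s → ‖F s‖ ≤ C * Real.exp (-(m * s))) (t : ℝ) :
    ‖duhFun l F t‖ ≤ C * ∫ s in (0 : ℝ)..(max t 0),
      Real.exp (-(l * (max t 0 - s))) * Real.exp (-(m * s)) := by
  set r := max t 0 with hr
  have hr0 : 0 ≤ r := le_max_right _ _
  rw [duhFun, norm_mul, Complex.norm_real, Real.norm_of_nonneg (exp_pos _).le]
  have h1 : ‖∫ s in (0 : ℝ)..r, ((Real.exp (l * s) : ℝ) : ℂ) * F s‖ ≤
      ∫ s in (0 : ℝ)..r, Real.exp (l * s) * (C * Real.exp (-(m * s))) := by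
    refine intervalIntegral.norm_integral_le_of_norm_le hr0 ?_
      (Continuous.intervalIntegrable (by fun_prop) _ _)
    refine Filter.Eventually.of_forall fun s hs => ?_
    rw [norm_mul, Complex.norm_real, Real.norm_of_nonneg (exp_pos _).le]
    have := hF s hs.1.le
    gcongr
  refine (mul_le_mul_of_nonneg_left h1 (exp_pos _).le).trans (le_of_eq ?_)
  rw [← intervalIntegral.integral_const_mul, ← intervalIntegral.integral_const_mul]
  refine intervalIntegral.integral_congr fun s _ => ?_
  change _ = C * (Real.exp (-(l * (r - s))) * Real.exp (-(m * s)))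
  rw [show -(l * (r - s)) = -(l * r) + l * s by ring, Real.exp_add]
  ring

lemma integral_exp_neg_le {m : ℝ} (hm : 0 < m) {r : ℝ} :
    ∫ s in (0 : ℝ)..r, Real.exp (-(m * s)) ≤ 1 / m := by
  have : ∀ s : ℝ, HasDerivAt (fun s => -(1 / m) * Real.exp (-(m * s))) (Real.exp (-(m * s))) s := by
    intro s
    have := (((hasDerivAt_id s).const_mul m).neg.exp).const_mul (-(1 / m))
    refine this.congr_deriv ?_
    simp
    field_simp
  rw [intervalIntegral.integral_eq_sub_of_hasDerivAt (fun s _ => this s)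
    (Continuous.intervalIntegrable (by fun_prop) _ _)]
  have := exp_pos (-(m * r))
  have hm' : 0 < 1 / m := by positivity
  simp
  simp at hm'
  positivity

lemma norm_duhFun_le_left {l C : ℝ} (hl : 0 < l) (F : TF)
    (hF : ∀ s, 0 ≤ s → ‖F s‖ ≤ C) (t : ℝ) : ‖duhFun l F t‖ ≤ C / l := by
  have hC : 0 ≤ C := (norm_nonneg _).trans (hF 0 le_rfl)
  refine (norm_duhFun_le F (l := l) (m := 0) (C := C) (fun s hs => by simpa using hF s hs) t).trans ?_
  rw [div_eq_mul_one_div]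
  refine mul_le_mul_of_nonneg_left ?_ hC
  refine le_trans (le_of_eq ?_) (integral_exp_neg_le hl (r := max t 0))
  have := intervalIntegral.integral_comp_sub_left (a := 0) (b := max t 0)
    (fun s => Real.exp (-(l * s))) (max t 0)
  simpa using this

lemma norm_duhFun_le_right {l m C : ℝ} (hl : 0 < l) (hm : 0 < m) (F : TF)
    (hF : ∀ s, 0 ≤ s → ‖F s‖ ≤ C * Real.exp (-(m * s))) (t : ℝ) : ‖duhFun l F t‖ ≤ C / m := by
  have hC : 0 ≤ C := by simpa using (norm_nonneg _).trans (hF 0 le_rfl)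
  refine (norm_duhFun_le F hF t).trans ?_
  rw [div_eq_mul_one_div]
  refine mul_le_mul_of_nonneg_left (le_trans ?_ (integral_exp_neg_le hm (r := max t 0))) hC
  refine intervalIntegral.integral_mono_on (le_max_right _ _)
    (Continuous.intervalIntegrable (by fun_prop) _ _)
    (Continuous.intervalIntegrable (by fun_prop) _ _) fun s hs => ?_
  refine mul_le_of_le_one_left (exp_pos _).le (exp_le_one_iff.2 ?_)
  have : 0 ≤ max t 0 - s := sub_nonneg.2 hs.2
  have := mul_nonneg hl.le this
  linarith

/-- The Duhamel operator `F ↦ ∫₀ᵗ exp(-l (t - s)) F(s) ds`, set to zero for `l ≤ 0`. -/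
def duh (l : ℝ) : TF →L[ℂ] TF :=
  if hl : 0 < l then
    LinearMap.mkContinuous
      { toFun := fun F => BoundedContinuousFunction.ofNormedAddCommGroup (duhFun l F)
          (continuous_duhFun l F) (‖F‖ / l)
          (norm_duhFun_le_left hl F fun s _ => F.norm_coe_le_norm s)
        map_add' := fun F G => by
          ext t
          have hi : ∀ F : TF, IntervalIntegrable
              (fun s : ℝ => ((Real.exp (l * s) : ℝ) : ℂ) * F s) volume 0 (max t 0) := fun F => by
            have := F.continuous
            exact Continuous.intervalIntegrable (by fun_prop) _ _
          simp only [BoundedContinuousFunction.coe_ofNormedAddCommGroup, duhFun,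
            BoundedContinuousFunction.coe_add, Pi.add_apply, mul_add]
          rw [intervalIntegral.integral_add (hi F) (hi G), mul_add]
        map_smul' := fun c F => by
          ext t
          simp only [BoundedContinuousFunction.coe_ofNormedAddCommGroup, duhFun,
            BoundedContinuousFunction.coe_smul, smul_eq_mul, RingHom.id_apply]
          simp only [mul_left_comm _ c, intervalIntegral.integral_const_mul] }
      (1 / l) fun F => by
        rw [one_div_mul_eq_div]
        exact BoundedContinuousFunction.norm_ofNormedAddCommGroup_le (continuous_duhFun l F)
          (by positivity) (norm_duhFun_le_left hl F fun s _ => F.norm_coe_le_norm s)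
  else 0

lemma duh_apply {l : ℝ} (hl : 0 < l) (F : TF) (t : ℝ) : duh l F t = duhFun l F t := by
  simp [duh, hl]

lemma duh_zero : duh 0 = 0 := by simp [duh]

lemma duh_apply_zero (l : ℝ) (F : TF) : duh l F 0 = 0 := by
  by_cases hl : 0 < l
  · simp [duh_apply hl, duhFun]
  · simp [duh, hl]

lemma norm_duh_le {l : ℝ} (hl : 0 < l) (F : TF) : ‖duh l F‖ ≤ ‖F‖ / l := by
  rw [BoundedContinuousFunction.norm_le (by positivity)]
  intro t
  rw [duh_apply hl]
  exact norm_duhFun_le_left hl F (fun s _ => F.norm_coe_le_norm s) t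

lemma norm_duh_heat_le {l m : ℝ} (hl : 0 < l) (hm : 0 < m) (F : TF) :
    ‖duh l (heat m * F)‖ ≤ ‖F‖ / m := by
  rw [BoundedContinuousFunction.norm_le (by positivity)]
  intro t
  rw [duh_apply hl]
  refine norm_duhFun_le_right hl hm _ (fun s hs => ?_) t
  rw [BoundedContinuousFunction.coe_mul, Pi.mul_apply, norm_mul, norm_heat_apply hm.le,
    max_eq_left hs, mul_comm]
  have := F.norm_coe_le_norm s
  gcongr

lemma norm_duh_heat_le_sqrt {l m : ℝ} (hl : 0 < l) (hm : 0 < m) (F : TF) :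
    ‖duh l (heat m * F)‖ ≤ ‖F‖ / √(l * m) := by
  have h1 := norm_duh_heat_le hl hm F
  have h2 : ‖duh l (heat m * F)‖ ≤ ‖F‖ / l := by
    refine (norm_duh_le hl _).trans ?_
    gcongr
    refine (norm_mul_le _ _).trans ?_
    exact mul_le_of_le_one_left (norm_nonneg _) (norm_heat_le m)
  have hs : 0 < √(l * m) := by positivity
  rw [le_div_iff₀ hm] at h1
  rw [le_div_iff₀ hl] at h2
  rw [le_div_iff₀ hs]
  refine (pow_le_pow_iff_left₀ (by positivity) (norm_nonneg _) two_ne_zero).1 ?_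
  rw [mul_pow, Real.sq_sqrt (by positivity)]
  have := norm_nonneg (duh l (heat m * F))
  calc ‖duh l (heat m * F)‖ ^ 2 * (l * m)
      = (‖duh l (heat m * F)‖ * l) * (‖duh l (heat m * F)‖ * m) := by ring
    _ ≤ ‖F‖ * ‖F‖ := by gcongr
    _ = _ := by ring

lemma star_duh (l : ℝ) (F : TF) : duh l (star F) = star (duh l F) := by
  by_cases hl : 0 < l
  · ext t
    rw [BoundedContinuousFunction.star_apply, duh_apply hl, duh_apply hl, duhFun, duhFun,
      star_mul']
    congr 1
    · exact (Complex.conj_ofReal _).symm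
    · rw [Complex.star_def, intervalIntegral.integral_of_le (le_max_right _ _),
        intervalIntegral.integral_of_le (le_max_right _ _), ← integral_conj]
      refine integral_congr_ae (Filter.Eventually.of_forall fun s => ?_)
      simp only [map_mul, Complex.conj_ofReal]
      rfl
  · simp [duh, hl]

lemma td_duh {l : ℝ} (hl : 0 < l) (F : TF) :
    TD (duh l F) (((-l : ℝ) : ℂ) • duh l F + F) := by
  refine TD.of_hasDerivWithinAt fun t ht => ?_
  have hc : Continuous fun s : ℝ => ((Real.exp (l * s) : ℝ) : ℂ) * F s := by
    have := F.continuous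
    fun_prop
  have h1 := (hc.integral_hasStrictDerivAt 0 t).hasDerivAt
  have h : HasDerivAt (fun t : ℝ => ((Real.exp (-(l * t)) : ℝ) : ℂ))
      ((Real.exp (-(l * t)) * (-l) : ℝ) : ℂ) t := by
    have := ((hasDerivAt_id t).const_mul l).neg.exp
    simpa using this.ofReal_comp
  refine ((h.mul h1).hasDerivWithinAt (s := Ici 0)).congr_deriv ?_ |>.congr (fun s hs => ?_) ?_
  · simp only [BoundedContinuousFunction.coe_add, Pi.add_apply, BoundedContinuousFunction.coe_smul,
      smul_eq_mul, duh_apply hl, duhFun, max_eq_left ht]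
    rw [← mul_assoc, ← Complex.ofReal_mul, ← Real.exp_add]
    simp
    ring
  · rw [duh_apply hl, duhFun, max_eq_left hs]
    rfl
  · rw [duh_apply hl, duhFun, max_eq_left ht]
    rfl

end Duhamel

section Theta

/-- The positive lower bound of the profile `theta`. -/
def thetaMin (ν : ℝ) : ℝ := (√(max ν 1))⁻¹

lemma thetaMin_pos (ν : ℝ) : 0 < thetaMin ν := by
  have : 0 < max ν 1 := by positivity
  unfold thetaMin
  positivity

lemma thetaMin_eq {ν : ℝ} (hν : 1 ≤ ν) : thetaMin ν = (√ν)⁻¹ := by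
  rw [thetaMin, max_eq_left hν]

/-- A positive profile bounding the velocity: `exp(-ν t) + ν^{-1/2}` for `ν ≥ 1`. -/
def theta (ν : ℝ) : TF := heat ν + BoundedContinuousFunction.const ℝ (thetaMin ν : ℂ)

/-- The reciprocal of `theta`. -/
def thetaInv (ν : ℝ) : TF :=
  BoundedContinuousFunction.ofNormedAddCommGroup
    (fun t : ℝ => (((Real.exp (-(|ν| * max t 0)) + thetaMin ν)⁻¹ : ℝ) : ℂ)) (by
      have := thetaMin_pos ν
      refine Complex.continuous_ofReal.comp (Continuous.inv₀ (by fun_prop) fun t => ?_)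
      positivity) (thetaMin ν)⁻¹ (fun t => by
      have := thetaMin_pos ν
      rw [Complex.norm_real, Real.norm_of_nonneg (by positivity)]
      gcongr
      linarith [exp_pos (-(|ν| * max t 0))])

lemma thetaInv_mul_theta (ν : ℝ) : thetaInv ν * theta ν = 1 := by
  ext t
  have : Real.exp (-(|ν| * max t 0)) + thetaMin ν ≠ 0 := by
    have := thetaMin_pos ν
    positivity
  simp only [thetaInv, theta, heat, BoundedContinuousFunction.coe_mul, Pi.mul_apply,
    BoundedContinuousFunction.coe_ofNormedAddCommGroup, BoundedContinuousFunction.coe_add,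
    Pi.add_apply, BoundedContinuousFunction.const_apply, BoundedContinuousFunction.coe_one,
    Pi.one_apply, ← Complex.ofReal_add, ← Complex.ofReal_mul]
  rw [inv_mul_cancel₀ this, Complex.ofReal_one]

lemma star_theta (ν : ℝ) : star (theta ν) = theta ν := by
  rw [theta, star_add, star_heat]
  congr 1
  ext t
  simp [Complex.conj_ofReal]

lemma star_thetaInv (ν : ℝ) : star (thetaInv ν) = thetaInv ν := by
  ext t
  rw [BoundedContinuousFunction.star_apply]
  exact Complex.conj_ofReal _

lemma norm_thetaInv_le {ν : ℝ} (hν : 1 ≤ ν) : ‖thetaInv ν‖ ≤ √ν := by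
  have := thetaMin_pos ν
  refine (BoundedContinuousFunction.norm_ofNormedAddCommGroup_le _ (by positivity) _).trans ?_
  rw [thetaMin_eq hν, inv_inv]

lemma norm_theta_le {ν : ℝ} (hν : 1 ≤ ν) : ‖theta ν‖ ≤ 2 := by
  refine (norm_add_le _ _).trans ?_
  have h1 := norm_heat_le ν
  have h2 : ‖BoundedContinuousFunction.const ℝ (thetaMin ν : ℂ)‖ ≤ 1 := by
    refine (BoundedContinuousFunction.norm_const_le _).trans ?_
    rw [Complex.norm_real, Real.norm_of_nonneg (thetaMin_pos ν).le, thetaMin_eq hν]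
    exact inv_le_one_of_one_le₀ (Real.one_le_sqrt.2 hν)
  linarith

lemma norm_thetaInv_mul_heat_le {ν l : ℝ} (hν : 0 ≤ ν) (hl : ν ≤ l) :
    ‖thetaInv ν * heat l‖ ≤ 1 := by
  rw [BoundedContinuousFunction.norm_le zero_le_one]
  intro t
  have h0 := thetaMin_pos ν
  have h1 := exp_pos (-(ν * max t 0))
  rw [BoundedContinuousFunction.coe_mul, Pi.mul_apply, norm_mul, norm_heat_apply (hν.trans hl)]
  simp only [thetaInv, BoundedContinuousFunction.coe_ofNormedAddCommGroup, abs_of_nonneg hν]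
  rw [Complex.norm_real, Real.norm_of_nonneg (by positivity), inv_mul_le_iff₀ (by positivity),
    mul_one]
  have h2 : Real.exp (-(l * max t 0)) ≤ Real.exp (-(ν * max t 0)) := by
    have := le_max_right t 0
    gcongr
  linarith

lemma norm_duh_theta_le {ν l : ℝ} (hν : 1 ≤ ν) (hl : 0 < l) (F : TF) :
    ‖duh l (theta ν * F)‖ ≤ (1 / √(l * ν) + 1 / (l * √ν)) * ‖F‖ := by
  have hν0 : 0 < ν := by linarith
  rw [theta, add_mul, map_add]
  refine (norm_add_le _ _).trans ?_
  rw [add_mul]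
  refine add_le_add ((norm_duh_heat_le_sqrt hl hν0 F).trans (le_of_eq (by ring)))
    ((norm_duh_le hl _).trans ?_)
  have h2 : ‖BoundedContinuousFunction.const ℝ (thetaMin ν : ℂ)‖ ≤ (√ν)⁻¹ := by
    refine (BoundedContinuousFunction.norm_const_le _).trans ?_
    rw [Complex.norm_real, Real.norm_of_nonneg (thetaMin_pos ν).le, thetaMin_eq hν]
  calc ‖BoundedContinuousFunction.const ℝ (thetaMin ν : ℂ) * F‖ / l
      ≤ ((√ν)⁻¹ * ‖F‖) / l := by
        gcongr
        exact (norm_mul_le _ _).trans (by gcongr)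
    _ = _ := by field_simp

end Theta

section Symbols

/-- The symbol of `-Δ`. -/
def lam (k : Freq) : ℝ := 4 * π ^ 2 * ((k 0 : ℝ) ^ 2 + (k 1 : ℝ) ^ 2)

lemma lam_zero : lam 0 = 0 := by simp [lam]

lemma lam_nonneg (k : Freq) : 0 ≤ lam k := by unfold lam; positivity

lemma lam_neg (k : Freq) : lam (-k) = lam k := by simp [lam]

lemma dsym_zero (i : Fin 2) : dsym i 0 = 0 := by simp [dsym]

lemma wt_sq_le_lam {k : Freq} (hk : k ≠ 0) : wt k ^ 2 ≤ lam k := by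
  have h1 : (1 : ℝ) ≤ |(k 0 : ℝ)| + |(k 1 : ℝ)| := by
    by_contra! h
    apply hk
    have h0 : |k 0| + |k 1| < 1 := by exact_mod_cast h
    have e0 : k 0 = 0 := abs_eq_zero.1 (by have := abs_nonneg (k 0); have := abs_nonneg (k 1); omega)
    have e1 : k 1 = 0 := abs_eq_zero.1 (by have := abs_nonneg (k 0); have := abs_nonneg (k 1); omega)
    funext i
    fin_cases i <;> simp [e0, e1]
  have hpi : 3 < π := Real.pi_gt_three
  have hs : wt k ^ 2 ≤ 8 * ((k 0 : ℝ) ^ 2 + (k 1 : ℝ) ^ 2) := by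
    unfold wt
    rw [← sq_abs (k 0 : ℝ), ← sq_abs (k 1 : ℝ)]
    nlinarith [sq_nonneg (|(k 0 : ℝ)| - |(k 1 : ℝ)|), abs_nonneg (k 0 : ℝ), abs_nonneg (k 1 : ℝ)]
  refine hs.trans ?_
  unfold lam
  have : 8 ≤ 4 * π ^ 2 := by nlinarith
  gcongr

lemma one_le_lam {k : Freq} (hk : k ≠ 0) : 1 ≤ lam k :=
  (one_le_pow₀ (one_le_wt k)).trans (wt_sq_le_lam hk)

lemma lam_pos {k : Freq} (hk : k ≠ 0) : 0 < lam k := zero_lt_one.trans_le (one_le_lam hk)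

lemma polyBdd_lam : PolyBdd fun k => (lam k : ℂ) := by
  refine ⟨8 * π ^ 2, 2, by positivity, fun k => ?_⟩
  rw [Complex.norm_real, Real.norm_of_nonneg (lam_nonneg k), lam]
  have h0 := pow_le_pow_left₀ (abs_nonneg _) (abs_le_wt k 0) 2
  have h1 := pow_le_pow_left₀ (abs_nonneg _) (abs_le_wt k 1) 2
  rw [sq_abs] at h0 h1
  nlinarith [sq_nonneg π]

lemma norm_dsym_le_sqrt (i : Fin 2) (k : Freq) : ‖dsym i k‖ ≤ √(lam k) := by
  rw [norm_dsym]
  refine Real.le_sqrt_of_sq_le ?_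
  rw [mul_pow, sq_abs, lam]
  have : (k i : ℝ) ^ 2 ≤ (k 0 : ℝ) ^ 2 + (k 1 : ℝ) ^ 2 := by
    fin_cases i <;> simp <;> positivity
  calc (2 * π) ^ 2 * (k i : ℝ) ^ 2 ≤ (2 * π) ^ 2 * ((k 0 : ℝ) ^ 2 + (k 1 : ℝ) ^ 2) := by gcongr
    _ = _ := by ring

lemma sum_dsym_sq (k : Freq) : ∑ i, dsym i k * dsym i k = -(lam k : ℂ) := by
  simp only [Fin.sum_univ_two, dsym, lam]
  push_cast
  linear_combination (4 * π ^ 2 * ((k 0 : ℂ) ^ 2 + (k 1 : ℂ) ^ 2)) * Complex.I_sq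

/-- The symbol of the `(i, l)` entry of the Leray projection composed with `∂_j`. -/
def mu (i l j : Fin 2) (k : Freq) : ℂ :=
  dsym j k * ((if i = l then 1 else 0) + dsym i k * dsym l k / lam k)

lemma mu_zero (i l j : Fin 2) : mu i l j 0 = 0 := by simp [mu, dsym_zero]

lemma norm_mu_le (i l j : Fin 2) (k : Freq) : ‖mu i l j k‖ ≤ 2 * ‖dsym j k‖ := by
  rw [mu, norm_mul, mul_comm]
  gcongr
  refine (norm_add_le _ _).trans ?_
  have h1 : ‖(if i = l then 1 else 0 : ℂ)‖ ≤ 1 := by split_ifs <;> simp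
  have h2 : ‖dsym i k * dsym l k / lam k‖ ≤ 1 := by
    rw [norm_div, norm_mul, Complex.norm_real, Real.norm_of_nonneg (lam_nonneg k)]
    refine div_le_one_of_le₀ ?_ (lam_nonneg k)
    calc ‖dsym i k‖ * ‖dsym l k‖ ≤ √(lam k) * √(lam k) := by
          gcongr <;> exact norm_dsym_le_sqrt _ _
      _ = _ := Real.mul_self_sqrt (lam_nonneg k)
  linarith

lemma norm_mu_le_sqrt (i l j : Fin 2) (k : Freq) : ‖mu i l j k‖ ≤ 2 * √(lam k) :=
  (norm_mu_le i l j k).trans (by have := norm_dsym_le_sqrt j k; gcongr)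

lemma mu_neg (i l j : Fin 2) (k : Freq) : mu i l j (-k) = star (mu i l j k) := by
  have h : star (if i = l then 1 else 0 : ℂ) = if i = l then 1 else 0 := by split_ifs <;> simp
  have h2 : star (lam k : ℂ) = lam k := Complex.conj_ofReal _
  simp only [mu, dsym_neg, lam_neg, star_mul', star_add, star_div₀, h, h2]

lemma sum_dsym_mu (l j : Fin 2) (k : Freq) : ∑ i, dsym i k * mu i l j k = 0 := by
  by_cases hk : k = 0
  · simp [hk, dsym_zero]
  have hl : (lam k : ℂ) ≠ 0 := by exact_mod_cast (lam_pos hk).ne'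
  have h : ∑ i, dsym i k * mu i l j k = dsym j k * (∑ i, dsym i k * (if i = l then 1 else 0)) +
      dsym j k * dsym l k * (∑ i, dsym i k * dsym i k) / lam k := by
    simp only [mu, Fin.sum_univ_two]
    ring
  rw [h, sum_dsym_sq]
  simp
  field_simp
  ring

lemma PolyBdd.of_norm_le {c d : Freq → ℂ} (C : ℝ) (hC : 0 ≤ C) (hd : PolyBdd d)
    (h : ∀ k, ‖c k‖ ≤ C * ‖d k‖) : PolyBdd c := by
  obtain ⟨D, r, hD, hDr⟩ := hd
  refine ⟨C * D, r, by positivity, fun k => (h k).trans ?_⟩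
  rw [mul_assoc]
  have := hDr k
  gcongr

lemma polyBdd_mu (i l j : Fin 2) : PolyBdd (mu i l j) :=
  (polyBdd_dsym j).of_norm_le 2 zero_le_two (norm_mu_le i l j)

end Symbols

section System

/-- The multipliers in the mild formulation; the first component carries the velocity divided by
`theta ν`, the second one the magnetic field. -/
def mild (ν η : ℝ) : Fin 2 ⊕ Fin 2 → Fin 2 ⊕ Fin 2 → Fin 2 ⊕ Fin 2 → Freq → TF →L[ℂ] TF
  | .inl i, .inl l, .inl j, k => (-mu i l j k) • (ContinuousLinearMap.mul ℂ TF (thetaInv ν)) ∘L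
      (duh (ν * lam k)) ∘L (ContinuousLinearMap.mul ℂ TF (theta ν * theta ν))
  | .inl i, .inr l, .inr j, k => mu i l j k • (ContinuousLinearMap.mul ℂ TF (thetaInv ν)) ∘L
      (duh (ν * lam k))
  | .inr i, .inr j, .inl l, k => ((if l = i then dsym j k else 0) - if j = i then dsym l k else 0) •
      (duh (η * lam k)) ∘L (ContinuousLinearMap.mul ℂ TF (theta ν))
  | _, _, _, _ => 0

lemma mild_inl_inl_inl (ν η : ℝ) (i l j : Fin 2) (k : Freq) (F : TF) :
    mild ν η (.inl i) (.inl l) (.inl j) k F =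
      -(mu i l j k • (thetaInv ν * duh (ν * lam k) (theta ν * theta ν * F))) := by
  simp [mild]

lemma mild_inl_inr_inr (ν η : ℝ) (i l j : Fin 2) (k : Freq) (F : TF) :
    mild ν η (.inl i) (.inr l) (.inr j) k F = mu i l j k • (thetaInv ν * duh (ν * lam k) F) := by
  simp [mild]

lemma mild_inr_inr_inl (ν η : ℝ) (i j l : Fin 2) (k : Freq) (F : TF) :
    mild ν η (.inr i) (.inr j) (.inl l) k F =
      ((if l = i then dsym j k else 0) - if j = i then dsym l k else 0) •
        duh (η * lam k) (theta ν * F) := by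
  simp [mild]

lemma star_mild (ν η : ℝ) (c a a' : Fin 2 ⊕ Fin 2) (k : Freq) (F : TF) :
    mild ν η c a a' (-k) (star F) = star (mild ν η c a a' k F) := by
  have hm : ∀ F : TF, theta ν * star F = star (theta ν * F) := fun F => by
    rw [star_mul', star_theta]
  have hm2 : ∀ F : TF, theta ν * theta ν * star F = star (theta ν * theta ν * F) := fun F => by
    simp only [star_mul', star_theta]
  have hi : ∀ F : TF, thetaInv ν * star F = star (thetaInv ν * F) := fun F => by
    rw [star_mul', star_thetaInv]
  have hd : ∀ (l j i : Fin 2), ((if l = i then dsym j (-k) else 0) - if j = i then dsym l (-k) else 0)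
      = star ((if l = i then dsym j k else 0) - if j = i then dsym l k else 0) := fun l j i => by
    rw [star_sub]
    split_ifs <;> simp [dsym_neg]
  have hz : (0 : TF) = star 0 := star_zero _ |>.symm
  rcases c with i | i <;> rcases a with l | l <;> rcases a' with j | j
  · simp only [mild_inl_inl_inl, star_neg, star_smul, lam_neg, mu_neg, hm2, star_duh, hi]
  · exact hz
  · exact hz
  · simp only [mild_inl_inr_inr, star_smul, lam_neg, mu_neg, star_duh, hi]
  · exact hz
  · exact hz
  · simp only [mild_inr_inr_inl, star_smul, lam_neg, hd, hm, star_duh]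
  · exact hz

/-- The constant in the bilinear estimate. -/
def mildConst (η : ℝ) : ℝ := 8 + 2 * (1 / √η + 1 / η)

lemma mildConst_pos {η : ℝ} (hη : 0 < η) : 0 < mildConst η := by
  unfold mildConst; positivity

lemma norm_mu_smul_duh_le {ν : ℝ} (hν : 1 ≤ ν) (i l j : Fin 2) {k : Freq} (hk : k ≠ 0) (G : TF) :
    ‖mu i l j k • (thetaInv ν * duh (ν * lam k) G)‖ ≤ 2 / √ν * ‖G‖ := by
  have hν0 : 0 < ν := by linarith
  have hsν : 0 < √ν := by positivity
  have hl := lam_pos hk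
  have hs1 : 1 ≤ √(lam k) := Real.one_le_sqrt.2 (one_le_lam hk)
  have h1 : 0 ≤ ‖G‖ / √ν := by positivity
  rw [norm_smul]
  calc ‖mu i l j k‖ * ‖thetaInv ν * duh (ν * lam k) G‖
      ≤ (2 * √(lam k)) * (√ν * (‖G‖ / (ν * lam k))) := by
        gcongr
        · exact norm_mu_le_sqrt i l j k
        · refine (norm_mul_le _ _).trans ?_
          gcongr
          · exact norm_thetaInv_le hν
          · exact norm_duh_le (by positivity) G
    _ = 2 * (‖G‖ * (√ν / ν) * (√(lam k) / lam k)) := by ring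
    _ = 2 * (‖G‖ / √ν * (1 / √(lam k))) := by
        rw [Real.sqrt_div_self, Real.sqrt_div_self]; ring
    _ ≤ 2 * (‖G‖ / √ν * 1) := by
        gcongr
        rw [div_le_one (by positivity)]
        exact hs1
    _ = _ := by ring

lemma norm_dsym_smul_duh_le {ν η : ℝ} (hν : 1 ≤ ν) (hη : 0 < η) (i j l : Fin 2) {k : Freq}
    (hk : k ≠ 0) (F : TF) :
    ‖((if l = i then dsym j k else 0) - if j = i then dsym l k else 0) •
        duh (η * lam k) (theta ν * F)‖ ≤ 2 * (1 / √η + 1 / η) / √ν * ‖F‖ := by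
  have hν0 : 0 < ν := by linarith
  have hsν : 0 < √ν := by positivity
  have hl := lam_pos hk
  have hs1 : 1 ≤ √(lam k) := Real.one_le_sqrt.2 (one_le_lam hk)
  have hi : ∀ (p : Prop) [Decidable p] (j : Fin 2), ‖if p then dsym j k else 0‖ ≤ √(lam k) := by
    intro p _ j
    split_ifs
    · exact norm_dsym_le_sqrt j k
    · simp
  rw [norm_smul]
  calc _ ≤ (√(lam k) + √(lam k)) * ((1 / √(η * lam k * ν) + 1 / (η * lam k * √ν)) * ‖F‖) := by
        gcongr
        · exact (norm_sub_le _ _).trans (add_le_add (hi _ _) (hi _ _))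
        · exact norm_duh_theta_le hν (by positivity) F
    _ = 2 * (1 / √η * (√(lam k) / √(lam k)) + 1 / η * (√(lam k) / lam k)) / √ν * ‖F‖ := by
        rw [Real.sqrt_mul (by positivity), Real.sqrt_mul hη.le]
        ring
    _ = 2 * (1 / √η + 1 / η * (1 / √(lam k))) / √ν * ‖F‖ := by
        rw [Real.sqrt_div_self, div_self (by positivity), mul_one, one_div (√(lam k))]
    _ ≤ 2 * (1 / √η + 1 / η * 1) / √ν * ‖F‖ := by
        gcongr
        rw [div_le_one (by positivity)]
        exact hs1
    _ = _ := by ring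

lemma norm_mild_le {ν η : ℝ} (hν : 1 ≤ ν) (hη : 0 < η) (c a a' : Fin 2 ⊕ Fin 2) (k : Freq)
    (F : TF) : ‖mild ν η c a a' k F‖ ≤ mildConst η / √ν * ‖F‖ := by
  have hν0 : 0 < ν := by linarith
  have hsν : 0 < √ν := by positivity
  have hC := mildConst_pos hη
  have hC8 : 8 ≤ mildConst η := by
    unfold mildConst
    have : 0 ≤ 2 * (1 / √η + 1 / η) := by positivity
    linarith
  have hCη : 2 * (1 / √η + 1 / η) ≤ mildConst η := by
    unfold mildConst; linarith
  have h0 : ‖(0 : TF)‖ ≤ mildConst η / √ν * ‖F‖ := by rw [norm_zero]; positivity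
  by_cases hk : k = 0
  · have : mild ν η c a a' k F = 0 := by
      subst hk
      rcases c with i | i <;> rcases a with l | l <;> rcases a' with j | j <;>
        simp [mild, lam_zero, duh_zero]
    rwa [this]
  rcases c with i | i <;> rcases a with l | l <;> rcases a' with j | j
  · rw [mild_inl_inl_inl, norm_neg]
    refine (norm_mu_smul_duh_le hν i l j hk _).trans ?_
    have h2 := norm_theta_le hν
    calc 2 / √ν * ‖theta ν * theta ν * F‖ ≤ 2 / √ν * (2 * 2 * ‖F‖) := by
          gcongr
          refine (norm_mul_le _ _).trans ?_
          gcongr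
          refine (norm_mul_le _ _).trans ?_
          gcongr
      _ = 8 / √ν * ‖F‖ := by ring
      _ ≤ _ := by gcongr
  · exact h0
  · exact h0
  · rw [mild_inl_inr_inr]
    refine (norm_mu_smul_duh_le hν i l j hk _).trans ?_
    gcongr
    linarith
  · exact h0
  · exact h0
  · rw [mild_inr_inr_inl]
    refine (norm_dsym_smul_duh_le hν hη i l j hk F).trans ?_
    gcongr
  · exact h0

end System

section Nonlinearity

/-- The projected divergence of `b ⊗ b - u ⊗ u`. -/
def forceU (u b : Fin 2 → Freq → TF) (i : Fin 2) : Freq → TF :=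
  ∑ l, ∑ j, sym (mu i l j) (conv (b l) (b j) - conv (u l) (u j))

/-- The divergence of `b ⊗ u - u ⊗ b`. -/
def forceB (u b : Fin 2 → Freq → TF) (i : Fin 2) : Freq → TF :=
  ∑ j, sym (dsym j) (conv (b j) (u i) - conv (u j) (b i))

lemma forceU_apply (u b : Fin 2 → Freq → TF) (i : Fin 2) (k : Freq) :
    forceU u b i k = ∑ l, ∑ j, mu i l j k • (conv (b l) (b j) k - conv (u l) (u j) k) := by
  simp [forceU, sym]

lemma forceB_apply (u b : Fin 2 → Freq → TF) (i : Fin 2) (k : Freq) :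
    forceB u b i k = ∑ j, dsym j k • (conv (b j) (u i) k - conv (u j) (b i) k) := by
  simp [forceB, sym]

lemma conv_mul_left (F : TF) {f g : Freq → TF} (hf : WSum 0 f) (hg : WSum 0 g) (k : Freq) :
    conv (fun j => F * f j) g k = F * conv f g k := by
  simp only [conv, mul_assoc]
  exact (summable_conv hf hg k).tsum_mul_left F

lemma WSum.mul_left {s : ℕ} {f : Freq → TF} (F : TF) (hf : WSum s f) :
    WSum s (fun k => F * f k) :=
  hf.of_le ‖F‖ fun k => by
    have := wt_pos k
    calc wt k ^ s * ‖F * f k‖ ≤ wt k ^ s * (‖F‖ * ‖f k‖) := by gcongr; exact norm_mul_le _ _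
      _ = _ := by ring

end Nonlinearity

section Mild

/-- The mild formulation of the MHD system in Fourier variables. -/
structure IsMild (ν η : ℝ) (a b₀ : Fin 2 → Freq → ℂ) (u b : Fin 2 → Freq → TF) : Prop where
  wsum_u : ∀ i, WSum 1 (u i)
  wsum_b : ∀ i, WSum 1 (b i)
  herm_u : ∀ i, Herm (u i)
  herm_b : ∀ i, Herm (b i)
  eq_u : ∀ i k, u i k = a i k • heat (ν * lam k) + duh (ν * lam k) (forceU u b i k)
  eq_b : ∀ i k, b i k = b₀ i k • heat (η * lam k) + duh (η * lam k) (forceB u b i k)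

theorem exists_isMild {ν η ρ : ℝ} (hν : 1 ≤ ν) (hη : 0 < η) (a b₀ : Fin 2 → Freq → ℂ)
    (ha0 : ∀ i, a i 0 = 0) (hah : ∀ i k, a i (-k) = star (a i k))
    (hbh : ∀ i k, b₀ i (-k) = star (b₀ i k)) (has : ∀ i, Summable fun k => wt k * ‖a i k‖)
    (hbs : ∀ i, Summable fun k => wt k * ‖b₀ i k‖)
    (hρ : ∑ i, ∑' k, wt k * ‖a i k‖ + ∑ i, ∑' k, wt k * ‖b₀ i k‖ ≤ ρ)
    (hsmall : 32 * mildConst η * ρ ≤ √ν) :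
    ∃ u b : Fin 2 → Freq → TF, IsMild ν η a b₀ u b ∧
      ∀ i, ∑' k, wt k * ‖b i k - b₀ i k • heat (η * lam k)‖ ≤ 16 * mildConst η * ρ ^ 2 / √ν := by
  have hν0 : 0 < ν := by linarith
  have hsν : 0 < √ν := by positivity
  have hC := mildConst_pos hη
  set x : Fin 2 ⊕ Fin 2 → Freq → TF := Sum.elim
    (fun i k => a i k • (thetaInv ν * heat (ν * lam k))) (fun i k => b₀ i k • heat (η * lam k))
    with hx
  have hxa : ∀ i k, ‖x (.inl i) k‖ ≤ ‖a i k‖ := fun i k => by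
    simp only [hx, Sum.elim_inl, norm_smul]
    by_cases hk : k = 0
    · simp [hk, ha0]
    · refine mul_le_of_le_one_right (norm_nonneg _) (norm_thetaInv_mul_heat_le hν0.le ?_)
      exact le_mul_of_one_le_right hν0.le (one_le_lam hk)
  have hxb : ∀ i k, ‖x (.inr i) k‖ ≤ ‖b₀ i k‖ := fun i k => by
    simp only [hx, Sum.elim_inr, norm_smul]
    exact mul_le_of_le_one_right (norm_nonneg _) (norm_heat_le _)
  have hle : ∀ {c : Freq → ℂ} {f : Freq → TF}, (∀ k, ‖f k‖ ≤ ‖c k‖) →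
      (Summable fun k => wt k * ‖c k‖) → (Summable fun k => wt k * ‖f k‖) := fun h hs =>
    Summable.of_nonneg_of_le (fun k => by have := wt_pos k; positivity)
      (fun k => by have := wt_pos k; have := h k; gcongr) hs
  have htle : ∀ {c : Freq → ℂ} {f : Freq → TF}, (∀ k, ‖f k‖ ≤ ‖c k‖) →
      (Summable fun k => wt k * ‖c k‖) → ∑' k, wt k * ‖f k‖ ≤ ∑' k, wt k * ‖c k‖ := fun h hs =>
    (hle h hs).tsum_le_tsum (fun k => by have := wt_pos k; have := h k; gcongr) hs
  obtain ⟨f, hf1, hfh, hf, hfx⟩ := exists_mild (T := mild ν η) (ε := mildConst η / √ν)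
    (by positivity) (norm_mild_le hν hη) (star_mild ν η) x
    (by
      rintro (i | i)
      · simpa [WSum] using hle (hxa i) (has i)
      · simpa [WSum] using hle (hxb i) (hbs i))
    (by
      rintro (i | i) k
      · simp only [hx, Sum.elim_inl, hah, lam_neg, star_smul, star_mul', star_thetaInv, star_heat]
      · simp only [hx, Sum.elim_inr, hbh, lam_neg, star_smul, star_heat])
    (ρ := ρ)
    (by
      rw [Fintype.sum_sum_type]
      exact (add_le_add (Finset.sum_le_sum fun i _ => htle (hxa i) (has i))
        (Finset.sum_le_sum fun i _ => htle (hxb i) (hbs i))).trans hρ)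
    (by
      simp only [Fintype.card_sum, Fintype.card_fin]
      rw [show (8 : ℝ) * (((2 + 2 : ℕ) : ℝ) * (mildConst η / √ν)) * ρ =
        32 * mildConst η * ρ / √ν by push_cast; ring]
      exact div_le_one_of_le₀ hsmall hsν.le)
  have h0 : ∀ c, WSum 0 (f c) := fun c => (hf1 c).zero
  have hθ : ∀ G : TF, theta ν * (thetaInv ν * G) = G := fun G => by
    rw [← mul_assoc, mul_comm (theta ν), thetaInv_mul_theta, one_mul]
  refine ⟨fun i k => theta ν * f (.inl i) k, fun i => f (.inr i),
    ⟨fun i => (hf1 _).mul_left _, fun i => hf1 _, fun i k => ?_, fun i => hfh _, fun i k => ?_,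
      fun i k => ?_⟩, fun i => ?_⟩
  · rw [hfh (.inl i) k, star_mul', star_theta]
  · have hc : ∀ l j, conv (fun k => theta ν * f (.inl l) k) (fun k => theta ν * f (.inl j) k) k =
        theta ν * theta ν * conv (f (.inl l)) (f (.inl j)) k := fun l j => by
      rw [conv_mul_left _ (h0 _) ((h0 _).mul_left _), conv_comm,
        conv_mul_left _ (h0 _) (h0 _), conv_comm, mul_assoc]
    have h1 := hf (.inl i) k
    simp only [Fintype.sum_sum_type, mild_inl_inl_inl, mild_inl_inr_inr] at h1
    have z1 : ∀ l j, mild ν η (.inl i) (.inl l) (.inr j) k = 0 := fun _ _ => rfl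
    have z2 : ∀ l j, mild ν η (.inl i) (.inr l) (.inl j) k = 0 := fun _ _ => rfl
    simp only [z1, z2, zero_apply, Finset.sum_const_zero, add_zero, zero_add] at h1
    simp only [forceU_apply, hc, map_sum, map_smul, map_sub]
    rw [h1, hx, Sum.elim_inl]
    simp only [mul_add, Finset.mul_sum, mul_smul_comm, mul_neg, hθ]
    simp only [Fin.sum_univ_two, smul_sub]
    abel
  · have hc : ∀ l j, conv (f (.inr j)) (fun k => theta ν * f (.inl l) k) k =
        theta ν * conv (f (.inr j)) (f (.inl l)) k := fun l j => by
      rw [conv_comm, conv_mul_left _ (h0 _) (h0 _), conv_comm]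
    have hc' : ∀ l j, conv (fun k => theta ν * f (.inl l) k) (f (.inr j)) k =
        theta ν * conv (f (.inr j)) (f (.inl l)) k := fun l j => by
      rw [conv_comm, hc]
    have h1 := hf (.inr i) k
    simp only [Fintype.sum_sum_type, mild_inr_inr_inl] at h1
    have z1 : ∀ l j, mild ν η (.inr i) (.inl l) (.inl j) k = 0 := fun _ _ => rfl
    have z2 : ∀ l j, mild ν η (.inr i) (.inl l) (.inr j) k = 0 := fun _ _ => rfl
    have z3 : ∀ l j, mild ν η (.inr i) (.inr l) (.inr j) k = 0 := fun _ _ => rfl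
    simp only [z1, z2, z3, zero_apply, Finset.sum_const_zero, add_zero, zero_add] at h1
    simp only [forceB_apply, hc, hc', map_sum, map_smul, map_sub]
    rw [h1, hx, Sum.elim_inr]
    congr 1
    fin_cases i <;> simp [Fin.sum_univ_two, smul_sub, sub_smul]
  · refine (hfx (.inr i)).trans (le_of_eq ?_)
    simp only [Fintype.card_sum, Fintype.card_fin]
    push_cast
    ring

end Mild

section Bootstrap

lemma WSum.of_dsym_le {s : ℕ} {c : Freq → ℂ} {f : Freq → TF} {C : ℝ} (hc : ∀ k, ‖c k‖ ≤ C * wt k)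
    (hf : WSum (s + 1) f) : WSum s (sym c f) :=
  hf.of_le C fun k => by
    have := wt_pos k
    rw [sym, norm_smul]
    calc wt k ^ s * (‖c k‖ * ‖f k‖) ≤ wt k ^ s * ((C * wt k) * ‖f k‖) := by
          gcongr
          exact hc k
      _ = _ := by ring

lemma norm_dsym_le_wt (i : Fin 2) (k : Freq) : ‖dsym i k‖ ≤ 2 * π * wt k := by
  rw [norm_dsym]
  gcongr
  exact abs_le_wt k i

lemma norm_mu_le_wt (i l j : Fin 2) (k : Freq) : ‖mu i l j k‖ ≤ 4 * π * wt k := by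
  refine (norm_mu_le i l j k).trans ?_
  linarith [norm_dsym_le_wt j k]

lemma WSum.sub {s : ℕ} {f g : Freq → TF} (hf : WSum s f) (hg : WSum s g) : WSum s (f - g) := by
  refine Summable.of_nonneg_of_le (fun k => ?_) (fun k => ?_) (Summable.add hf hg)
  · have := wt_pos k
    positivity
  · have := wt_pos k
    rw [← mul_add]
    gcongr
    exact norm_sub_le _ _

lemma WSum.forceU {s : ℕ} {u b : Fin 2 → Freq → TF} (hu : ∀ i, WSum (s + 1) (u i))
    (hb : ∀ i, WSum (s + 1) (b i)) (i : Fin 2) : WSum s (forceU u b i) := by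
  have h : ∀ l j, WSum s (sym (mu i l j) (MHD.conv (b l) (b j) - MHD.conv (u l) (u j))) :=
    fun l j => WSum.of_dsym_le (norm_mu_le_wt i l j)
      (((hb l).conv (hb j)).sub ((hu l).conv (hu j)))
  simp only [MHD.forceU, Fin.sum_univ_two]
  exact ((h _ _).add (h _ _)).add ((h _ _).add (h _ _))

lemma WSum.forceB {s : ℕ} {u b : Fin 2 → Freq → TF} (hu : ∀ i, WSum (s + 1) (u i))
    (hb : ∀ i, WSum (s + 1) (b i)) (i : Fin 2) : WSum s (forceB u b i) := by
  have h : ∀ j, WSum s (sym (dsym j) (MHD.conv (b j) (u i) - MHD.conv (u j) (b i))) :=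
    fun j => WSum.of_dsym_le (norm_dsym_le_wt j)
      (((hb j).conv (hu i)).sub ((hu j).conv (hb i)))
  simp only [MHD.forceB, Fin.sum_univ_two]
  exact (h _).add (h _)

lemma WSum.duh {s : ℕ} {κ : ℝ} (hκ : 0 < κ) {f : Freq → TF} (hf : WSum s f) :
    WSum (s + 2) (fun k => duh (κ * lam k) (f k)) :=
  hf.of_le (1 / κ) fun k => by
    have hw := wt_pos k
    by_cases hk : k = 0
    · simp only [hk, lam_zero, mul_zero, duh_zero, zero_apply, norm_zero]
      have := wt_pos 0
      positivity
    · have hl := lam_pos hk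
      have hwl := wt_sq_le_lam hk
      calc wt k ^ (s + 2) * ‖MHD.duh (κ * lam k) (f k)‖
          ≤ wt k ^ (s + 2) * (‖f k‖ / (κ * lam k)) := by
            gcongr
            exact norm_duh_le (by positivity) _
        _ = 1 / κ * (wt k ^ s * ‖f k‖) * (wt k ^ 2 / lam k) := by
            rw [pow_add]
            field_simp
        _ ≤ 1 / κ * (wt k ^ s * ‖f k‖) * 1 := by
            gcongr
            exact div_le_one_of_le₀ hwl hl.le
        _ = _ := mul_one _

/-- Rapid decay of scalar coefficients. -/
def RapidC (a : Freq → ℂ) : Prop := ∀ s : ℕ, Summable fun k => wt k ^ s * ‖a k‖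

lemma RapidC.heat {a : Freq → ℂ} (ha : RapidC a) (l : Freq → ℝ) :
    Rapid fun k => a k • heat (l k) := fun s => by
  refine Summable.of_nonneg_of_le (fun k => ?_) (fun k => ?_) (ha s)
  · have := wt_pos k
    positivity
  · have := wt_pos k
    rw [norm_smul]
    gcongr
    exact mul_le_of_le_one_right (norm_nonneg _) (norm_heat_le _)

variable {ν η : ℝ} {a b₀ : Fin 2 → Freq → ℂ} {u b : Fin 2 → Freq → TF}

lemma IsMild.wsum (h : IsMild ν η a b₀ u b) (hν : 0 < ν) (hη : 0 < η) (ha : ∀ i, RapidC (a i))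
    (hb : ∀ i, RapidC (b₀ i)) (s : ℕ) :
    (∀ i, WSum (s + 1) (u i)) ∧ ∀ i, WSum (s + 1) (b i) := by
  induction s with
  | zero => exact ⟨h.wsum_u, h.wsum_b⟩
  | succ s ih =>
    constructor
    · intro i
      rw [funext (h.eq_u i)]
      exact ((ha i).heat _ _).add ((WSum.forceU ih.1 ih.2 i).duh hν)
    · intro i
      rw [funext (h.eq_b i)]
      exact ((hb i).heat _ _).add ((WSum.forceB ih.1 ih.2 i).duh hη)

lemma Sm.neg {n : ℕ} {f : Freq → TF} (hf : Sm n f) : Sm n (-f) := by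
  have : -f = MHD.sym (fun _ => -1) f := by
    funext k
    simp [MHD.sym]
  rw [this]
  exact hf.sym ⟨1, 0, zero_le_one, fun k => by simp⟩

lemma Sm.sub {n : ℕ} {f g : Freq → TF} (hf : Sm n f) (hg : Sm n g) : Sm n (f - g) := by
  rw [sub_eq_add_neg]
  exact hf.add hg.neg

lemma Sm.forceU {n : ℕ} (hu : ∀ i, Sm n (u i)) (hb : ∀ i, Sm n (b i)) (i : Fin 2) :
    Sm n (forceU u b i) := by
  have h : ∀ l j, Sm n (MHD.sym (mu i l j) (MHD.conv (b l) (b j) - MHD.conv (u l) (u j))) :=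
    fun l j => Sm.sym (polyBdd_mu i l j) (((hb l).conv (hb j)).sub ((hu l).conv (hu j)))
  simp only [MHD.forceU, Fin.sum_univ_two]
  exact ((h _ _).add (h _ _)).add ((h _ _).add (h _ _))

lemma Sm.forceB {n : ℕ} (hu : ∀ i, Sm n (u i)) (hb : ∀ i, Sm n (b i)) (i : Fin 2) :
    Sm n (forceB u b i) := by
  have h : ∀ j, Sm n (MHD.sym (dsym j) (MHD.conv (b j) (u i) - MHD.conv (u j) (b i))) :=
    fun j => Sm.sym (polyBdd_dsym j) (((hb j).conv (hu i)).sub ((hu j).conv (hb i)))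
  simp only [MHD.forceB, Fin.sum_univ_two]
  exact (h _).add (h _)

/-- The symbol of `κ Δ`. -/
def lap (κ : ℝ) : Freq → ℂ := fun k => -(κ * lam k : ℝ)

lemma polyBdd_lap (κ : ℝ) : PolyBdd (lap κ) :=
  polyBdd_lam.of_norm_le |κ| (abs_nonneg κ) fun k => by
    simp [lap]

lemma td_heat_add_duh {κ : ℝ} (hκ : 0 < κ) {c : ℂ} {k : Freq} {F : TF} (hF : k = 0 → F = 0) :
    TD (c • heat (κ * lam k) + duh (κ * lam k) F)
      (lap κ k • (c • heat (κ * lam k) + duh (κ * lam k) F) + F) := by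
  have h1 := (td_heat (mul_nonneg hκ.le (lam_nonneg k))).smul c
  by_cases hk : k = 0
  · subst hk
    simpa [hF, lam_zero, lap] using h1
  · have h2 := td_duh (mul_pos hκ (lam_pos hk)) F
    convert h1.add h2 using 1
    simp only [lap, smul_add, Complex.ofReal_neg, Complex.ofReal_mul, smul_comm c]
    rw [add_assoc]

lemma forceU_zero (u b : Fin 2 → Freq → TF) (i : Fin 2) : forceU u b i 0 = 0 := by
  simp [forceU_apply, mu_zero]

lemma forceB_zero (u b : Fin 2 → Freq → TF) (i : Fin 2) : forceB u b i 0 = 0 := by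
  simp [forceB_apply, dsym_zero]

lemma IsMild.td_u (h : IsMild ν η a b₀ u b) (hν : 0 < ν) (i : Fin 2) (k : Freq) :
    TD (u i k) ((MHD.sym (lap ν) (u i) + forceU u b i) k) := by
  have := td_heat_add_duh hν (c := a i k) (k := k) (F := forceU u b i k)
    (by rintro rfl; exact forceU_zero u b i)
  rwa [← h.eq_u] at this

lemma IsMild.td_b (h : IsMild ν η a b₀ u b) (hη : 0 < η) (i : Fin 2) (k : Freq) :
    TD (b i k) ((MHD.sym (lap η) (b i) + forceB u b i) k) := by
  have := td_heat_add_duh hη (c := b₀ i k) (k := k) (F := forceB u b i k)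
    (by rintro rfl; exact forceB_zero u b i)
  rwa [← h.eq_b] at this

lemma IsMild.sm (h : IsMild ν η a b₀ u b) (hν : 0 < ν) (hη : 0 < η) (ha : ∀ i, RapidC (a i))
    (hb : ∀ i, RapidC (b₀ i)) (n : ℕ) : (∀ i, Sm n (u i)) ∧ ∀ i, Sm n (b i) := by
  have hru : ∀ i, Rapid (u i) := fun i s => by
    refine ((h.wsum hν hη ha hb s).1 i).of_le 1 fun k => ?_
    rw [one_mul]
    gcongr
    exacts [one_le_wt k, Nat.le_succ s]
  have hrb : ∀ i, Rapid (b i) := fun i s => by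
    refine ((h.wsum hν hη ha hb s).2 i).of_le 1 fun k => ?_
    rw [one_mul]
    gcongr
    exacts [one_le_wt k, Nat.le_succ s]
  induction n with
  | zero => exact ⟨hru, hrb⟩
  | succ n ih =>
    exact ⟨fun i => ⟨hru i, _, ((ih.1 i).sym (polyBdd_lap ν)).add (Sm.forceU ih.1 ih.2 i),
        h.td_u hν i⟩,
      fun i => ⟨hrb i, _, ((ih.2 i).sym (polyBdd_lap η)).add (Sm.forceB ih.1 ih.2 i),
        h.td_b hη i⟩⟩

end Bootstrap

section Structure

variable {ν η : ℝ} {a b₀ : Fin 2 → Freq → ℂ} {u b : Fin 2 → Freq → TF}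

lemma sum_dsym_forceU (u b : Fin 2 → Freq → TF) (k : Freq) :
    ∑ i, dsym i k • forceU u b i k = 0 := by
  have h : ∑ i, dsym i k • forceU u b i k = ∑ l, ∑ j, (∑ i, dsym i k * mu i l j k) •
      (conv (b l) (b j) k - conv (u l) (u j) k) := by
    simp only [forceU_apply, Fin.sum_univ_two, smul_add, smul_smul, add_smul]
    abel
  rw [h]
  simp only [sum_dsym_mu, zero_smul, Finset.sum_const_zero]

lemma sum_dsym_forceB (u b : Fin 2 → Freq → TF) (k : Freq) :
    ∑ i, dsym i k • forceB u b i k = 0 := by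
  simp only [forceB_apply, Fin.sum_univ_two, smul_add, smul_smul]
  rw [conv_comm (u 0) (b 0), conv_comm (u 0) (b 1), conv_comm (u 1) (b 0), conv_comm (u 1) (b 1),
    sub_self, sub_self]
  module

lemma duh_div_free {κ : ℝ} {k : Freq} {c : Fin 2 → ℂ} {F v : Fin 2 → TF}
    (hv : ∀ i, v i = c i • heat (κ * lam k) + duh (κ * lam k) (F i))
    (hc : ∑ i, dsym i k * c i = 0) (hF : ∑ i, dsym i k • F i = 0) : ∑ i, dsym i k • v i = 0 := by
  have : ∑ i, dsym i k • v i =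
      (∑ i, dsym i k * c i) • heat (κ * lam k) + duh (κ * lam k) (∑ i, dsym i k • F i) := by
    simp only [hv, Fin.sum_univ_two, smul_add, add_smul, smul_smul, map_add, map_smul]
    abel
  rw [this, hc, hF]
  simp

lemma IsMild.div_u (h : IsMild ν η a b₀ u b) (ha : ∀ k, ∑ i, dsym i k * a i k = 0) :
    ∑ i, sym (dsym i) (u i) = 0 := by
  funext k
  simpa [sym] using duh_div_free (fun i => h.eq_u i k) (ha k) (sum_dsym_forceU u b k)

lemma IsMild.div_b (h : IsMild ν η a b₀ u b) (hb : ∀ k, ∑ i, dsym i k * b₀ i k = 0) :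
    ∑ i, sym (dsym i) (b i) = 0 := by
  funext k
  simpa [sym] using duh_div_free (fun i => h.eq_b i k) (hb k) (sum_dsym_forceB u b k)

lemma IsMild.u_zero (h : IsMild ν η a b₀ u b) (ha : ∀ i, a i 0 = 0) (i : Fin 2) : u i 0 = 0 := by
  rw [h.eq_u, forceU_zero, ha]
  simp

lemma IsMild.b_zero (h : IsMild ν η a b₀ u b) (hb : ∀ i, b₀ i 0 = 0) (i : Fin 2) : b i 0 = 0 := by
  rw [h.eq_b, forceB_zero, hb]
  simp

/-- The symbol of the pressure. -/
def psym (l j : Fin 2) : Freq → ℂ := fun k => -(dsym l k * dsym j k / lam k)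

lemma polyBdd_psym (l j : Fin 2) : PolyBdd (psym l j) := by
  refine ⟨1, 0, zero_le_one, fun k => ?_⟩
  rw [psym, norm_neg, norm_div, norm_mul, Complex.norm_real, Real.norm_of_nonneg (lam_nonneg k),
    pow_zero, mul_one]
  refine div_le_one_of_le₀ ?_ (lam_nonneg k)
  calc ‖dsym l k‖ * ‖dsym j k‖ ≤ √(lam k) * √(lam k) := by
        gcongr <;> exact norm_dsym_le_sqrt _ _
    _ = _ := Real.mul_self_sqrt (lam_nonneg k)

/-- The Fourier coefficients of the pressure. -/
def pressure (u b : Fin 2 → Freq → TF) : Freq → TF :=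
  ∑ l, ∑ j, sym (psym l j) (conv (b l) (b j) - conv (u l) (u j))

lemma Sm.pressure {n : ℕ} (hu : ∀ i, Sm n (u i)) (hb : ∀ i, Sm n (b i)) :
    Sm n (pressure u b) := by
  have h : ∀ l j, Sm n (MHD.sym (psym l j) (MHD.conv (b l) (b j) - MHD.conv (u l) (u j))) :=
    fun l j => Sm.sym (polyBdd_psym l j) (((hb l).conv (hb j)).sub ((hu l).conv (hu j)))
  simp only [MHD.pressure, Fin.sum_univ_two]
  exact ((h _ _).add (h _ _)).add ((h _ _).add (h _ _))

lemma forceU_add_pressure (u b : Fin 2 → Freq → TF) (i : Fin 2) :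
    forceU u b i + sym (dsym i) (pressure u b) =
      ∑ j, (sym (dsym j) (conv (b j) (b i)) - sym (dsym j) (conv (u j) (u i))) := by
  funext k
  simp only [Pi.add_apply, forceU_apply, pressure, Finset.sum_apply, sym, Pi.sub_apply, mu, psym]
  have hb := conv_comm (b 1) (b 0)
  have hu := conv_comm (u 1) (u 0)
  fin_cases i <;> simp [Fin.sum_univ_two, hb, hu] <;> module

lemma sum_dsym_conv {v : Freq → TF} {u : Fin 2 → Freq → TF} (hu : ∀ i, Rapid (u i))
    (hv : Rapid v) (hdiv : ∑ i, sym (dsym i) (u i) = 0) :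
    ∑ j, sym (dsym j) (conv (u j) v) = ∑ j, conv (u j) (sym (dsym j) v) := by
  have h0 : conv (∑ i, sym (dsym i) (u i)) v = 0 := by rw [hdiv, conv_comm, conv_zero]
  have hs : ∀ i, WSum 0 (sym (dsym i) (u i)) := fun i => (hu i).sym (polyBdd_dsym i) 0
  rw [Fin.sum_univ_two, conv_comm, conv_add (hv 0) (hs 0) (hs 1), conv_comm v, conv_comm v] at h0
  simp only [sym_dsym_conv _ (hu _) hv, Fin.sum_univ_two]
  rw [add_add_add_comm, h0, zero_add]

end Structure

section Solution

variable {ν η : ℝ} {a b₀ : Fin 2 → Freq → ℂ} {u b : Fin 2 → Freq → TF} {f g : Freq → TF}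

/-- The real vector field with given Fourier coefficients. -/
def field (u : Fin 2 → Freq → TF) (t : ℝ) (x : Fin 2 → ℝ) (i : Fin 2) : ℝ := (Ser (u i) t x).re

lemma re_ser_add (hf : Rapid f) (hg : Rapid g) (t : ℝ) (x : Fin 2 → ℝ) :
    (Ser (f + g) t x).re = (Ser f t x).re + (Ser g t x).re := by
  rw [ser_add (hf 0) (hg 0), Complex.add_re]

lemma re_ser_conv (hf : Rapid f) (hg : Rapid g) (hfh : Herm f) (hgh : Herm g) (t : ℝ)
    (x : Fin 2 → ℝ) :
    (Ser (conv f g) t x).re = (Ser f t x).re * (Ser g t x).re := by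
  rw [ser_conv (hf 0) (hg 0), Complex.mul_re, ser_im hfh, ser_im hgh, mul_zero, sub_zero]

lemma ser_zero (t : ℝ) (x : Fin 2 → ℝ) : Ser 0 t x = 0 := by simp [Ser]

lemma contDiffOn_re_ser (hf : ∀ n, Sm n f) :
    ContDiffOn ℝ (⊤ : ℕ∞) (fun p : ℝ × (Fin 2 → ℝ) => (Ser f p.1 p.2).re) (Ici 0 ×ˢ univ) :=
  Complex.reCLM.contDiff.comp_contDiffOn (contDiffOn_ser_infty hf)

lemma prdc_re_ser (f : Freq → TF) (t : ℝ) : Prdc 1 fun x => (Ser f t x).re := fun x i => by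
  simp only [prdc_ser f t x i]

lemma divg_field (hu : ∀ i, Rapid (u i)) (hdiv : ∑ i, sym (dsym i) (u i) = 0) (t : ℝ)
    (x : Fin 2 → ℝ) : divg (field u t) x = 0 := by
  have hs : ∀ i, Rapid (sym (dsym i) (u i)) := fun i => (hu i).sym (polyBdd_dsym i)
  have := re_ser_add (hs 0) (hs 1) t x
  rw [← Fin.sum_univ_two (fun i => sym (dsym i) (u i)), hdiv, ser_zero] at this
  simp only [divg, field, pd_re_ser (hu _), Fin.sum_univ_two]
  simpa using this.symm

lemma re_ser_lap (hf : Rapid f) (κ t : ℝ) (x : Fin 2 → ℝ) :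
    (Ser (sym (lap κ) f) t x).re =
      κ * ∑ j, pd j (pd j fun y => (Ser f t y).re) x := by
  have hs : ∀ {f : Freq → TF} i, Rapid f → Rapid (sym (dsym i) f) :=
    fun i hf => hf.sym (polyBdd_dsym i)
  have h1 : ∀ j, (pd j fun y => (Ser f t y).re) = fun y => (Ser (sym (dsym j) f) t y).re :=
    fun j => funext fun y => pd_re_ser hf j t y
  have h2 : sym (lap κ) f =
      (κ : ℂ) • (sym (dsym 0) (sym (dsym 0) f) + sym (dsym 1) (sym (dsym 1) f)) := by
    funext k
    have := sum_dsym_sq k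
    rw [Fin.sum_univ_two] at this
    simp only [sym, Pi.smul_apply, Pi.add_apply, smul_smul, ← add_smul, this, lap]
    congr 1
    push_cast
    ring
  rw [h2, ser_smul, Complex.re_ofReal_mul,
    re_ser_add (hs _ (hs _ hf)) (hs _ (hs _ hf)), Fin.sum_univ_two, h1, h1,
    pd_re_ser (hs _ hf), pd_re_ser (hs _ hf)]

lemma advect_eq (hu : ∀ i, Rapid (u i)) (huh : ∀ i, Herm (u i))
    (hdiv : ∑ i, sym (dsym i) (u i) = 0) (hf : Rapid f) (hfh : Herm f) (t : ℝ) (x : Fin 2 → ℝ) :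
    ∑ j, field u t x j * pd j (fun y => (Ser f t y).re) x =
      (Ser (∑ j, sym (dsym j) (conv (u j) f)) t x).re := by
  have hs : ∀ i, Rapid (sym (dsym i) f) := fun i => hf.sym (polyBdd_dsym i)
  have hh : ∀ i, Herm (sym (dsym i) f) := fun i => hfh.sym (dsym_neg i)
  rw [sum_dsym_conv hu hf hdiv, Fin.sum_univ_two, Fin.sum_univ_two,
    re_ser_add ((hu _).conv (hs _)) ((hu _).conv (hs _)), re_ser_conv (hu _) (hs _) (huh _) (hh _),
    re_ser_conv (hu _) (hs _) (huh _) (hh _), pd_re_ser hf, pd_re_ser hf]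
  rfl

theorem IsMild.isMHD (h : IsMild ν η a b₀ u b) (hν : 0 < ν) (hη : 0 < η)
    (ha : ∀ i, RapidC (a i)) (hb : ∀ i, RapidC (b₀ i)) (had : ∀ k, ∑ i, dsym i k * a i k = 0)
    (hbd : ∀ k, ∑ i, dsym i k * b₀ i k = 0) :
    IsMHD 2 1 ν η (Ici 0) (field u) (field b) fun t x => (Ser (pressure u b) t x).re := by
  have hsm := h.sm hν hη ha hb
  have hru : ∀ i, Rapid (u i) := fun i => ((hsm 0).1 i).rapid
  have hrb : ∀ i, Rapid (b i) := fun i => ((hsm 0).2 i).rapid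
  have hdu := h.div_u had
  have hdb := h.div_b hbd
  have hsd : ∀ {v : Freq → TF} i, Rapid v → Rapid (sym (dsym i) v) :=
    fun i hv => hv.sym (polyBdd_dsym i)
  have hP : Rapid (pressure u b) := (Sm.pressure (n := 0) (hsm 0).1 (hsm 0).2).rapid
  have hFU : ∀ i, Rapid (forceU u b i) := fun i => (Sm.forceU (hsm 0).1 (hsm 0).2 i).rapid
  have hFB : ∀ i, Rapid (forceB u b i) := fun i => (Sm.forceB (hsm 0).1 (hsm 0).2 i).rapid
  have hsum : ∀ {v : Fin 2 → Freq → TF} {w : Freq → TF}, (∀ i, Rapid (v i)) → Rapid w →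
      Rapid (∑ j, sym (dsym j) (conv (v j) w)) := fun hv hw => by
    rw [Fin.sum_univ_two]
    exact (hsd _ ((hv _).conv hw)).add (hsd _ ((hv _).conv hw))
  refine ⟨contDiffOn_pi.2 fun i => contDiffOn_re_ser fun n => (hsm n).1 i,
    contDiffOn_pi.2 fun i => contDiffOn_re_ser fun n => (hsm n).2 i,
    contDiffOn_re_ser fun n => Sm.pressure (hsm n).1 (hsm n).2,
    fun t _ x i => funext fun j => prdc_re_ser (u j) t x i,
    fun t _ x i => funext fun j => prdc_re_ser (b j) t x i,
    fun t _ => prdc_re_ser _ t, fun t _ => divg_field hru hdu t, fun t _ => divg_field hrb hdb t,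
    fun t _ ht x i => ?_, fun t _ ht x i => ?_⟩
  · have key : forceU u b i + sym (dsym i) (pressure u b) +
        ∑ j, sym (dsym j) (conv (u j) (u i)) = ∑ j, sym (dsym j) (conv (b j) (b i)) := by
      rw [forceU_add_pressure, Finset.sum_sub_distrib, sub_add_cancel]
    have hl := (hru i).sym (polyBdd_lap ν)
    simp only [field]
    have e1 := advect_eq hru h.herm_u hdu (hru i) (h.herm_u i) t x
    have e2 := advect_eq hrb h.herm_b hdb (hrb i) (h.herm_b i) t x
    simp only [field] at e1 e2
    rw [e1, e2, ← re_ser_lap (hru i), deriv_re_ser (hru i) (hl.add (hFU i)) (h.td_u hν i) ht,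
      re_ser_add hl (hFU i), ← key, re_ser_add ((hFU i).add (hsd i hP)) (hsum hru (hru i)),
      re_ser_add (hFU i) (hsd i hP), ← pd_re_ser hP]
    ring
  · have key : forceB u b i + ∑ j, sym (dsym j) (conv (u j) (b i)) =
        ∑ j, sym (dsym j) (conv (b j) (u i)) := by
      funext k
      simp only [Pi.add_apply, forceB_apply, Fin.sum_univ_two, sym]
      module
    have hl := (hrb i).sym (polyBdd_lap η)
    have e1 := advect_eq hru h.herm_u hdu (hrb i) (h.herm_b i) t x
    have e2 := advect_eq hrb h.herm_b hdb (hru i) (h.herm_u i) t x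
    simp only [field] at e1 e2 ⊢
    rw [e1, e2, ← re_ser_lap (hrb i), deriv_re_ser (hrb i) (hl.add (hFB i)) (h.td_b hη i) ht,
      re_ser_add hl (hFB i), ← key, re_ser_add (hFB i) (hsum hru (hrb i))]
    ring

end Solution

section Box

/-- The integral of a derivative of a periodic function over a period cell vanishes. -/
lemma integral_box_deriv_eq_zero {f : (Fin 2 → ℝ) → ℂ} {f' : (Fin 2 → ℝ) → (Fin 2 → ℝ) →L[ℝ] ℂ}
    (hf : ∀ x, HasFDerivAt f (f' x) x) (hc : Continuous f') (hp : Prdc 1 f) (i : Fin 2) :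
    ∫ x in box 2 1, f' x (Pi.single i 1) = 0 := by
  have hfc : Continuous f := continuous_iff_continuousAt.2 fun x => (hf x).continuousAt
  have hev : Continuous fun x => f' x (Pi.single i 1) := hc.clm_apply continuous_const
  have key := integral_divergence_of_hasFDerivAt_off_countable' (n := 1) (0 : Fin 2 → ℝ)
    (fun _ => 1) (fun _ => zero_le_one) (fun j => if j = i then f else 0)
    (fun j x => if j = i then f' x else 0) ∅ countable_empty
    (fun j => by split_ifs <;> [exact hfc.continuousOn; exact continuousOn_const])
    (fun x _ j => by split_ifs <;> [exact hf x; exact hasFDerivAt_const _ _])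
    (by
      have : (fun x => ∑ j, (if j = i then f' x else 0) (Pi.single j 1)) =
          fun x => f' x (Pi.single i 1) := by
        funext x
        rw [Finset.sum_eq_single i] <;> simp +contextual
      rw [this]
      exact hev.continuousOn.integrableOn_compact isCompact_Icc)
  have e : ∀ x, ∑ j, (if j = i then f' x else 0) (Pi.single j 1) = f' x (Pi.single i 1) :=
    fun x => by rw [Finset.sum_eq_single i] <;> simp +contextual
  simp only [e] at key
  rw [box, key]
  refine Finset.sum_eq_zero fun j _ => ?_
  rw [sub_eq_zero]
  refine integral_congr_ae (Filter.Eventually.of_forall fun x => ?_)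
  split_ifs
  · have : (j.insertNth (1 : ℝ) x : Fin 2 → ℝ) =
        (j.insertNth (0 : ℝ) x : Fin 2 → ℝ) + Pi.single j 1 := by
      ext l
      fin_cases j <;> fin_cases l <;> simp [Fin.insertNth_apply_below]
    simpa [this] using hp _ j
  · rfl

end Box

section Average

lemma continuous_chr (k : Freq) : Continuous (chr k) :=
  continuous_iff_continuousAt.2 fun x => (hasFDerivAt_chr k x).continuousAt

lemma volume_box : (volume : Measure (Fin 2 → ℝ)) (box 2 1) = 1 := by
  rw [box, Real.volume_Icc_pi]
  simp

instance : IsProbabilityMeasure ((volume : Measure (Fin 2 → ℝ)).restrict (box 2 1)) :=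
  ⟨by rw [Measure.restrict_apply_univ, volume_box]⟩

lemma integrable_box {E : Type*} [NormedAddCommGroup E] {f : (Fin 2 → ℝ) → E}
    (hf : Continuous f) : IntegrableOn f (box 2 1) :=
  hf.continuousOn.integrableOn_compact isCompact_Icc

lemma dsym_ne_zero {k : Freq} (hk : k ≠ 0) : ∃ i, dsym i k ≠ 0 := by
  by_contra! h
  apply hk
  funext i
  have := h i
  rw [← norm_eq_zero, norm_dsym] at this
  simpa [pi_ne_zero] using this

lemma integral_chr (k : Freq) : ∫ x in box 2 1, chr k x = if k = 0 then 1 else 0 := by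
  split_ifs with hk
  · simp [hk, chr, Measure.real]
  · obtain ⟨i, hi⟩ := dsym_ne_zero hk
    have h := integral_box_deriv_eq_zero (hasFDerivAt_chr k)
      (continuous_finsetSum _ fun i _ => (ContinuousLinearMap.smulRightL ℝ _ _ _).continuous.comp
        (continuous_const.mul (continuous_chr k))) (prdc_chr k) i
    have e : ∀ x : Fin 2 → ℝ, (∑ j, (ContinuousLinearMap.proj j : (Fin 2 → ℝ) →L[ℝ] ℝ).smulRight
        (dsym j k * chr k x)) (Pi.single i 1) = dsym i k * chr k x := fun x => by
      rw [sum_apply, Finset.sum_eq_single i] <;>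
        simp +contextual
    simp only [e, integral_const_mul] at h
    exact (mul_eq_zero.1 h).resolve_left hi

/-- Fourier coefficients. -/
def coef (f : (Fin 2 → ℝ) → ℂ) (k : Freq) : ℂ := ∫ x in box 2 1, chr (-k) x * f x

lemma integral_ser {f : Freq → TF} (hf : WSum 0 f) (t : ℝ) :
    ∫ x in box 2 1, Ser f t x = f 0 t := by
  have h := integral_tsum_of_summable_integral_norm (μ := volume.restrict (box 2 1))
    (F := fun k x => f k t * chr k x) (fun k => integrable_box (by
      have := continuous_chr k; fun_prop))
    (by
      simp only [norm_mul, norm_chr, mul_one, integral_const, probReal_univ, one_smul]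
      exact Summable.of_nonneg_of_le (fun _ => norm_nonneg _) (fun k => (f k).norm_coe_le_norm t)
        hf.norm)
  unfold Ser
  rw [← h, tsum_eq_single 0]
  · rw [integral_const_mul, integral_chr, if_pos rfl, mul_one]
  · intro k hk
    rw [integral_const_mul, integral_chr, if_neg hk, mul_zero]

lemma continuous_ser {f : Freq → TF} (hf : Rapid f) (t : ℝ) : Continuous (Ser f t) :=
  continuous_iff_continuousAt.2 fun x => (hasFDerivAt_ser_space hf t x).continuousAt

lemma zeroAvg_field {u : Fin 2 → Freq → TF} (hu : ∀ i, Rapid (u i)) (h0 : ∀ i, u i 0 = 0) (t : ℝ) :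
    ZeroAvg 1 (field u t) := fun i => by
  have h := integral_ser (hu i 0) t
  rw [h0] at h
  have := integral_re (integrable_box (continuous_ser (hu i) t))
  simp only [RCLike.re_to_complex] at this
  simp only [field]
  rw [this, h]
  rfl

end Average

section Inversion

lemma isOpenQuotientMap_torusProj : IsOpenQuotientMap (torusProj 2 1) :=
  IsOpenQuotientMap.piMap fun _ => QuotientAddGroup.isOpenQuotientMap_mk

lemma prdc_add_int {E : Type*} {f : (Fin 2 → ℝ) → E} (hp : Prdc 1 f) (x : Fin 2 → ℝ) (i : Fin 2)
    (n : ℤ) : f (x + Pi.single i (n : ℝ)) = f x := by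
  induction n generalizing x with
  | zero => simp
  | succ n ih =>
    have h := hp (x + (Pi.single i ((n : ℤ) : ℝ) : Fin 2 → ℝ)) i
    rw [add_assoc, ← Pi.single_add] at h
    have e := ih x
    simp_all
  | pred n ih =>
    have h := hp (x + (Pi.single i ((-n - 1 : ℤ) : ℝ) : Fin 2 → ℝ)) i
    rw [add_assoc, ← Pi.single_add] at h
    have e := ih x
    simp_all

lemma eq_of_torusProj_eq {E : Type*} {f : (Fin 2 → ℝ) → E} (hp : Prdc 1 f) {x y : Fin 2 → ℝ}
    (h : torusProj 2 1 x = torusProj 2 1 y) : f x = f y := by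
  have h' : ∀ i, ∃ n : ℤ, y i = x i + n := fun i => by
    obtain ⟨n, hn⟩ := (QuotientAddGroup.eq_iff_sub_mem.1 (congr_fun h i).symm)
    exact ⟨n, by simp at hn; linarith⟩
  choose n hn using h'
  have : y = x + Pi.single 0 (n 0 : ℝ) + Pi.single 1 (n 1 : ℝ) := by
    ext i
    fin_cases i <;> simp [hn]
  rw [this, prdc_add_int hp, prdc_add_int hp]

lemma exists_lift {f : (Fin 2 → ℝ) → ℂ} (hf : Continuous f) (hp : Prdc 1 f) :
    ∃ F : C(UnitAddTorus (Fin 2), ℂ), ∀ x : Fin 2 → ℝ, F (fun i => (x i : UnitAddCircle)) = f x := by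
  have hq : Topology.IsQuotientMap (⟨torusProj 2 1, isOpenQuotientMap_torusProj.continuous⟩ :
      C(Fin 2 → ℝ, UnitAddTorus (Fin 2))) := isOpenQuotientMap_torusProj.isQuotientMap
  refine ⟨hq.lift ⟨f, hf⟩ fun x y h => eq_of_torusProj_eq hp h, fun x => ?_⟩
  exact DFunLike.congr_fun (hq.lift_comp ⟨f, hf⟩
    fun x y h => eq_of_torusProj_eq hp h) x

lemma fourier_inversion {f : (Fin 2 → ℝ) → ℂ} (hf : Continuous f) (hp : Prdc 1 f)
    (hs : Summable (coef f)) (x : Fin 2 → ℝ) : ∑' k, coef f k * chr k x = f x := by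
  obtain ⟨F, hF⟩ := exists_lift hf hp
  have hchr : ∀ (k : Freq) (x : Fin 2 → ℝ),
      UnitAddTorus.mFourier k (fun i => (x i : UnitAddCircle)) = chr k x := fun k x => by
    simp only [UnitAddTorus.mFourier, ContinuousMap.coe_mk, Fin.prod_univ_two,
      fourier_coe_apply, chr, ← Complex.exp_add]
    congr 1
    push_cast
    ring
  have hcoef : UnitAddTorus.mFourierCoeff F = coef f := by
    funext k
    rw [UnitAddTorus.mFourierCoeff_eq_integral _ _ 0]
    simp only [hchr, hF, coef, smul_eq_mul]
    have : {x : Fin 2 → ℝ | ∀ i, x i ∈ Ioc ((0 : Fin 2 → ℝ) i) ((0 : Fin 2 → ℝ) i + 1)} =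
        Set.pi univ fun _ => Ioc (0 : ℝ) 1 := by
      ext x; simp
    rw [this]
    exact setIntegral_congr_set Measure.univ_pi_Ioc_ae_eq_Icc
  have h := UnitAddTorus.hasSum_mFourier_series_apply_of_summable (f := F) (by rwa [hcoef])
    fun i => (x i : UnitAddCircle)
  simp only [hcoef, hchr, hF, smul_eq_mul] at h
  exact h.tsum_eq

end Inversion

section Coefficients

/-- Smooth periodic functions. -/
structure SP (g : (Fin 2 → ℝ) → ℝ) : Prop where
  smooth : ContDiff ℝ (⊤ : ℕ∞) g
  prdc : Prdc 1 g

lemma SP.pd {g : (Fin 2 → ℝ) → ℝ} (hg : SP g) (i : Fin 2) : SP (pd i g) := by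
  refine ⟨(hg.smooth.fderiv_right (m := (⊤ : ℕ∞)) (by simp)).clm_apply contDiff_const,
    fun x j => ?_⟩
  have : (fun y => g (y + Pi.single j 1)) = g := funext fun y => hg.prdc y j
  simp only [_root_.pd]
  rw [← fderiv_comp_add_right, this]

lemma SP.pdList {g : (Fin 2 → ℝ) → ℝ} (hg : SP g) (l : List (Fin 2)) : SP (pdList l g) := by
  induction l with
  | nil => exact hg
  | cons i l ih => exact ih.pd i

/-- Fourier coefficients of a real function. -/
def rcoef (g : (Fin 2 → ℝ) → ℝ) (k : Freq) : ℂ := coef (fun x => (g x : ℂ)) k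

lemma rcoef_pd {g : (Fin 2 → ℝ) → ℝ} (hg : SP g) (i : Fin 2) (k : Freq) :
    rcoef (pd i g) k = dsym i k * rcoef g k := by
  have hc := continuous_chr (-k)
  have hgc := hg.smooth.continuous
  have hpc := (hg.pd i).smooth.continuous
  have hd : ∀ x, HasFDerivAt (fun x => (g x : ℂ)) (Complex.ofRealCLM.comp (fderiv ℝ g x)) x :=
    fun x => Complex.ofRealCLM.hasFDerivAt.comp x
      ((hg.smooth.differentiable (by simp)) x).hasFDerivAt
  have h := integral_box_deriv_eq_zero (fun x => (hasFDerivAt_chr (-k) x).mul (hd x)) (by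
      have h1 := hg.smooth.continuous_fderiv (by simp)
      have h2 : Continuous fun x => Complex.ofRealCLM.comp (fderiv ℝ g x) :=
        continuous_const.clm_comp h1
      have h3 : Continuous fun x => ∑ i, (ContinuousLinearMap.proj i :
          (Fin 2 → ℝ) →L[ℝ] ℝ).smulRight (dsym i (-k) * chr (-k) x) :=
        continuous_finsetSum _ fun i _ => (ContinuousLinearMap.smulRightL ℝ _ _ _).continuous.comp
          (continuous_const.mul hc)
      have h4 : Continuous fun x => (g x : ℂ) := by fun_prop
      exact (hc.smul h2).add (h4.smul h3)) (fun x j => by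
        simp only [Pi.mul_apply, prdc_chr (-k) x j, hg.prdc x j]) i
  have e : ∀ x : Fin 2 → ℝ, (chr (-k) x • Complex.ofRealCLM.comp (fderiv ℝ g x) +
      (g x : ℂ) • ∑ j, (ContinuousLinearMap.proj j : (Fin 2 → ℝ) →L[ℝ] ℝ).smulRight
        (dsym j (-k) * chr (-k) x)) (Pi.single i 1) =
      chr (-k) x * (pd i g x : ℂ) - dsym i k * (chr (-k) x * g x) := fun x => by
    have e' : (∑ j, (ContinuousLinearMap.proj j : (Fin 2 → ℝ) →L[ℝ] ℝ).smulRight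
        (dsym j (-k) * chr (-k) x)) (Pi.single i 1) = dsym i (-k) * chr (-k) x := by
      rw [sum_apply, Finset.sum_eq_single i] <;> simp +contextual
    rw [add_apply, smul_apply, smul_apply, e']
    have : dsym i (-k) = -dsym i k := by simp [dsym]
    simp [this, pd]
    ring
  simp only [e] at h
  rw [integral_sub (integrable_box (by fun_prop)) (integrable_box (by fun_prop)),
    integral_const_mul, sub_eq_zero] at h
  exact h

lemma rcoef_pdList_replicate {g : (Fin 2 → ℝ) → ℝ} (hg : SP g) (i : Fin 2) (n : ℕ) (k : Freq) :
    rcoef (pdList (List.replicate n i) g) k = dsym i k ^ n * rcoef g k := by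
  induction n with
  | zero => simp [pdList]
  | succ n ih =>
    rw [List.replicate_succ, pdList, rcoef_pd (hg.pdList _), ih, pow_succ']
    ring

lemma norm_rcoef_le {g : (Fin 2 → ℝ) → ℝ} (hg : Continuous g) (k : Freq) :
    ‖rcoef g k‖ ≤ √(∫ x in box 2 1, g x ^ 2) := by
  have h1 : ‖rcoef g k‖ ≤ ∫ x in box 2 1, |g x| := by
    refine (norm_integral_le_integral_norm _).trans_eq ?_
    simp [norm_chr]
  refine h1.trans (Real.le_sqrt_of_sq_le ?_)
  set m := ∫ x in box 2 1, |g x| with hm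
  have h2 : 0 ≤ ∫ x in box 2 1, (|g x| - m) ^ 2 := integral_nonneg fun x => sq_nonneg _
  have h3 : ∀ x, (|g x| - m) ^ 2 = g x ^ 2 - 2 * m * |g x| + m ^ 2 := fun x => by
    rw [sub_sq, sq_abs]; ring
  simp only [h3] at h2
  rw [integral_add (integrable_box (by fun_prop)) (integrable_box (by fun_prop)),
    integral_sub (integrable_box (by fun_prop)) (integrable_box (by fun_prop)),
    integral_const_mul, ← hm] at h2
  simp at h2
  linarith

lemma wt_pow_le {k : Freq} (hk : k ≠ 0) (n : ℕ) :
    wt k ^ n ≤ 3 ^ n * (|(k 0 : ℝ)| ^ n + |(k 1 : ℝ)| ^ n) := by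
  have h1 : 1 ≤ max |(k 0 : ℝ)| |(k 1 : ℝ)| := by
    by_contra! h
    obtain ⟨h0, h1⟩ := max_lt_iff.1 h
    norm_cast at h0 h1
    rw [Int.abs_lt_one_iff] at h0 h1
    exact hk (funext fun i => by fin_cases i <;> assumption)
  have h2 : wt k ≤ 3 * max |(k 0 : ℝ)| |(k 1 : ℝ)| := by
    unfold wt
    linarith [le_max_left |(k 0 : ℝ)| |(k 1 : ℝ)|, le_max_right |(k 0 : ℝ)| |(k 1 : ℝ)|]
  calc wt k ^ n ≤ (3 * max |(k 0 : ℝ)| |(k 1 : ℝ)|) ^ n := pow_le_pow_left₀ (wt_pos k).le h2 n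
    _ = 3 ^ n * max |(k 0 : ℝ)| |(k 1 : ℝ)| ^ n := mul_pow _ _ _
    _ ≤ _ := by
      gcongr
      rcases max_choice |(k 0 : ℝ)| |(k 1 : ℝ)| with h | h <;> rw [h]
      · linarith [pow_nonneg (abs_nonneg (k 1 : ℝ)) n]
      · linarith [pow_nonneg (abs_nonneg (k 0 : ℝ)) n]

lemma wt_pow_mul_norm_rcoef_le {g : (Fin 2 → ℝ) → ℝ} (hg : SP g) (h0 : rcoef g 0 = 0) (n : ℕ)
    (k : Freq) : wt k ^ n * ‖rcoef g k‖ ≤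
      3 ^ n * ∑ i, √(∫ x in box 2 1, pdList (List.replicate n i) g x ^ 2) := by
  by_cases hk : k = 0
  · rw [hk, h0, norm_zero, mul_zero]
    positivity
  have h : ∀ i, |(k i : ℝ)| ^ n * ‖rcoef g k‖ ≤
      √(∫ x in box 2 1, pdList (List.replicate n i) g x ^ 2) := fun i => by
    refine le_trans ?_ (norm_rcoef_le (hg.pdList _).smooth.continuous k)
    rw [rcoef_pdList_replicate hg, norm_mul, norm_pow, norm_dsym]
    gcongr
    exact le_mul_of_one_le_left (abs_nonneg _) (by linarith [Real.pi_gt_three])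
  calc wt k ^ n * ‖rcoef g k‖ ≤ 3 ^ n * (|(k 0 : ℝ)| ^ n + |(k 1 : ℝ)| ^ n) * ‖rcoef g k‖ := by
        gcongr; exact wt_pow_le hk n
    _ = 3 ^ n * (|(k 0 : ℝ)| ^ n * ‖rcoef g k‖ + |(k 1 : ℝ)| ^ n * ‖rcoef g k‖) := by ring
    _ ≤ _ := by
      rw [Fin.sum_univ_two]
      gcongr <;> exact h _

lemma summable_wt : Summable fun k : Freq => (wt k ^ 3)⁻¹ := by
  have h1 := EisensteinSeries.summable_one_div_norm_rpow (k := 3) (by norm_num)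
  have h2 : Summable fun k : Freq => if k = 0 then (1 : ℝ) else 0 :=
    (hasSum_ite_eq 0 1).summable
  refine Summable.of_nonneg_of_le (fun k => ?_) (fun k => ?_) (h1.add h2)
  · have := wt_pos k; positivity
  · by_cases hk : k = 0
    · simp [hk, wt]
    · have h3 : 0 < ‖k‖ := norm_pos_iff.2 hk
      have h4 : ‖k‖ ≤ wt k := (pi_norm_le_iff_of_nonneg (wt_pos k).le).2 fun i => by
        rw [Int.norm_eq_abs]; exact abs_le_wt k i
      have h5 : ‖k‖ ^ (-3 : ℝ) = (‖k‖ ^ 3)⁻¹ := by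
        rw [Real.rpow_neg h3.le]; norm_cast
      rw [h5, if_neg hk, add_zero]
      gcongr

lemma rapidC_rcoef {g : (Fin 2 → ℝ) → ℝ} (hg : SP g) (h0 : rcoef g 0 = 0) :
    RapidC (rcoef g) := fun s => by
  refine Summable.of_nonneg_of_le (fun k => by have := wt_pos k; positivity) (fun k => ?_)
    (summable_wt.mul_left
      (3 ^ (s + 3) * ∑ i, √(∫ x in box 2 1, pdList (List.replicate (s + 3) i) g x ^ 2)))
  have hw := wt_pos k
  rw [← div_eq_mul_inv, le_div_iff₀ (by positivity)]
  calc _ = wt k ^ (s + 3) * ‖rcoef g k‖ := by ring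
    _ ≤ _ := wt_pow_mul_norm_rcoef_le hg h0 _ k

lemma tsum_wt_mul_norm_rcoef_le {g : (Fin 2 → ℝ) → ℝ} {R : ℝ} (hg : SP g) (h0 : rcoef g 0 = 0)
    (hR : ∀ i, √(∫ x in box 2 1, pdList (List.replicate 4 i) g x ^ 2) ≤ R) :
    ∑' k, wt k * ‖rcoef g k‖ ≤ 162 * R * ∑' k, (wt k ^ 3)⁻¹ := by
  rw [← tsum_mul_left]
  refine Summable.tsum_le_tsum (fun k => ?_) (by simpa using rapidC_rcoef hg h0 1)
    (summable_wt.mul_left _)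
  have hw := wt_pos k
  rw [← div_eq_mul_inv, le_div_iff₀ (by positivity)]
  have := wt_pow_mul_norm_rcoef_le hg h0 4 k
  rw [Fin.sum_univ_two] at this
  calc _ = wt k ^ 4 * ‖rcoef g k‖ := by ring
    _ ≤ _ := by linarith [hR 0, hR 1]

lemma rcoef_neg (g : (Fin 2 → ℝ) → ℝ) (k : Freq) : rcoef g (-k) = star (rcoef g k) := by
  simp only [rcoef, coef]
  rw [RCLike.star_def, ← integral_conj]
  congr 1
  ext x
  rw [chr_neg (-k)]
  simp

lemma rcoef_inversion {g : (Fin 2 → ℝ) → ℝ} (hg : SP g) (h0 : rcoef g 0 = 0) (x : Fin 2 → ℝ) :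
    ∑' k, rcoef g k * chr k x = g x :=
  fourier_inversion (f := fun x => (g x : ℂ)) (by have := hg.smooth.continuous; fun_prop)
    (fun x i => by simp only [hg.prdc x i])
    (Summable.of_norm (show Summable fun k => ‖rcoef g k‖ by simpa using rapidC_rcoef hg h0 0)) x

end Coefficients

section VectorFields

variable {w : (Fin 2 → ℝ) → Fin 2 → ℝ}

lemma sp_component (hw : ContDiff ℝ (⊤ : ℕ∞) w) (hp : Prdc 1 w) (i : Fin 2) : SP fun x => w x i :=
  ⟨contDiff_pi.1 hw i, fun x j => congr_fun (hp x j) i⟩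

lemma rcoef_zero_of_zeroAvg (h : ZeroAvg 1 w) (i : Fin 2) : rcoef (fun x => w x i) 0 = 0 := by
  have : ∀ x, chr (-0) x = 1 := fun x => by simp [chr]
  simp only [rcoef, coef, this, one_mul]
  rw [integral_complex_ofReal, h i, Complex.ofReal_zero]

lemma sum_dsym_rcoef (hw : ContDiff ℝ (⊤ : ℕ∞) w) (hp : Prdc 1 w) (hd : ∀ x, divg w x = 0)
    (k : Freq) : ∑ i, dsym i k * rcoef (fun x => w x i) k = 0 := by
  simp only [← rcoef_pd (sp_component hw hp _)]
  have hc : ∀ i, Continuous (pd i fun x => w x i) :=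
    fun i => ((sp_component hw hp i).pd i).smooth.continuous
  have hck := continuous_chr (-k)
  simp only [rcoef, coef]
  rw [← integral_finsetSum _ fun i _ => integrable_box (by have := hc i; fun_prop)]
  refine integral_eq_zero_of_ae (Filter.Eventually.of_forall fun x => ?_)
  have := hd x
  simp only [divg] at this
  simp only [← Finset.mul_sum, ← Complex.ofReal_sum, this]
  simp

lemma sqrt_integral_pdList_le {R : ℝ} (hw : ContDiff ℝ (⊤ : ℕ∞) w) (hp : Prdc 1 w)
    (hH : Hnorm 1 4 w = R) (i j : Fin 2) :
    √(∫ x in box 2 1, pdList (List.replicate 4 j) (fun y => w y i) x ^ 2) ≤ R := by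
  rw [← hH]
  refine Real.sqrt_le_sqrt ?_
  have hc : ∀ (α : Fin 2 → ℕ) i, Continuous (pdM α fun y => w y i) :=
    fun α i => ((sp_component hw hp i).pdList _).smooth.continuous
  have hg : ∀ m, Continuous (gradSq m w) := fun m =>
    continuous_finsetSum _ fun α _ => continuous_finsetSum _ fun i _ => (hc α i).pow 2
  have h0 : ∀ m x, 0 ≤ gradSq m w x := fun m x =>
    Finset.sum_nonneg fun α _ => Finset.sum_nonneg fun i _ => sq_nonneg _
  have h1 : ∫ x in box 2 1, gradSq 4 w x ≤ HnormSq 1 4 w :=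
    Finset.single_le_sum (f := fun m => ∫ x in box 2 1, gradSq m w x)
      (fun m _ => integral_nonneg (h0 m)) (by simp)
  refine le_trans (integral_mono (integrable_box ?_) (integrable_box (hg 4)) fun x => ?_) h1
  · exact ((sp_component hw hp i).pdList _).smooth.continuous.pow 2
  · have e : pdList (List.replicate 4 j) (fun y => w y i) =
        pdM (Pi.single j 4) (fun y => w y i) := by
      unfold pdM mIdxList
      congr 1
      fin_cases j <;> simp [List.finRange_succ]
    rw [e]
    calc _ ≤ ∑ i, pdM (Pi.single j 4) (fun y => w y i) x ^ 2 :=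
          Finset.single_le_sum (f := fun i => pdM (Pi.single j 4) (fun y => w y i) x ^ 2)
            (fun i _ => sq_nonneg _) (Finset.mem_univ i)
      _ ≤ _ := Finset.single_le_sum
            (f := fun α => ∑ i, pdM α (fun y => w y i) x ^ 2)
            (fun α _ => Finset.sum_nonneg fun i _ => sq_nonneg _)
            (by rw [Finset.Nat.mem_antidiagonalTuple]; simp)

end VectorFields

section Modes

/-- The real part of a character. -/
def cs (m : Freq) (x : Fin 2 → ℝ) : ℝ := Real.cos (2 * π * (m 0 * x 0 + m 1 * x 1))

/-- The imaginary part of a character. -/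
def sn (m : Freq) (x : Fin 2 → ℝ) : ℝ := Real.sin (2 * π * (m 0 * x 0 + m 1 * x 1))

lemma chr_eq (m : Freq) (x : Fin 2 → ℝ) : chr m x = cs m x + sn m x * Complex.I := by
  rw [chr, cs, sn, Complex.ofReal_cos, Complex.ofReal_sin, ← Complex.exp_mul_I]
  congr 1
  push_cast
  ring

lemma cs_eq (m : Freq) : cs m = fun x => (chr m x).re := by
  funext x
  simp [chr_eq]

lemma sn_eq (m : Freq) : sn m = fun x => (chr m x).im := by
  funext x
  simp [chr_eq]

lemma continuous_cs (m : Freq) : Continuous (cs m) := by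
  unfold cs; fun_prop

lemma integral_cs (m : Freq) : ∫ x in box 2 1, cs m x = if m = 0 then 1 else 0 := by
  have := integral_re (integrable_box (continuous_chr m))
  simp only [RCLike.re_to_complex, integral_chr] at this
  rw [cs_eq, this]
  split_ifs <;> simp

lemma sp_sn (m : Freq) : SP (sn m) :=
  ⟨by unfold sn; fun_prop, fun x i => by simp only [sn_eq, prdc_chr m x i]⟩

lemma pd_sn (m : Freq) (i : Fin 2) (x : Fin 2 → ℝ) : pd i (sn m) x = 2 * π * m i * cs m x := by
  have h : HasFDerivAt (sn m) (Complex.imCLM.comp (∑ j,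
      (ContinuousLinearMap.proj j : (Fin 2 → ℝ) →L[ℝ] ℝ).smulRight (dsym j m * chr m x))) x := by
    rw [sn_eq]
    exact Complex.imCLM.hasFDerivAt.comp x (hasFDerivAt_chr m x)
  have e : (∑ j, (ContinuousLinearMap.proj j : (Fin 2 → ℝ) →L[ℝ] ℝ).smulRight
      (dsym j m * chr m x)) (Pi.single i 1) = dsym i m * chr m x := by
    rw [sum_apply, Finset.sum_eq_single i] <;> simp +contextual
  rw [pd, h.fderiv, ContinuousLinearMap.comp_apply, e, chr_eq]
  simp [dsym]

lemma sn_mul_sn (m n : Freq) (x : Fin 2 → ℝ) :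
    sn m x * sn n x = (cs (m - n) x - cs (m + n) x) / 2 := by
  simp only [sn, cs, Pi.sub_apply, Pi.add_apply, Int.cast_sub, Int.cast_add]
  rw [show 2 * π * (((m 0 : ℝ) - n 0) * x 0 + ((m 1 : ℝ) - n 1) * x 1) =
    2 * π * (m 0 * x 0 + m 1 * x 1) - 2 * π * (n 0 * x 0 + n 1 * x 1) by ring,
    show 2 * π * (((m 0 : ℝ) + n 0) * x 0 + ((m 1 : ℝ) + n 1) * x 1) =
    2 * π * (m 0 * x 0 + m 1 * x 1) + 2 * π * (n 0 * x 0 + n 1 * x 1) by ring,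
    Real.cos_sub, Real.cos_add]
  ring

lemma integral_sn_mul_sn (m n : Freq) : ∫ x in box 2 1, sn m x * sn n x =
    ((if m - n = 0 then 1 else 0) - if m + n = 0 then 1 else 0) / 2 := by
  simp only [sn_mul_sn]
  rw [integral_div, integral_sub (integrable_box (continuous_cs _))
    (integrable_box (continuous_cs _)), integral_cs, integral_cs]

lemma rcoef_sn {m k : Freq} (h1 : k ≠ m) (h2 : k ≠ -m) : rcoef (sn m) k = 0 := by
  have e : ∀ x, chr (-k) x * (sn m x : ℂ) =
      (-Complex.I / 2) * (chr (-k + m) x - chr (-k + -m) x) := fun x => by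
    rw [chr_add, chr_add, chr_neg m, chr_eq m]
    simp only [RCLike.star_def, map_add, map_mul, Complex.conj_ofReal, Complex.conj_I]
    linear_combination (chr (-k) x * sn m x) * Complex.I_sq
  have h3 : -k + m ≠ 0 := fun h => h1 (by rwa [neg_add_eq_zero] at h)
  have h4 : -k + -m ≠ 0 := fun h => h2 (by rwa [neg_add_eq_zero] at h)
  simp only [rcoef, coef, e]
  rw [integral_const_mul, integral_sub (integrable_box (continuous_chr _))
    (integrable_box (continuous_chr _)), integral_chr, integral_chr, if_neg h3, if_neg h4]
  simp

lemma exp_mul_rcoef_sn (κ : ℝ) (m k : Freq) :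
    (Real.exp (-(κ * lam k)) : ℂ) * rcoef (sn m) k =
      (Real.exp (-(κ * lam m)) : ℂ) * rcoef (sn m) k := by
  by_cases h1 : k = m
  · rw [h1]
  by_cases h2 : k = -m
  · rw [h2, lam_neg]
  rw [rcoef_sn h1 h2, mul_zero, mul_zero]

/-- Linear combinations of the three sine modes of frequency `(0, 1)`, `(1, 1)` and `(1, -1)`. -/
def lc (α β γ : ℝ) (x : Fin 2 → ℝ) : ℝ :=
  α * sn ![0, 1] x + β * sn ![1, 1] x + γ * sn ![1, -1] x

lemma sp_lc (α β γ : ℝ) : SP (lc α β γ) :=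
  ⟨((contDiff_const.mul (sp_sn _).smooth).add (contDiff_const.mul (sp_sn _).smooth)).add
    (contDiff_const.mul (sp_sn _).smooth), fun x i => by
      simp only [lc, (sp_sn _).prdc x i]⟩

lemma pd_lc (α β γ : ℝ) (i : Fin 2) (x : Fin 2 → ℝ) : pd i (lc α β γ) x =
    2 * π * (α * (![0, 1] : Freq) i * cs ![0, 1] x + β * (![1, 1] : Freq) i * cs ![1, 1] x +
      γ * (![1, -1] : Freq) i * cs ![1, -1] x) := by
  have h : ∀ m, HasFDerivAt (sn m) (fderiv ℝ (sn m) x) x :=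
    fun m => ((sp_sn m).smooth.differentiable (by simp) x).hasFDerivAt
  have h' : HasFDerivAt (lc α β γ) _ x :=
    (((h ![0, 1]).const_mul α).add ((h ![1, 1]).const_mul β)).add ((h ![1, -1]).const_mul γ)
  rw [pd, h'.fderiv]
  have e : ∀ m, fderiv ℝ (sn m) x (Pi.single i 1) = 2 * π * m i * cs m x := fun m => pd_sn m i x
  simp only [add_apply, smul_apply, e, smul_eq_mul]
  ring

lemma rcoef_lc (α β γ : ℝ) (k : Freq) : rcoef (lc α β γ) k =
    α * rcoef (sn ![0, 1]) k + β * rcoef (sn ![1, 1]) k + γ * rcoef (sn ![1, -1]) k := by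
  have e : ∀ x, chr (-k) x * (lc α β γ x : ℂ) = α * (chr (-k) x * sn ![0, 1] x) +
      β * (chr (-k) x * sn ![1, 1] x) + γ * (chr (-k) x * sn ![1, -1] x) := fun x => by
    simp only [lc]
    push_cast
    ring
  have hc : ∀ m, Continuous (sn m) := fun m => (sp_sn m).smooth.continuous
  have := continuous_chr (-k)
  simp only [rcoef, coef, e]
  rw [integral_add, integral_add]
  · simp only [integral_const_mul]
  all_goals exact integrable_box (by fun_prop)

lemma integral_lc (α β γ : ℝ) : ∫ x in box 2 1, lc α β γ x = 0 := by
  have h : rcoef (lc α β γ) 0 = 0 := by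
    rw [rcoef_lc, rcoef_sn, rcoef_sn, rcoef_sn] <;> simp [funext_iff]
  have e : ∀ x, chr (-0) x = 1 := fun x => by simp [chr]
  simp only [rcoef, coef, e, one_mul] at h
  rw [integral_complex_ofReal] at h
  exact_mod_cast h

lemma lc_eq (α β γ : ℝ) (x : Fin 2 → ℝ) : lc α β γ x =
    α * sin (2 * π * x 1) + (β + γ) * (sin (2 * π * x 0) * cos (2 * π * x 1)) +
      (β - γ) * (cos (2 * π * x 0) * sin (2 * π * x 1)) := by
  simp only [lc, sn, Matrix.cons_val_zero, Matrix.cons_val_one]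
  push_cast
  rw [show 2 * π * (0 * x 0 + 1 * x 1) = 2 * π * x 1 by ring,
    show 2 * π * (1 * x 0 + 1 * x 1) = 2 * π * x 0 + 2 * π * x 1 by ring,
    show 2 * π * (1 * x 0 + -1 * x 1) = 2 * π * x 0 - 2 * π * x 1 by ring,
    Real.sin_add, Real.sin_sub]
  ring

lemma pd_zero_lc (α β γ : ℝ) (x : Fin 2 → ℝ) : pd 0 (lc α β γ) x =
    2 * π * ((β + γ) * (cos (2 * π * x 0) * cos (2 * π * x 1)) -
      (β - γ) * (sin (2 * π * x 0) * sin (2 * π * x 1))) := by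
  rw [pd_lc]
  simp only [cs, Matrix.cons_val_zero, Matrix.cons_val_one]
  push_cast
  rw [show 2 * π * (1 * x 0 + 1 * x 1) = 2 * π * x 0 + 2 * π * x 1 by ring,
    show 2 * π * (1 * x 0 + -1 * x 1) = 2 * π * x 0 - 2 * π * x 1 by ring,
    Real.cos_add, Real.cos_sub]
  ring

lemma pd_one_lc (α β γ : ℝ) (x : Fin 2 → ℝ) : pd 1 (lc α β γ) x =
    2 * π * (α * cos (2 * π * x 1) + (β - γ) * (cos (2 * π * x 0) * cos (2 * π * x 1)) -
      (β + γ) * (sin (2 * π * x 0) * sin (2 * π * x 1))) := by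
  rw [pd_lc]
  simp only [cs, Matrix.cons_val_zero, Matrix.cons_val_one]
  push_cast
  rw [show 2 * π * (0 * x 0 + 1 * x 1) = 2 * π * x 1 by ring,
    show 2 * π * (1 * x 0 + 1 * x 1) = 2 * π * x 0 + 2 * π * x 1 by ring,
    show 2 * π * (1 * x 0 + -1 * x 1) = 2 * π * x 0 - 2 * π * x 1 by ring,
    Real.cos_add, Real.cos_sub]
  ring

end Modes

section Cells

/-- The field `((p - q cos X) sin Y, q sin X cos Y)`, where `X = 2 * π * x` and `Y = 2 * π * y`. -/
def cell (p q : ℝ) (x : Fin 2 → ℝ) : Fin 2 → ℝ :=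
  ![lc p (-q / 2) (q / 2) x, lc 0 (q / 2) (q / 2) x]

variable (p q : ℝ)

lemma sp_cell (i : Fin 2) : SP fun x => cell p q x i := by
  fin_cases i <;> exact sp_lc _ _ _

lemma contDiff_cell : ContDiff ℝ (⊤ : ℕ∞) (cell p q) := contDiff_pi.2 fun i => (sp_cell p q i).smooth

lemma prdc_cell : Prdc 1 (cell p q) := fun x i => funext fun j => (sp_cell p q j).prdc x i

lemma pd_cell_zero (i : Fin 2) : pd i (fun x => cell p q x 0) = pd i (lc p (-q / 2) (q / 2)) := rfl

lemma pd_cell_one (i : Fin 2) : pd i (fun x => cell p q x 1) = pd i (lc 0 (q / 2) (q / 2)) := rfl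

lemma divg_cell (x : Fin 2 → ℝ) : divg (cell p q) x = 0 := by
  rw [divg, Fin.sum_univ_two, pd_cell_zero, pd_cell_one, pd_zero_lc, pd_one_lc]
  ring

lemma zeroAvg_cell : ZeroAvg 1 (cell p q) := fun i => by
  fin_cases i <;> exact integral_lc _ _ _

lemma L2norm_cell {M : ℝ} (hM : 0 ≤ M) : L2norm 1 (cell M M) = M := by
  have hc : ∀ m, Continuous (sn m) := fun m => (sp_sn m).smooth.continuous
  have e : ∀ x, ∑ i, cell M M x i ^ 2 = M ^ 2 * (sn ![0, 1] x * sn ![0, 1] x) +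
      M ^ 2 / 2 * (sn ![1, 1] x * sn ![1, 1] x) + M ^ 2 / 2 * (sn ![1, -1] x * sn ![1, -1] x) +
      -M ^ 2 * (sn ![0, 1] x * sn ![1, 1] x) + M ^ 2 * (sn ![0, 1] x * sn ![1, -1] x) := fun x => by
    simp only [cell, Fin.sum_univ_two, lc, Matrix.cons_val_zero, Matrix.cons_val_one]
    ring
  rw [L2norm, ← Real.sqrt_sq hM]
  congr 1
  simp only [e, Real.sqrt_sq hM]
  rw [integral_add, integral_add, integral_add, integral_add]
  · simp only [integral_const_mul, integral_sn_mul_sn]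
    norm_num [funext_iff]
    ring
  all_goals exact integrable_box (by fun_prop)

/-- The decay factor of the modes of lowest frequency. -/
def damp (κ : ℝ) : ℝ := Real.exp (-(κ * (4 * π ^ 2)))

lemma rcoef_cell (M κ : ℝ) (i : Fin 2) (k : Freq) :
    rcoef (fun x => cell (M * damp κ) (M * damp κ ^ 2) x i) k =
      rcoef (fun x => cell M M x i) k * Real.exp (-(κ * lam k)) := by
  have h0 : Real.exp (-(κ * lam ![0, 1])) = damp κ := by
    simp [lam, damp]
  have h1 : Real.exp (-(κ * lam ![1, 1])) = damp κ ^ 2 := by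
    rw [damp, ← Real.exp_nat_mul]; congr 1; simp [lam]; ring
  have h2 : Real.exp (-(κ * lam ![1, -1])) = damp κ ^ 2 := by
    rw [damp, ← Real.exp_nat_mul]; congr 1; simp [lam]; ring
  have e0 := exp_mul_rcoef_sn κ ![0, 1] k
  have e1 := exp_mul_rcoef_sn κ ![1, 1] k
  have e2 := exp_mul_rcoef_sn κ ![1, -1] k
  rw [h0] at e0
  rw [h1] at e1
  rw [h2] at e2
  fin_cases i
  · change rcoef (lc _ _ _) k = rcoef (lc _ _ _) k * _
    rw [rcoef_lc, rcoef_lc]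
    push_cast at *
    linear_combination (-(M : ℂ)) * e0 + M / 2 * e1 - M / 2 * e2
  · change rcoef (lc _ _ _) k = rcoef (lc _ _ _) k * _
    rw [rcoef_lc, rcoef_lc]
    push_cast at *
    linear_combination (-(M : ℂ) / 2) * e1 - M / 2 * e2

lemma cell_zero_axis (M y : ℝ) : cell M M ![0, y] = 0 := by
  funext i
  fin_cases i <;> simp [cell, lc_eq]
  ring

/-- The Jacobian determinant of a planar field. -/
def jac (w : (Fin 2 → ℝ) → Fin 2 → ℝ) (x : Fin 2 → ℝ) : ℝ :=
  pd 0 (fun y => w y 0) x * pd 1 (fun y => w y 1) x -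
    pd 1 (fun y => w y 0) x * pd 0 (fun y => w y 1) x

lemma jac_cell_ne_zero {p q : ℝ} (hq : 0 < q) (hqp : q < p) {x : Fin 2 → ℝ}
    (h : cell p q x = 0) : jac (cell p q) x ≠ 0 := by
  have h0 : lc p (-q / 2) (q / 2) x = 0 := congr_fun h 0
  have h1 : lc 0 (q / 2) (q / 2) x = 0 := congr_fun h 1
  rw [jac, pd_cell_zero, pd_cell_zero, pd_cell_one, pd_cell_one, pd_zero_lc, pd_zero_lc, pd_one_lc,
    pd_one_lc]
  rw [lc_eq] at h0 h1
  set c := cos (2 * π * x 0)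
  set s := sin (2 * π * x 0)
  set C := cos (2 * π * x 1)
  set S := sin (2 * π * x 1)
  have hcs : s ^ 2 + c ^ 2 = 1 := Real.sin_sq_add_cos_sq _
  have hCS : S ^ 2 + C ^ 2 = 1 := Real.sin_sq_add_cos_sq _
  have hc : c ≤ 1 := Real.cos_le_one _
  have hpos : 0 < p - q * c := by nlinarith
  have hS : S = 0 := by
    have : (p - q * c) * S = 0 := by linarith
    exact (mul_eq_zero.1 this).resolve_left hpos.ne'
  have hC : C ≠ 0 := by rintro hC; simp [hS, hC] at hCS
  have hs : s = 0 := by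
    have : q * (s * C) = 0 := by linarith
    simpa [hq.ne', hC] using this
  have hc0 : c ≠ 0 := by rintro hc; simp [hs, hc] at hcs
  have : 2 * π * ((-q / 2 + q / 2) * (c * C) - (-q / 2 - q / 2) * (s * S)) *
      (2 * π * (0 * C + (q / 2 - q / 2) * (c * C) - (q / 2 + q / 2) * (s * S))) -
      2 * π * (p * C + (-q / 2 - q / 2) * (c * C) - (-q / 2 + q / 2) * (s * S)) *
      (2 * π * ((q / 2 + q / 2) * (c * C) - (q / 2 - q / 2) * (s * S))) =
      -(2 * π) ^ 2 * (p - q * c) * q * c * C ^ 2 := by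
    rw [hS, hs]; ring
  rw [this]
  have hπ := Real.pi_pos.ne'
  have := hpos.ne'
  have := hq.ne'
  simp only [ne_eq, mul_eq_zero, neg_eq_zero, not_or]
  simp_all

end Cells

section Zeros

lemma exists_mem_box (x : Fin 2 → ℝ) : ∃ y ∈ box 2 1, torusProj 2 1 y = torusProj 2 1 x := by
  refine ⟨fun i => Int.fract (x i), ⟨fun i => Int.fract_nonneg _, fun i => (Int.fract_lt_one _).le⟩,
    funext fun i => ?_⟩
  exact AddCircle.coe_fract _

lemma exists_forall_le_of_prdc {f : (Fin 2 → ℝ) → ℝ} (hf : Continuous f) (hp : Prdc 1 f) :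
    ∃ x₀, ∀ x, f x₀ ≤ f x := by
  obtain ⟨x₀, -, h⟩ := (isCompact_Icc : IsCompact (box 2 1)).exists_isMinOn
    ⟨0, ⟨le_rfl, fun _ => zero_le_one⟩⟩ hf.continuousOn
  refine ⟨x₀, fun x => ?_⟩
  obtain ⟨y, hy, e⟩ := exists_mem_box x
  rw [← eq_of_torusProj_eq hp e]
  exact h hy

/-- Nondegeneracy of all zeros is stable under perturbations that are small in `C¹`. -/
lemma exists_jac_ne_zero_of_close {h : (Fin 2 → ℝ) → Fin 2 → ℝ} (hh : ∀ i, SP fun x => h x i)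
    (hnd : ∀ x, h x = 0 → jac h x ≠ 0) :
    ∃ ε > 0, ∀ w : (Fin 2 → ℝ) → Fin 2 → ℝ, (∀ x i, |w x i - h x i| ≤ ε) →
      (∀ x i j, |pd j (fun y => w y i) x - pd j (fun y => h y i) x| ≤ ε) →
      ∀ x, w x = 0 → jac w x ≠ 0 := by
  have hc : ∀ i, Continuous fun x => h x i := fun i => (hh i).smooth.continuous
  have hd : ∀ i j, Continuous (pd j fun y => h y i) := fun i j => ((hh i).pd j).smooth.continuous
  have hpd : ∀ i j x k, pd j (fun y => h y i) (x + Pi.single k 1) = pd j (fun y => h y i) x :=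
    fun i j => ((hh i).pd j).prdc
  have hp : ∀ i x k, h (x + Pi.single k 1) i = h x i := fun i => (hh i).prdc
  obtain ⟨x₀, h₀⟩ := exists_forall_le_of_prdc
    (f := fun x => |h x 0| + |h x 1| + |jac h x|) (by unfold jac; fun_prop)
    (fun x k => by simp only [jac, hp, hpd])
  obtain ⟨x₁, h₁⟩ := exists_forall_le_of_prdc
    (f := fun x => -(∑ i, ∑ j, |pd j (fun y => h y i) x|)) (by fun_prop)
    (fun x k => by simp only [hpd])
  set c := |h x₀ 0| + |h x₀ 1| + |jac h x₀|
  set D := ∑ i, ∑ j, |pd j (fun y => h y i) x₁|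
  have hcpos : 0 < c := by
    by_contra! hle
    have a0 := abs_nonneg (h x₀ 0)
    have a1 := abs_nonneg (h x₀ 1)
    have a2 := abs_nonneg (jac h x₀)
    exact hnd x₀ (funext (Fin.forall_fin_two.2
      ⟨abs_eq_zero.1 (by linarith), abs_eq_zero.1 (by linarith)⟩)) (abs_eq_zero.1 (by linarith))
  have hD : 0 ≤ D := by positivity
  have hdD : ∀ x i j, |pd j (fun y => h y i) x| ≤ D := fun x i j =>
    (Finset.single_le_sum (f := fun j => |pd j (fun y => h y i) x|) (fun _ _ => abs_nonneg _)
      (Finset.mem_univ j)).trans ((Finset.single_le_sum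
        (f := fun i => ∑ j, |pd j (fun y => h y i) x|) (fun _ _ => by positivity)
        (Finset.mem_univ i)).trans (neg_le_neg_iff.1 (h₁ x)))
  refine ⟨min 1 (c / (4 * D + 5)), by positivity, fun w hw hwd x hx hj => ?_⟩
  set ε := min 1 (c / (4 * D + 5))
  have hε0 : 0 < ε := by positivity
  have hε1 : ε ≤ 1 := min_le_left _ _
  have hεc : ε * (4 * D + 5) ≤ c := (le_div_iff₀ (by positivity)).1 (min_le_right _ _)
  have key : ∀ a b a' b' : ℝ, |a| ≤ D → |b| ≤ D → |a' - a| ≤ ε → |b' - b| ≤ ε →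
      |a * b - a' * b'| ≤ ε * (2 * D + 1) := fun a b a' b' ha hb ha' hb' => by
    rw [show a * b - a' * b' = -((a' - a) * b) - (a * (b' - b)) - (a' - a) * (b' - b) by ring]
    refine (abs_sub _ _).trans ((add_le_add_left (abs_sub _ _) _).trans ?_)
    rw [abs_neg, abs_mul, abs_mul, abs_mul]
    have h1 := mul_le_mul ha' hb (abs_nonneg _) hε0.le
    have h2 := mul_le_mul ha hb' (abs_nonneg _) hD
    have h3 := mul_le_mul ha' hb' (abs_nonneg _) hε0.le
    nlinarith
  have k1 := key _ _ _ _ (hdD x 0 0) (hdD x 1 1) (hwd x 0 0) (hwd x 1 1)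
  have k2 := key _ _ _ _ (hdD x 0 1) (hdD x 1 0) (hwd x 0 1) (hwd x 1 0)
  have k3 : |jac h x| ≤ ε * (4 * D + 2) := by
    rw [jac] at hj
    rw [jac, abs_le]
    rw [abs_le] at k1 k2
    constructor <;> linarith [k1.1, k1.2, k2.1, k2.2]
  have k4 : ∀ i, |h x i| ≤ ε := fun i => by simpa [hx] using hw x i
  have := h₀ x
  have := k4 0
  have := k4 1
  nlinarith

/-- Nondegenerate zeros are isolated. -/
lemma eventually_ne_zero_of_jac {w : (Fin 2 → ℝ) → Fin 2 → ℝ} {x : Fin 2 → ℝ}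
    (hw : DifferentiableAt ℝ w x) (hj : jac w x ≠ 0) : ∀ᶠ y in nhdsWithin x {x}ᶜ, w y ≠ 0 := by
  have hpd : ∀ i j, pd j (fun y => w y i) x = fderiv ℝ w x (Pi.single j 1) i := fun i j => by
    have := (hasFDerivAt_pi'.1 hw.hasFDerivAt i).fderiv
    rw [pd, this]
    rfl
  have hinj : Function.Injective (fderiv ℝ w x) := by
    rw [injective_iff_map_eq_zero]
    intro v hv
    have hv' : v = v 0 • Pi.single 0 1 + v 1 • Pi.single 1 1 := by
      ext i; fin_cases i <;> simp
    rw [hv', map_add, map_smul, map_smul] at hv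
    have e0 := congr_fun hv 0
    have e1 := congr_fun hv 1
    simp only [Pi.add_apply, Pi.smul_apply, smul_eq_mul, ← hpd, Pi.zero_apply] at e0 e1
    rw [jac] at hj
    ext i
    fin_cases i
    · refine (mul_eq_zero.1 (?_ : v 0 * _ = 0)).resolve_right hj
      linear_combination pd 1 (fun y => w y 1) x * e0 - pd 1 (fun y => w y 0) x * e1
    · refine (mul_eq_zero.1 (?_ : v 1 * _ = 0)).resolve_right hj
      linear_combination pd 0 (fun y => w y 0) x * e1 - pd 0 (fun y => w y 1) x * e0
  obtain ⟨K, -, hK⟩ := (fderiv ℝ w x).toLinearMap.exists_antilipschitzWith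
    (LinearMap.ker_eq_bot.2 hinj)
  exact hw.hasFDerivAt.eventually_ne ⟨K, hK⟩

lemma isMagLine_singleton_iff {b : (Fin 2 → ℝ) → Fin 2 → ℝ} {p : Fin 2 → AddCircle (1 : ℝ)} :
    IsMagLine 2 1 b {p} ↔ ∃ x, torusProj 2 1 x = p ∧ b x = 0 := by
  constructor
  · rintro ⟨γ, hγ, hs⟩
    have hmem : ∀ τ, torusProj 2 1 (γ τ) = p := fun τ => by
      have : torusProj 2 1 (γ τ) ∈ ({p} : Set (Fin 2 → AddCircle (1 : ℝ))) :=
        hs ▸ mem_image_of_mem _ (mem_range_self τ)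
      exact this
    have hcont : Continuous γ := continuous_iff_continuousAt.2 fun τ => (hγ τ).continuousAt
    refine ⟨γ 0, hmem 0, ?_⟩
    have hev : γ =ᶠ[nhds 0] fun _ => γ 0 := by
      filter_upwards [hcont.continuousAt.eventually (Metric.ball_mem_nhds (γ 0) one_pos)] with τ hτ
      funext i
      have h1 := congr_fun ((hmem τ).trans (hmem 0).symm) i
      obtain ⟨n, hn⟩ := AddCircle.coe_eq_zero_iff (1 : ℝ) |>.1 (sub_eq_zero.2 h1)
      have h2 : |γ τ i - γ 0 i| < 1 := (dist_le_pi_dist (γ τ) (γ 0) i).trans_lt hτ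
      have h3 : (n : ℝ) = γ τ i - γ 0 i := by simpa using hn
      rw [← h3] at h2
      have : n = 0 := Int.abs_lt_one_iff.1 (by exact_mod_cast h2)
      rw [this, Int.cast_zero] at h3
      linarith
    exact (hγ 0).unique ((hasDerivAt_const 0 (γ 0)).congr_of_eventuallyEq hev)
  · rintro ⟨x, rfl, hx⟩
    refine ⟨fun _ => x, fun τ => by rw [hx]; exact hasDerivAt_const _ _, ?_⟩
    simp

/-- A field with a curve of zeros and a field with isolated zeros have inequivalent families
of magnetic lines. -/
lemma not_magLinesEquiv {v w : (Fin 2 → ℝ) → Fin 2 → ℝ} (hv : ∀ y, v ![0, y] = 0)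
    (hw : Differentiable ℝ w) (hp : Prdc 1 w) (hj : ∀ x, w x = 0 → jac w x ≠ 0) :
    ¬ MagLinesEquiv 2 1 v w := by
  rintro ⟨φ, hφ⟩
  have hline : ∀ y : ℝ, ∃ x, torusProj 2 1 x = φ (torusProj 2 1 ![0, y]) ∧ w x = 0 := fun y =>
    isMagLine_singleton_iff.1
      (by rw [← image_singleton]; exact (hφ _).1 (isMagLine_singleton_iff.2 ⟨_, rfl, hv y⟩))
  obtain ⟨z, hz, hwz⟩ := hline 0
  have hq := isOpenQuotientMap_torusProj
  obtain ⟨U, hU, hUo, hzU⟩ := mem_nhds_iff.1 (eventually_nhdsWithin_iff.1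
    (eventually_ne_zero_of_jac (hw z) (hj z hwz)))
  have hcont : Continuous fun y : ℝ => φ (torusProj 2 1 ![0, y]) :=
    φ.continuous.comp (hq.continuous.comp (by fun_prop))
  have hev : ∀ᶠ y : ℝ in nhds 0, φ (torusProj 2 1 ![0, y]) ∈ torusProj 2 1 '' U :=
    hcont.continuousAt.eventually ((hq.isOpenMap U hUo).mem_nhds ⟨z, hzU, hz⟩)
  obtain ⟨δ, hδ, hball⟩ := Metric.eventually_nhds_iff.1 hev
  set y := min (δ / 2) (1 / 2)
  have hy0 : 0 < y := by positivity
  have hy1 : y < 1 := (min_le_right _ _).trans_lt (by norm_num)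
  obtain ⟨x', hx'U, hx'⟩ := hball (y := y)
    (by rw [dist_zero_right, Real.norm_of_nonneg hy0.le]
        exact (min_le_left _ _).trans_lt (by linarith))
  obtain ⟨x, hx, hwx⟩ := hline y
  have hwx' : w x' = 0 := by rw [eq_of_torusProj_eq hp (hx'.trans hx.symm), hwx]
  have hxz : x' = z := by
    by_contra hne
    exact hU hx'U hne hwx'
  rw [hxz] at hx'
  have h1 := congr_fun (φ.injective (hz.symm.trans hx')) 1
  have h2 : ((0 : ℝ) : AddCircle (1 : ℝ)) = (y : ℝ) := h1
  rw [AddCircle.coe_zero, eq_comm, AddCircle.coe_eq_zero_iff] at h2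
  obtain ⟨n, hn⟩ := h2
  have h3 : (n : ℝ) = y := by simpa using hn
  rw [← h3] at hy0 hy1
  have : 0 < n := by exact_mod_cast hy0
  have : n < 1 := by exact_mod_cast hy1
  omega

end Zeros

section Closeness

variable {f g : Freq → TF}

lemma abs_re_ser_sub_le (hf : Rapid f) (hg : Rapid g) (t : ℝ) (x : Fin 2 → ℝ) :
    |(Ser f t x).re - (Ser g t x).re| ≤ ∑' k, ‖f k - g k‖ := by
  have hs : Rapid (f - g) := fun s => (hf s).sub (hg s)
  have e := re_ser_add hs hg t x
  rw [sub_add_cancel] at e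
  rw [e, add_sub_cancel_right]
  exact (Complex.abs_re_le_norm _).trans (norm_ser_le (hs 0) t x)

lemma abs_pd_re_ser_sub_le (hf : Rapid f) (hg : Rapid g) (t : ℝ) (x : Fin 2 → ℝ) (j : Fin 2) :
    |pd j (fun y => (Ser f t y).re) x - pd j (fun y => (Ser g t y).re) x| ≤
      2 * π * ∑' k, wt k * ‖f k - g k‖ := by
  have hs : Rapid (f - g) := fun s => (hf s).sub (hg s)
  rw [pd_re_ser hf, pd_re_ser hg]
  refine (abs_re_ser_sub_le (hf.sym (polyBdd_dsym j)) (hg.sym (polyBdd_dsym j)) t x).trans ?_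
  rw [← tsum_mul_left]
  have h : ∀ k, ‖sym (dsym j) f k - sym (dsym j) g k‖ ≤ 2 * π * (wt k * ‖f k - g k‖) := fun k => by
    rw [sym, sym, ← smul_sub, norm_smul, norm_dsym, mul_assoc]
    have := abs_le_wt k j
    gcongr
  have hs1 : Summable fun k => 2 * π * (wt k * ‖f k - g k‖) :=
    Summable.mul_left _ (by simpa [WSum] using hs 1)
  exact Summable.tsum_le_tsum h (Summable.of_nonneg_of_le (fun _ => norm_nonneg _) h hs1) hs1

lemma tsum_norm_le_tsum_wt (hf : Rapid f) (hg : Rapid g) :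
    ∑' k, ‖f k - g k‖ ≤ ∑' k, wt k * ‖f k - g k‖ := by
  have hs : Rapid (f - g) := fun s => (hf s).sub (hg s)
  exact Summable.tsum_le_tsum (fun k => le_mul_of_one_le_left (norm_nonneg _) (one_le_wt k))
    (hs 0).norm (by simpa [WSum] using hs 1)

lemma re_ser_eq_of_rcoef {w : (Fin 2 → ℝ) → ℝ} (hw : SP w) (h0 : rcoef w 0 = 0) {t : ℝ}
    (h : ∀ k, f k t = rcoef w k) (x : Fin 2 → ℝ) : (Ser f t x).re = w x := by
  simp only [Ser, h]
  rw [rcoef_inversion hw h0, Complex.ofReal_re]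

lemma re_ser_heat_cell {η T : ℝ} (hη : 0 < η) (hT : 0 < T) (M : ℝ) (i : Fin 2) (x : Fin 2 → ℝ) :
    (Ser (fun k => rcoef (fun y => cell M M y i) k • heat (η * lam k)) T x).re =
      cell (M * damp (η * T)) (M * damp (η * T) ^ 2) x i := by
  refine re_ser_eq_of_rcoef (sp_cell _ _ i) (rcoef_zero_of_zeroAvg (zeroAvg_cell _ _) i)
    (fun k => ?_) x
  rw [rcoef_cell]
  simp only [BoundedContinuousFunction.coe_smul, smul_eq_mul]
  rw [heat_apply (mul_nonneg hη.le (lam_nonneg k)), max_eq_left hT.le, mul_right_comm]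

lemma differentiable_field {u : Fin 2 → Freq → TF} (hu : ∀ i, Rapid (u i)) (t : ℝ) :
    Differentiable ℝ (field u t) := differentiable_pi.2 fun i x =>
  (Complex.reCLM.hasFDerivAt.comp x (hasFDerivAt_ser_space (hu i) t x)).differentiableAt

lemma damp_pos (κ : ℝ) : 0 < damp κ := Real.exp_pos _

lemma damp_lt_one {κ : ℝ} (hκ : 0 < κ) : damp κ < 1 :=
  Real.exp_lt_one_iff.2 (by have := Real.pi_pos; simp only [neg_lt_zero]; positivity)

end Closeness

/-- The global solution with data `u₀` and `cell M M`, for large viscosity. -/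
theorem exists_solution {ν η T M R ε ρ : ℝ} (hη : 0 < η) (hT : 0 < T) (hν : 1 ≤ ν)
    (hρ : 2 * (162 * R * ∑' k, (wt k ^ 3)⁻¹) +
      ∑ i, ∑' k, wt k * ‖rcoef (fun y => cell M M y i) k‖ ≤ ρ)
    (hsmall : 32 * mildConst η * ρ ≤ √ν) (hclose : 2 * π * (16 * mildConst η * ρ ^ 2 / √ν) ≤ ε)
    {u₀ : (Fin 2 → ℝ) → Fin 2 → ℝ} (hu : ContDiff ℝ (⊤ : ℕ∞) u₀) (hup : Prdc 1 u₀)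
    (hud : ∀ x, divg u₀ x = 0) (hu0 : ZeroAvg 1 u₀) (huR : Hnorm 1 4 u₀ = R) :
    ∃ (u b : ℝ → (Fin 2 → ℝ) → Fin 2 → ℝ) (P : ℝ → (Fin 2 → ℝ) → ℝ),
      IsMHD 2 1 ν η (Ici 0) u b P ∧ u 0 = u₀ ∧ b 0 = cell M M ∧
      (∀ t, ZeroAvg 1 (u t) ∧ ZeroAvg 1 (b t)) ∧ Differentiable ℝ (b T) ∧ Prdc 1 (b T) ∧
      (∀ x i, |b T x i - cell (M * damp (η * T)) (M * damp (η * T) ^ 2) x i| ≤ ε) ∧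
      ∀ x i j, |pd j (fun y => b T y i) x -
        pd j (fun y => cell (M * damp (η * T)) (M * damp (η * T) ^ 2) y i) x| ≤ ε := by
  have hν0 : 0 < ν := by linarith
  have hC := mildConst_pos hη
  set a : Fin 2 → Freq → ℂ := fun i => rcoef fun x => u₀ x i
  set b₀ : Fin 2 → Freq → ℂ := fun i => rcoef fun x => cell M M x i
  have hsu := sp_component hu hup
  have ha0 : ∀ i, a i 0 = 0 := rcoef_zero_of_zeroAvg hu0
  have hb0 : ∀ i, b₀ i 0 = 0 := rcoef_zero_of_zeroAvg (zeroAvg_cell M M)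
  have har : ∀ i, RapidC (a i) := fun i => rapidC_rcoef (hsu i) (ha0 i)
  have hbr : ∀ i, RapidC (b₀ i) := fun i => rapidC_rcoef (sp_cell M M i) (hb0 i)
  have hle : ∑ i, ∑' k, wt k * ‖a i k‖ ≤ 2 * (162 * R * ∑' k, (wt k ^ 3)⁻¹) := by
    have h := fun i => tsum_wt_mul_norm_rcoef_le (hsu i) (ha0 i) (sqrt_integral_pdList_le hu hup huR i)
    rw [Fin.sum_univ_two]
    linarith [h 0, h 1]
  obtain ⟨u, b, h, hb⟩ := exists_isMild hν hη a b₀ ha0 (fun i => rcoef_neg _) (fun i => rcoef_neg _)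
    (fun i => by simpa using har i 1) (fun i => by simpa using hbr i 1)
    ((add_le_add_left hle _).trans hρ) hsmall
  have hur : ∀ i, Rapid (u i) := fun i => ((h.sm hν0 hη har hbr 0).1 i).rapid
  have hbrr : ∀ i, Rapid (b i) := fun i => ((h.sm hν0 hη har hbr 0).2 i).rapid
  have hhr : ∀ i, Rapid fun k => b₀ i k • heat (η * lam k) := fun i => (hbr i).heat _
  have hcell : ∀ i, (fun y => cell (M * damp (η * T)) (M * damp (η * T) ^ 2) y i) =
      fun y => (Ser (fun k => b₀ i k • heat (η * lam k)) T y).re := fun i =>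
    funext fun x => (re_ser_heat_cell hη hT M i x).symm
  have hpi : (1 : ℝ) ≤ 2 * π := by linarith [Real.pi_gt_three]
  refine ⟨field u, field b, fun t x => (Ser (pressure u b) t x).re,
    h.isMHD hν0 hη har hbr (sum_dsym_rcoef hu hup hud)
      (sum_dsym_rcoef (contDiff_cell M M) (prdc_cell M M) (divg_cell M M)), ?_, ?_, fun t =>
    ⟨zeroAvg_field hur (h.u_zero ha0) t, zeroAvg_field hbrr (h.b_zero hb0) t⟩,
    differentiable_field hbrr T, fun x i => funext fun j => prdc_re_ser (b j) T x i,
    fun x i => ?_, fun x i j => ?_⟩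
  · funext x i
    refine re_ser_eq_of_rcoef (hsu i) (ha0 i) (fun k => ?_) x
    rw [h.eq_u]
    simp [duh_apply_zero, heat_zero_apply, a]
  · funext x i
    refine re_ser_eq_of_rcoef (sp_cell M M i) (hb0 i) (fun k => ?_) x
    rw [h.eq_b]
    simp [duh_apply_zero, heat_zero_apply, b₀]
  · rw [congr_fun (hcell i) x]
    refine (abs_re_ser_sub_le (hbrr i) (hhr i) T x).trans
      ((tsum_norm_le_tsum_wt (hbrr i) (hhr i)).trans ((hb i).trans (le_trans ?_ hclose)))
    exact le_mul_of_one_le_left (by positivity) hpi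
  · rw [hcell i]
    refine (abs_pd_re_ser_sub_le (hbrr i) (hhr i) T x j).trans (le_trans ?_ hclose)
    exact mul_le_mul_of_nonneg_left (hb i) (by positivity)

end MHD

/-- magnetic reconnection in 2D with arbitrary large initial velocity,
Theorem 1.3 of the paper. Given `η, T, M, R > 0` there are a viscosity `ν ≥ 1` and a smooth
zero-average divergence-free field `b₀` with `‖b₀‖_{L²} = M` such that for every smooth
zero-average divergence-free `u₀` with `‖u₀‖_{H⁴} = R` there is a global smooth zero-average
solution of the MHD system with initial datum `(u₀, b₀)` exhibiting magnetic reconnection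
between times `0` and `T`. -/
theorem magnetic_reconnection_2d_large_velocity (η T M R : ℝ)
    (hη : 0 < η) (hT : 0 < T) (hM : 0 < M) (hR : 0 < R) :
    ∃ ν : ℝ, 1 ≤ ν ∧
      ∃ b₀ : (Fin 2 → ℝ) → Fin 2 → ℝ,
        ContDiff ℝ (⊤ : ℕ∞) b₀ ∧ Prdc 1 b₀ ∧ (∀ x, divg b₀ x = 0) ∧
        ZeroAvg 1 b₀ ∧ L2norm 1 b₀ = M ∧
        ∀ u₀ : (Fin 2 → ℝ) → Fin 2 → ℝ,
          ContDiff ℝ (⊤ : ℕ∞) u₀ → Prdc 1 u₀ → (∀ x, divg u₀ x = 0) → ZeroAvg 1 u₀ →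
          Hnorm 1 4 u₀ = R →
          ∃ (u b : ℝ → (Fin 2 → ℝ) → Fin 2 → ℝ) (P : ℝ → (Fin 2 → ℝ) → ℝ),
            IsMHD 2 1 ν η (Set.Ici 0) u b P ∧ u 0 = u₀ ∧ b 0 = b₀ ∧
            (∀ t : ℝ, 0 ≤ t → ZeroAvg 1 (u t) ∧ ZeroAvg 1 (b t)) ∧
            ¬ MagLinesEquiv 2 1 (b 0) (b T) := by
  have hd0 := MHD.damp_pos (η * T)
  have hd1 := MHD.damp_lt_one (mul_pos hη hT)
  have hq : M * MHD.damp (η * T) ^ 2 < M * MHD.damp (η * T) :=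
    mul_lt_mul_of_pos_left (by nlinarith) hM
  obtain ⟨ε, hε, hstab⟩ := MHD.exists_jac_ne_zero_of_close (MHD.sp_cell _ _)
    fun x hx => MHD.jac_cell_ne_zero (by positivity) hq hx
  have hC := MHD.mildConst_pos hη
  set C := MHD.mildConst η
  obtain ⟨ρ, hρ⟩ : ∃ ρ, ρ = 2 * (162 * R * ∑' k, (MHD.wt k ^ 3)⁻¹) +
      ∑ i, ∑' k, MHD.wt k * ‖MHD.rcoef (fun y => MHD.cell M M y i) k‖ := ⟨_, rfl⟩
  have hw := fun k => (MHD.wt_pos k).le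
  have hρ0 : 0 ≤ ρ := by
    have h1 : 0 ≤ ∑' k, (MHD.wt k ^ 3)⁻¹ := tsum_nonneg fun k => by have := hw k; positivity
    have h2 : ∀ i, 0 ≤ ∑' k, MHD.wt k * ‖MHD.rcoef (fun y => MHD.cell M M y i) k‖ :=
      fun i => tsum_nonneg fun k => by have := hw k; positivity
    rw [hρ]
    have h3 := Finset.sum_nonneg fun i (_ : i ∈ Finset.univ) => h2 i
    positivity
  set s := 1 + 32 * C * ρ + 32 * π * C * ρ ^ 2 / ε
  have hs1 : 1 ≤ s := by
    have : 0 ≤ 32 * C * ρ := by positivity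
    have : 0 ≤ 32 * π * C * ρ ^ 2 / ε := by positivity
    simp only [s]; linarith
  have hsν : √(s ^ 2) = s := Real.sqrt_sq (by linarith)
  have hsmall : 32 * C * ρ ≤ √(s ^ 2) := by
    rw [hsν]
    have : 0 ≤ 32 * π * C * ρ ^ 2 / ε := by positivity
    simp only [s]; linarith
  have hclose : 2 * π * (16 * C * ρ ^ 2 / √(s ^ 2)) ≤ ε := by
    have h1 : 32 * π * C * ρ ^ 2 / ε ≤ s := by
      have : 0 ≤ 32 * C * ρ := by positivity
      simp only [s]; linarith
    rw [hsν, ← mul_div_assoc, div_le_iff₀ (by linarith)]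
    rw [div_le_iff₀ hε] at h1
    linarith
  refine ⟨s ^ 2, one_le_pow₀ hs1, MHD.cell M M, MHD.contDiff_cell M M, MHD.prdc_cell M M,
    MHD.divg_cell M M, MHD.zeroAvg_cell M M, MHD.L2norm_cell hM.le, fun u₀ hu hup hud hu0 huR => ?_⟩
  obtain ⟨u, b, P, hMHD, hu₀, hb₀, havg, hdiff, hper, h0, h1⟩ :=
    MHD.exists_solution hη hT (one_le_pow₀ hs1) hρ.ge hsmall hclose hu hup hud hu0 huR
  refine ⟨u, b, P, hMHD, hu₀, hb₀, fun t _ => havg t, ?_⟩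
  rw [hb₀]
  exact MHD.not_magLinesEquiv (MHD.cell_zero_axis M) hdiff hper (hstab (b T) h0 h1)

end
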